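/- arXiv:2510.17743 — 2 statements merged into one kernel-verified Lean document; each statement's English description precedes it below -/
import Mathlib

section
/- Let n and k be integers with 10^36 ≤ k ≤ 0.9·n. Then there exists a subset S ⊆ [n]² that contains exactly k points on each horizontal line {(x, c) : x ∈ ℝ} with c ∈ {1,…,n} and on each vertical line {(c, y) : y ∈ ℝ} with c ∈ {1,…,n}, and contains at most k·(w(L) + 0.01) points on every line L ∈ 𝓛 that is neither horizontal nor vertical. -/
open Set

noncomputable section

/-- The grid `[n]² = {1,…,n}²` regarded as a subset of `ℝ²`. -/
def grid2 (n : ℕ) : Set (ℝ × ℝ) :=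
  {p | ∃ a b : ℤ, 1 ≤ a ∧ a ≤ (n : ℤ) ∧ 1 ≤ b ∧ b ≤ (n : ℤ) ∧ p = ((a : ℝ), (b : ℝ))}

/-- An (affine) line in `ℝ²`: a one-dimensional affine subspace of `ℝ²`. -/
def IsLine (L : AffineSubspace ℝ (ℝ × ℝ)) : Prop :=
  Module.finrank ℝ L.direction = 1

/-- Membership in `𝓛`: lines intersecting the grid `[n]²` in at least two points. -/
def InLines (n : ℕ) (L : AffineSubspace ℝ (ℝ × ℝ)) : Prop :=
  IsLine L ∧ 2 ≤ (grid2 n ∩ (L : Set (ℝ × ℝ))).ncard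

/-- The weight `w(L) = |[n]² ∩ L| / n` of a line `L`. -/
def lineWeight (n : ℕ) (L : AffineSubspace ℝ (ℝ × ℝ)) : ℝ :=
  ((grid2 n ∩ (L : Set (ℝ × ℝ))).ncard : ℝ) / n

/-- A horizontal line `{(x, c) : x ∈ ℝ}`. -/
def IsHorizontalLine (L : AffineSubspace ℝ (ℝ × ℝ)) : Prop :=
  ∃ c : ℝ, (L : Set (ℝ × ℝ)) = {p | p.2 = c}

/-- A vertical line `{(c, y) : y ∈ ℝ}`. -/
def IsVerticalLine (L : AffineSubspace ℝ (ℝ × ℝ)) : Prop :=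
  ∃ c : ℝ, (L : Set (ℝ × ℝ)) = {p | p.1 = c}

/-- The number of points of a finite type satisfying a predicate, as a real number. -/
def cnt {Ω : Type*} [Fintype Ω] (P : Ω → Prop) : ℝ := by
  classical exact ((Finset.univ.filter P).card : ℝ)

lemma cnt_eq_card {Ω : Type*} [Fintype Ω] (P : Ω → Prop) [DecidablePred P] :
    cnt P = ((Finset.univ.filter P).card : ℝ) := by
  unfold cnt; congr

lemma cnt_nonneg {Ω : Type*} [Fintype Ω] (P : Ω → Prop) : 0 ≤ cnt P := by
  unfold cnt; positivity

lemma cnt_mono {Ω : Type*} [Fintype Ω] {P Q : Ω → Prop} (h : ∀ ω, P ω → Q ω) :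
    cnt P ≤ cnt Q := by
  classical
  unfold cnt
  exact_mod_cast Finset.card_le_card (Finset.monotone_filter_right _ (fun ω _ => h ω))

lemma cnt_and_add_not {Ω : Type*} [Fintype Ω] (P Q : Ω → Prop) :
    cnt (fun ω => P ω ∧ Q ω) + cnt (fun ω => ¬ P ω ∧ Q ω) = cnt Q := by
  classical
  unfold cnt
  have := Finset.card_filter_add_card_filter_not (s := Finset.univ.filter Q) (fun ω => P ω)
  rw [Finset.filter_filter, Finset.filter_filter] at this
  simp only [and_comm (a := P _), and_comm (a := ¬ P _)]
  exact_mod_cast this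

lemma cnt_or_le {Ω : Type*} [Fintype Ω] (P Q : Ω → Prop) :
    cnt (fun ω => P ω ∨ Q ω) ≤ cnt P + cnt Q := by
  classical
  have := Finset.card_union_le (Finset.univ.filter P) (Finset.univ.filter Q)
  rw [← Finset.filter_or] at this
  rw [cnt_eq_card, cnt_eq_card, cnt_eq_card]
  exact_mod_cast this

/-- Predicates on a finite product depending on disjoint sets of coordinates are independent. -/
lemma cnt_and_mul_cnt_true {κ : Type*} [Fintype κ] [DecidableEq κ] {α : κ → Type*}
    [∀ i, Fintype (α i)] {P Q : (∀ i, α i) → Prop} {U V : Set κ}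
    (hP : DependsOn P U) (hQ : DependsOn Q V) (h : Disjoint U V) :
    cnt (fun ω => P ω ∧ Q ω) * cnt (fun _ : ∀ i, α i => True) = cnt P * cnt Q := by
  classical
  unfold cnt
  norm_cast
  rw [← Finset.card_product, ← Finset.card_product]
  let f : ((∀ i, α i) × (∀ i, α i)) → ((∀ i, α i) × (∀ i, α i)) :=
    fun p => (fun i => if i ∈ U then p.1 i else p.2 i, fun i => if i ∈ U then p.2 i else p.1 i)
  have hff : ∀ p, f (f p) = p := by
    rintro ⟨a, b⟩
    simp only [f, Prod.mk.injEq]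
    constructor <;> · funext i; split_ifs <;> rfl
  have h1 : ∀ p, P (f p).1 ↔ P p.1 := fun p => by
    have := hP (x := (f p).1) (y := p.1) (fun i hi => by simp [f, hi])
    rw [this]
  have h2 : ∀ p, Q (f p).2 ↔ Q p.1 := fun p => by
    have := hQ (x := (f p).2) (y := p.1) (fun i hi => by
      have : i ∉ U := fun hu => Set.disjoint_left.mp h hu hi
      simp [f, this])
    rw [this]
  refine Finset.card_nbij' f f ?_ ?_ (fun p _ => hff p) (fun p _ => hff p)
  · intro p hp
    simp only [Finset.coe_product, Finset.coe_filter, Finset.mem_univ, true_and, Set.mem_prod,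
      Set.mem_ofPred_eq, and_true] at hp ⊢
    exact ⟨(h1 p).2 hp.1, (h2 p).2 hp.2⟩
  · intro p hp
    simp only [Finset.coe_product, Finset.coe_filter, Finset.mem_univ, true_and, Set.mem_prod,
      Set.mem_ofPred_eq, and_true] at hp ⊢
    refine ⟨(h1 p).2 hp.1, ?_⟩
    have := h2 (f p)
    rw [hff] at this
    exact this.1 hp.2

/-- The asymmetric Lovász local lemma on a finite product space. -/
theorem exists_avoiding {κ β : Type*} [Fintype κ] [DecidableEq κ] {α : κ → Type*}
    [∀ i, Fintype (α i)] [∀ i, Nonempty (α i)] (𝓑 : Finset β) (supp : β → Finset κ)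
    (bad : β → (∀ i, α i) → Prop) (hdep : ∀ B ∈ 𝓑, DependsOn (bad B) (supp B : Set κ))
    (w : β → ℝ) (hw0 : ∀ B ∈ 𝓑, 0 ≤ w B) (hw1 : ∀ B ∈ 𝓑, w B ≤ 1 / 2)
    (hp : ∀ B ∈ 𝓑, cnt (bad B) ≤
      w B * Real.exp (-2 * ∑ v ∈ supp B, ∑ B' ∈ 𝓑 with v ∈ supp B', w B') *
        cnt (fun _ : ∀ i, α i => True)) :
    ∃ ω, ∀ B ∈ 𝓑, ¬ bad B ω := by
  classical
  let av : Finset β → (∀ i, α i) → Prop := fun T ω => ∀ B ∈ T, ¬ bad B ω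
  have hins : ∀ B T, cnt (fun ω => bad B ω ∧ av T ω) + cnt (av (insert B T)) = cnt (av T) := by
    intro B T
    rw [← cnt_and_add_not (bad B) (av T)]
    congr 2
    funext ω
    simp [av]
  have htrue : 0 < cnt (fun _ : ∀ i, α i => True) := by
    unfold cnt
    simp only [Finset.filter_true, Finset.card_univ]
    exact_mod_cast Fintype.card_pos
  have key : ∀ T ⊆ 𝓑, ∀ B ∈ 𝓑, cnt (fun ω => bad B ω ∧ av T ω) ≤ w B * cnt (av T) := by
    intro T
    induction T using Finset.strongInduction with
    | H T ih =>
    intro hT B hB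
    set T1 := T.filter (fun B' => ¬ Disjoint (supp B) (supp B')) with hT1
    set T2 := T.filter (fun B' => Disjoint (supp B) (supp B')) with hT2
    have chain : ∀ U ⊆ T1, (∏ B' ∈ U, (1 - w B')) * cnt (av T2) ≤ cnt (av (U ∪ T2)) := by
      intro U
      induction U using Finset.induction_on with
      | empty => intro _; simp
      | insert B' U hB' ihU =>
        intro hU
        have hU' : U ⊆ T1 := (Finset.subset_insert _ _).trans hU
        have hB'1 : B' ∈ T1 := hU (Finset.mem_insert_self _ _)
        have hB'T : B' ∈ T := (Finset.mem_filter.1 hB'1).1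
        have hsub : U ∪ T2 ⊆ T := Finset.union_subset
          (hU'.trans (Finset.filter_subset _ _)) (Finset.filter_subset _ _)
        have hnot : B' ∉ U ∪ T2 := by
          rw [Finset.mem_union, not_or]
          refine ⟨hB', fun h => (Finset.mem_filter.1 hB'1).2 (Finset.mem_filter.1 h).2⟩
        have h1 := ih (U ∪ T2) ((Finset.ssubset_iff_of_subset hsub).2 ⟨B', hB'T, hnot⟩)
          (hsub.trans hT) B' (hT hB'T)
        have h2 := hins B' (U ∪ T2)
        have h3 := ihU hU'
        rw [Finset.prod_insert hB', Finset.insert_union]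
        have h4 : 0 ≤ 1 - w B' := by linarith [hw1 B' (hT hB'T)]
        calc (1 - w B') * (∏ B' ∈ U, (1 - w B')) * cnt (av T2)
            = (1 - w B') * ((∏ B' ∈ U, (1 - w B')) * cnt (av T2)) := by ring
          _ ≤ (1 - w B') * cnt (av (U ∪ T2)) := by gcongr
          _ ≤ _ := by linarith
    have hT12 : T1 ∪ T2 = T := by
      rw [Finset.union_comm]; exact Finset.filter_union_filter_not_eq _ _
    have hc := chain T1 subset_rfl
    rw [hT12] at hc
    have hprod : Real.exp (-2 * ∑ v ∈ supp B, ∑ B' ∈ 𝓑 with v ∈ supp B', w B') ≤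
        ∏ B' ∈ T1, (1 - w B') := by
      have hT1B : T1 ⊆ 𝓑 := (Finset.filter_subset _ _).trans hT
      calc _ ≤ Real.exp (∑ B' ∈ T1, (-2 * w B')) := by
            apply Real.exp_le_exp.2
            rw [← Finset.mul_sum]
            have : ∑ B' ∈ T1, w B' ≤ ∑ v ∈ supp B, ∑ B' ∈ 𝓑 with v ∈ supp B', w B' := by
              simp_rw [Finset.sum_filter]
              rw [Finset.sum_comm]
              calc ∑ B' ∈ T1, w B' ≤ ∑ B' ∈ T1, ∑ v ∈ supp B, if v ∈ supp B' then w B' else 0 := by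
                    apply Finset.sum_le_sum
                    intro B' hB'
                    obtain ⟨v, hv, hv'⟩ := Finset.not_disjoint_iff.1 (Finset.mem_filter.1 hB').2
                    have h0 := hw0 B' (hT1B hB')
                    calc w B' = if v ∈ supp B' then w B' else 0 := by simp [hv']
                      _ ≤ _ := Finset.single_le_sum
                        (f := fun v => if v ∈ supp B' then w B' else 0)
                        (fun i _ => by split_ifs <;> simp [h0]) hv
                _ ≤ _ := by
                    apply Finset.sum_le_sum_of_subset_of_nonneg hT1B
                    intro i hi _
                    exact Finset.sum_nonneg fun v _ => by
                      split_ifs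
                      · exact hw0 i hi
                      · exact le_rfl
            linarith
        _ = ∏ B' ∈ T1, Real.exp (-2 * w B') := Real.exp_sum _ _
        _ ≤ _ := by
            apply Finset.prod_le_prod (fun _ _ => (Real.exp_pos _).le)
            intro B' hB'
            have h0 := hw0 B' (hT1B hB')
            have h1 := hw1 B' (hT1B hB')
            have h2 := Real.add_one_le_exp (2 * w B')
            rw [neg_mul, Real.exp_neg, inv_le_comm₀ (Real.exp_pos _) (by linarith)]
            refine le_trans ?_ h2
            rw [inv_le_iff_one_le_mul₀ (by linarith)]
            nlinarith
    have hav2 : DependsOn (av T2) {v | ∃ B' ∈ T2, v ∈ supp B'} := by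
      intro x y hxy
      have : ∀ B' ∈ T2, bad B' x = bad B' y := fun B' hB' =>
        hdep B' (hT (Finset.mem_filter.1 hB').1) (fun i hi => hxy i ⟨B', hB', hi⟩)
      simp only [av]
      exact propext ⟨fun h B' hB' => this B' hB' ▸ h B' hB',
        fun h B' hB' => (this B' hB').symm ▸ h B' hB'⟩
    have hind := cnt_and_mul_cnt_true (hdep B hB) hav2 (by
      rw [Set.disjoint_left]
      rintro v hv ⟨B', hB', hv'⟩
      exact Finset.disjoint_left.1 (Finset.mem_filter.1 hB').2 hv hv')
    have hmono : cnt (fun ω => bad B ω ∧ av T ω) ≤ cnt (fun ω => bad B ω ∧ av T2 ω) :=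
      cnt_mono fun ω h => ⟨h.1, fun B' hB' => h.2 B' (Finset.mem_filter.1 hB').1⟩
    refine hmono.trans (le_of_mul_le_mul_right ?_ htrue)
    rw [hind]
    calc cnt (bad B) * cnt (av T2) ≤ w B * (∏ B' ∈ T1, (1 - w B')) *
          cnt (fun _ : ∀ i, α i => True) * cnt (av T2) := by
          refine mul_le_mul_of_nonneg_right ((hp B hB).trans ?_) (cnt_nonneg _)
          have := hw0 B hB
          gcongr
      _ = w B * ((∏ B' ∈ T1, (1 - w B')) * cnt (av T2)) * cnt (fun _ : ∀ i, α i => True) := by ring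
      _ ≤ _ := by
          have := hw0 B hB
          gcongr
  have hpos : ∀ T ⊆ 𝓑, 0 < cnt (av T) := by
    intro T
    induction T using Finset.induction_on with
    | empty => intro _; simpa [av] using htrue
    | insert B T hB ih =>
      intro hT
      have h1 := ih ((Finset.subset_insert _ _).trans hT)
      have hB' := hT (Finset.mem_insert_self _ _)
      have h2 := key T ((Finset.subset_insert _ _).trans hT) B hB'
      have h3 := hins B T
      nlinarith [hw1 B hB']
  have h := hpos 𝓑 subset_rfl
  rw [cnt_eq_card] at h
  obtain ⟨ω, hω⟩ := Finset.card_pos.1 (Nat.cast_pos.1 h)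
  exact ⟨ω, (Finset.mem_filter.1 hω).2⟩

lemma card_powersetCard_filter_mem_le {κ : Type*} [DecidableEq κ] (T : Finset κ) (s : ℕ) (v : κ) :
    ((T.powersetCard s).filter (fun Q => v ∈ Q)).card ≤
      if v ∈ T then T.card.choose (s - 1) else 0 := by
  split_ifs with hv
  · rw [← Finset.card_powersetCard]
    refine Finset.card_le_card_of_injOn (fun Q => Q.erase v) ?_ ?_
    · intro Q hQ
      simp only [Finset.coe_filter, Finset.mem_powersetCard, Set.mem_ofPred_eq] at hQ
      simp only [SetLike.mem_coe,
        Finset.mem_powersetCard]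
      exact ⟨(Finset.erase_subset _ _).trans hQ.1.1, by
        rw [Finset.card_erase_of_mem hQ.2, hQ.1.2]⟩
    · intro Q hQ Q' hQ' h
      simp only [Finset.coe_filter, Finset.mem_powersetCard, Set.mem_ofPred_eq] at hQ hQ'
      rw [← Finset.insert_erase hQ.2, ← Finset.insert_erase hQ'.2]
      simp only at h
      rw [h]
  · rw [Nat.le_zero, Finset.card_eq_zero, Finset.filter_eq_empty_iff]
    intro Q hQ hvQ
    exact hv ((Finset.mem_powersetCard.1 hQ).1 hvQ)

/-- Counting the points of a finite product subject to independent constraints on the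
coordinates in `Q`. -/
lemma cnt_forall_mem_le {κ : Type*} [Fintype κ] [DecidableEq κ] {α : κ → Type*}
    [∀ i, Fintype (α i)] (Q : Finset κ) (hit : ∀ P, α P → Prop) {θ : ℝ}
    (hθ : ∀ P, cnt (hit P) ≤ θ * Fintype.card (α P)) :
    cnt (fun ω : ∀ i, α i => ∀ P ∈ Q, hit P (ω P)) ≤
      θ ^ Q.card * cnt (fun _ : ∀ i, α i => True) := by
  classical
  have h1 : (Finset.univ.filter (fun ω : ∀ i, α i => ∀ P ∈ Q, hit P (ω P))) =
      Fintype.piFinset (fun P => if P ∈ Q then Finset.univ.filter (hit P) else Finset.univ) := by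
    ext ω
    simp only [Finset.mem_filter, Finset.mem_univ, true_and, Fintype.mem_piFinset]
    refine forall_congr' fun P => ?_
    by_cases hP : P ∈ Q <;> simp [hP]
  rw [cnt_eq_card, h1, Fintype.card_piFinset, cnt_eq_card, Finset.filter_true, Finset.card_univ,
    Fintype.card_pi]
  push_cast
  calc _ ≤ ∏ P, ((if P ∈ Q then θ else 1) * (Fintype.card (α P) : ℝ)) := by
        refine Finset.prod_le_prod (fun _ _ => by positivity) fun P _ => ?_
        split_ifs
        · rw [← cnt_eq_card]; exact hθ P
        · simp
    _ = _ := by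
        rw [Finset.prod_mul_distrib, Finset.prod_ite_mem, Finset.univ_inter, Finset.prod_const]

/-- If every coordinate is chosen from a finite set, then every test `j` can be made to be hit by
fewer than `s j` coordinates, as long as the expected numbers of hit `s j`-tuples are small. -/
theorem exists_choice {κ J : Type*} [Fintype κ] [DecidableEq κ] {α : κ → Type*}
    [∀ i, Fintype (α i)] [∀ i, Nonempty (α i)] (𝓙 : Finset J) (hit : J → ∀ P, α P → Prop)
    (T : J → Finset κ) (θ : J → ℝ) (s : J → ℕ) (hθ0 : ∀ j ∈ 𝓙, 0 ≤ θ j)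
    (hθ : ∀ j ∈ 𝓙, ∀ P, cnt (hit j P) ≤ θ j * Fintype.card (α P))
    (hT : ∀ j ∈ 𝓙, ∀ P o, hit j P o → P ∈ T j) (hs : ∀ j ∈ 𝓙, 1 ≤ s j)
    (hθ1 : ∀ j ∈ 𝓙, 3 * θ j ≤ 1 / 2)
    (hsum : ∀ P, ∑ j ∈ 𝓙 with P ∈ T j, (3 * θ j) ^ s j * ((T j).card.choose (s j - 1) : ℝ)
      ≤ 1 / 2) :
    ∃ ω : ∀ P, α P, ∀ j ∈ 𝓙, cnt (fun P => hit j P (ω P)) < s j := by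
  classical
  have hw0 : ∀ j ∈ 𝓙, 0 ≤ (3 * θ j) ^ s j := fun j hj => by
    have := hθ0 j hj
    positivity
  obtain ⟨ω, hω⟩ := exists_avoiding (α := α)
    (𝓙.sigma (fun j => (T j).powersetCard (s j))) (fun B => B.2)
    (fun B ω => ∀ P ∈ B.2, hit B.1 P (ω P)) (by
      intro B _ x y hxy
      refine propext (forall₂_congr fun P hP => ?_)
      rw [hxy P hP]) (fun B => (3 * θ B.1) ^ s B.1)
    (fun B hB => hw0 _ (Finset.mem_sigma.1 hB).1)
    (fun B hB => by
      have hj := (Finset.mem_sigma.1 hB).1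
      have := hθ0 _ hj
      have h1 := hθ1 _ hj
      exact (pow_le_of_le_one (by positivity) (by linarith)
        (Nat.one_le_iff_ne_zero.1 (hs _ hj))).trans h1)
    (fun B hB => by
      obtain ⟨hj, hQ⟩ := Finset.mem_sigma.1 hB
      have h0 := hθ0 _ hj
      have hcard := (Finset.mem_powersetCard.1 hQ).2
      have hin : ∀ v, ∑ B' ∈ 𝓙.sigma (fun j => (T j).powersetCard (s j)) with v ∈ B'.2,
          (3 * θ B'.1) ^ s B'.1 ≤ 1 / 2 := by
        intro v
        refine le_trans ?_ (hsum v)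
        rw [Finset.sum_filter, Finset.sum_sigma, Finset.sum_filter]
        refine Finset.sum_le_sum fun j hj => ?_
        rw [← Finset.sum_filter]
        dsimp only
        rw [Finset.sum_const, nsmul_eq_mul, mul_comm]
        have := card_powersetCard_filter_mem_le (T j) (s j) v
        have h0 := hw0 j hj
        calc _ ≤ (3 * θ j) ^ s j * ((if v ∈ T j then (T j).card.choose (s j - 1) else 0 : ℕ) : ℝ) := by
              gcongr
          _ ≤ _ := by split_ifs <;> simp
      refine (cnt_forall_mem_le B.2 (hit B.1) (hθ _ hj)).trans ?_
      refine mul_le_mul_of_nonneg_right ?_ (cnt_nonneg _)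
      have h1 : ∑ v ∈ B.2, ∑ B' ∈ 𝓙.sigma (fun j => (T j).powersetCard (s j)) with v ∈ B'.2,
          (3 * θ B'.1) ^ s B'.1 ≤ s B.1 * (1 / 2) := by
        calc _ ≤ ∑ v ∈ B.2, (1 / 2 : ℝ) := Finset.sum_le_sum fun v _ => hin v
          _ = _ := by rw [Finset.sum_const, hcard, nsmul_eq_mul]
      rw [hcard, mul_pow, mul_right_comm]
      have h2 : 1 ≤ (3 : ℝ) ^ s B.1 * Real.exp (-2 * ∑ v ∈ B.2,
          ∑ B' ∈ 𝓙.sigma (fun j => (T j).powersetCard (s j)) with v ∈ B'.2,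
          (3 * θ B'.1) ^ s B'.1) := by
        calc (1 : ℝ) = Real.exp 1 ^ s B.1 * Real.exp (-2 * (s B.1 * (1 / 2))) := by
              rw [← Real.exp_nat_mul, ← Real.exp_add, eq_comm, Real.exp_eq_one_iff]
              ring
          _ ≤ _ := by
              gcongr ?_ ^ _ * Real.exp ?_
              · linarith [Real.exp_one_lt_d9]
              · linarith
      calc θ B.1 ^ s B.1 = 1 * θ B.1 ^ s B.1 := (one_mul _).symm
        _ ≤ _ := by gcongr)
  refine ⟨ω, fun j hj => ?_⟩
  by_contra hcon
  rw [cnt_eq_card, not_lt, Nat.cast_le] at hcon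
  obtain ⟨Q, hQ, hQc⟩ := Finset.exists_subset_card_eq hcon
  refine hω ⟨j, Q⟩ (Finset.mem_sigma.2 ⟨hj, Finset.mem_powersetCard.2 ⟨fun P hP => ?_, hQc⟩⟩) ?_
  · exact hT j hj P _ (Finset.mem_filter.1 (hQ hP)).2
  · intro P hP
    exact (Finset.mem_filter.1 (hQ hP)).2

/-- Exponential moment bound for the number of points of `Y` that are kept when every point is
kept independently with probability `r / R`. -/
lemma sum_exp_card_le {V : Type*} [Fintype V] [DecidableEq V] (Y : Finset V) {r R : ℕ}
    (hrR : r ≤ R) (hR : 0 < R) (l : ℝ) :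
    ∑ ω : V → Fin R, Real.exp (l * (Y.filter (fun v => (ω v : ℕ) < r)).card) ≤
      Real.exp (Y.card * r / R * (Real.exp l - 1)) * cnt (fun _ : V → Fin R => True) := by
  classical
  have hR' : (0 : ℝ) < R := by exact_mod_cast hR
  have h1 : ∀ ω : V → Fin R, Real.exp (l * (Y.filter (fun v => (ω v : ℕ) < r)).card) =
      ∏ v, if v ∈ Y ∧ (ω v : ℕ) < r then Real.exp l else 1 := by
    intro ω
    rw [mul_comm, Real.exp_nat_mul, ← Finset.prod_const, Finset.prod_filter]
    simp_rw [ite_and]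
    rw [Finset.prod_ite_mem, Finset.univ_inter]
  simp_rw [h1]
  rw [← Fintype.piFinset_univ, ← Finset.prod_univ_sum (fun _ : V => (Finset.univ : Finset (Fin R)))
    (fun v x => if v ∈ Y ∧ (x : ℕ) < r then Real.exp l else 1), cnt_eq_card, Finset.filter_true,
    Finset.card_univ, Fintype.card_pi]
  have h2 : ∀ v, ∑ x : Fin R, (if v ∈ Y ∧ (x : ℕ) < r then Real.exp l else 1) ≤
      (if v ∈ Y then Real.exp (r / R * (Real.exp l - 1)) else 1) * R := by
    intro v
    split_ifs with hv
    · have hc : (Finset.univ.filter (fun x : Fin R => (x : ℕ) < r)).card = r := by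
        rw [Fin.card_filter_val_lt]; omega
      have : ∑ x : Fin R, (if v ∈ Y ∧ (x : ℕ) < r then Real.exp l else 1) =
          r * (Real.exp l - 1) + R := by
        simp only [hv, true_and]
        have : ∀ x : Fin R, (if (x : ℕ) < r then Real.exp l else 1) =
          (if (x : ℕ) < r then Real.exp l - 1 else 0) + 1 := fun x => by split_ifs <;> ring
        simp_rw [this]
        rw [Finset.sum_add_distrib, ← Finset.sum_filter, Finset.sum_const, hc]
        simp
      rw [this]
      have := Real.add_one_le_exp (r / R * (Real.exp l - 1))
      calc (r : ℝ) * (Real.exp l - 1) + R = (r / R * (Real.exp l - 1) + 1) * R := by field_simp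
        _ ≤ _ := by gcongr
    · simp [hv]
  calc _ ≤ ∏ v : V, (if v ∈ Y then Real.exp (r / R * (Real.exp l - 1)) else 1) * (R : ℝ) :=
        Finset.prod_le_prod (fun v _ => Finset.sum_nonneg fun x _ => by
          split_ifs <;> positivity) fun v _ => h2 v
    _ = _ := by
      rw [Finset.prod_mul_distrib, Finset.prod_ite_mem, Finset.univ_inter, Finset.prod_const,
        ← Real.exp_nat_mul]
      push_cast
      simp only [Fintype.card_fin]
      congr 2
      ring

/-- Chernoff bound for the number of points of `Y` that are kept when every point is kept
independently with probability `r / R`. -/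
lemma cnt_card_le {V : Type*} [Fintype V] [DecidableEq V] (Y : Finset V) {r R : ℕ}
    (hrR : r ≤ R) (hR : 0 < R) (l τ : ℝ) :
    cnt (fun ω : V → Fin R => l * τ ≤ l * (Y.filter (fun v => (ω v : ℕ) < r)).card) ≤
      Real.exp (-(l * τ) + Y.card * r / R * (Real.exp l - 1)) *
        cnt (fun _ : V → Fin R => True) := by
  classical
  have h := sum_exp_card_le Y hrR hR l
  have h1 : cnt (fun ω : V → Fin R => l * τ ≤ l * (Y.filter (fun v => (ω v : ℕ) < r)).card) *
      Real.exp (l * τ) ≤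
      ∑ ω : V → Fin R, Real.exp (l * (Y.filter (fun v => (ω v : ℕ) < r)).card) := by
    rw [cnt_eq_card, ← nsmul_eq_mul, ← Finset.sum_const]
    calc _ ≤ ∑ ω : V → Fin R with l * τ ≤ l * (Y.filter (fun v => (ω v : ℕ) < r)).card,
          Real.exp (l * (Y.filter (fun v => (ω v : ℕ) < r)).card) :=
          Finset.sum_le_sum fun ω hω => Real.exp_le_exp.2 (Finset.mem_filter.1 hω).2
      _ ≤ _ := Finset.sum_le_sum_of_subset_of_nonneg (Finset.filter_subset _ _)
          fun _ _ _ => (Real.exp_pos _).le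
  rw [Real.exp_add, Real.exp_neg, mul_assoc, ← div_eq_inv_mul, le_div_iff₀ (Real.exp_pos _)]
  exact h1.trans h

lemma exp_div_twelve_ge {y : ℝ} (hy : 10 ^ 7 ≤ y) : 10 ^ 125 * y ^ 125 ≤ Real.exp (y / 12) := by
  have h1 : (y / 12000) ≤ Real.exp (y / 12000) := by linarith [Real.add_one_le_exp (y / 12000)]
  have h2 : 10 * y ≤ (y / 12000) ^ 8 := by
    have : (120000 : ℝ) ≤ (y / 12000) ^ 7 := by
      calc (120000 : ℝ) ≤ (10 ^ 7 / 12000) ^ 7 := by norm_num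
        _ ≤ _ := by gcongr
    nlinarith
  calc (10 : ℝ) ^ 125 * y ^ 125 = (10 * y) ^ 125 := by rw [mul_pow]
    _ ≤ ((y / 12000) ^ 8) ^ 125 := by gcongr
    _ = (y / 12000) ^ 1000 := by rw [← pow_mul]
    _ ≤ Real.exp (y / 12000) ^ 1000 := by gcongr
    _ = _ := by rw [← Real.exp_nat_mul]; congr 1; push_cast; ring

/-- Two-sided concentration. -/
lemma cnt_abs_card_sub_le {V : Type*} [Fintype V] [DecidableEq V] (Y : Finset V) {r R : ℕ}
    (hrR : r ≤ R) (hR : 0 < R) {y M : ℝ} (hy : 10 ^ 7 ≤ y) (hyr : y ^ 5 = r)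
    (hY : (Y.card : ℝ) ≤ 3 * R) (hM : |M - Y.card * r / R| ≤ 1) :
    cnt (fun ω : V → Fin R => y ^ 3 < |((Y.filter (fun v => (ω v : ℕ) < r)).card : ℝ) - M|) ≤
      1 / (2000 * (r : ℝ) ^ 25) * cnt (fun _ : V → Fin R => True) := by
  have hR' : (0 : ℝ) < R := by exact_mod_cast hR
  have hy0 : 0 < y := by linarith
  set μ : ℝ := Y.card * r / R with hμ
  have hμ3 : μ ≤ 3 * y ^ 5 := by
    rw [hμ, hyr, div_le_iff₀ hR']
    nlinarith [(Nat.cast_nonneg r : (0 : ℝ) ≤ r)]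
  have hμ0 : 0 ≤ μ := by positivity
  obtain ⟨hM1, hM2⟩ := abs_le.1 hM
  set l : ℝ := 1 / (6 * y ^ 2) with hl
  have hl0 : 0 < l := by positivity
  have hl1 : l ≤ 1 := by
    rw [hl, div_le_one (by positivity)]; nlinarith
  have hexp : -(l * (y ^ 3 - 1)) + 3 * y ^ 5 * l ^ 2 ≤ 1 - y / 12 := by
    have : -(l * (y ^ 3 - 1)) + 3 * y ^ 5 * l ^ 2 = l - y / 12 := by
      rw [hl]; field_simp; ring
    linarith
  have hb1 := abs_le.1 (Real.abs_exp_sub_one_sub_id_le (x := l) (by rw [abs_of_pos hl0]; exact hl1))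
  have hb2 := abs_le.1 (Real.abs_exp_sub_one_sub_id_le (x := -l)
    (by rw [abs_neg, abs_of_pos hl0]; exact hl1))
  have hμl : μ * l ^ 2 ≤ 3 * y ^ 5 * l ^ 2 := by gcongr
  have hE1 : -(l * (μ + (y ^ 3 - 1))) + μ * (Real.exp l - 1) ≤ 1 - y / 12 := by
    nlinarith [mul_le_mul_of_nonneg_left hb1.2 hμ0]
  have hE2 : -(-l * (μ - (y ^ 3 - 1))) + μ * (Real.exp (-l) - 1) ≤ 1 - y / 12 := by
    nlinarith [mul_le_mul_of_nonneg_left hb2.2 hμ0]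
  have hpt : Real.exp (1 - y / 12) ≤ 1 / (4000 * (r : ℝ) ^ 25) := by
    have h1 := exp_div_twelve_ge hy
    rw [Real.exp_sub, ← hyr, ← pow_mul, div_le_div_iff₀ (Real.exp_pos _) (by positivity)]
    calc Real.exp 1 * (4000 * y ^ (5 * 25)) ≤ 3 * (4000 * y ^ (5 * 25)) := by
          gcongr; linarith [Real.exp_one_lt_d9]
      _ ≤ 1 * (10 ^ 125 * y ^ 125) := by
          have : 0 ≤ y ^ 125 := by positivity
          norm_num
          nlinarith
      _ ≤ _ := by gcongr
  have hcn := cnt_nonneg (fun _ : V → Fin R => True)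
  calc _ ≤ cnt (fun ω : V → Fin R =>
          l * (μ + (y ^ 3 - 1)) ≤ l * (Y.filter (fun v => (ω v : ℕ) < r)).card ∨
          -l * (μ - (y ^ 3 - 1)) ≤ -l * (Y.filter (fun v => (ω v : ℕ) < r)).card) := by
        refine cnt_mono fun ω h => ?_
        rcases lt_abs.1 h with h | h
        · left
          exact mul_le_mul_of_nonneg_left (by linarith) hl0.le
        · right
          rw [neg_mul, neg_mul, neg_le_neg_iff]
          exact mul_le_mul_of_nonneg_left (by linarith) hl0.le
    _ ≤ _ := cnt_or_le _ _
    _ ≤ Real.exp (1 - y / 12) * cnt (fun _ : V → Fin R => True) +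
        Real.exp (1 - y / 12) * cnt (fun _ : V → Fin R => True) := by
        refine add_le_add ((cnt_card_le Y hrR hR _ _).trans ?_)
          ((cnt_card_le Y hrR hR _ _).trans ?_)
        · exact mul_le_mul_of_nonneg_right (Real.exp_le_exp.2 hE1) hcn
        · exact mul_le_mul_of_nonneg_right (Real.exp_le_exp.2 hE2) hcn
    _ ≤ 1 / (4000 * (r : ℝ) ^ 25) * cnt (fun _ : V → Fin R => True) +
        1 / (4000 * (r : ℝ) ^ 25) * cnt (fun _ : V → Fin R => True) := by gcongr
    _ = _ := by
        have : (r : ℝ) ≠ 0 := by rw [← hyr]; positivity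
        field_simp; ring

/-- It is unlikely that more than one hundred points are kept when few are expected. -/
lemma cnt_hundred_lt_card_le {V : Type*} [Fintype V] [DecidableEq V] (Y : Finset V) {r R : ℕ}
    (hrR : r ≤ R) (hr : 10 ^ 36 ≤ r) (hY : (Y.card : ℝ) * r ^ 2 ≤ 3 * R) :
    cnt (fun ω : V → Fin R => 100 < (Y.filter (fun v => (ω v : ℕ) < r)).card) ≤
      1 / (2000 * (r : ℝ) ^ 25) * cnt (fun _ : V → Fin R => True) := by
  have hr0 : (0 : ℝ) < r := by
    have : 0 < r := lt_of_lt_of_le (by norm_num) hr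
    exact_mod_cast this
  have hr' : (10 : ℝ) ^ 36 ≤ r := by exact_mod_cast hr
  have hR : 0 < R := lt_of_lt_of_le (lt_of_lt_of_le (by norm_num) hr) hrR
  have hR' : (0 : ℝ) < R := by exact_mod_cast hR
  have hl : 0 ≤ Real.log r := Real.log_nonneg (by linarith)
  have h := cnt_card_le Y hrR hR (Real.log r) 101
  refine (cnt_mono fun ω hω => ?_).trans (h.trans ?_)
  · refine mul_le_mul_of_nonneg_left ?_ hl
    exact_mod_cast hω
  · refine mul_le_mul_of_nonneg_right ?_ (cnt_nonneg _)
    rw [Real.exp_log hr0, Real.exp_add, Real.exp_neg, mul_comm (Real.log r)]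
    have h101 : Real.exp (101 * Real.log r) = (r : ℝ) ^ 101 := by
      rw [show (101 : ℝ) = ((101 : ℕ) : ℝ) by norm_num, Real.exp_nat_mul, Real.exp_log hr0]
    have h3 : (Y.card : ℝ) * r / R * (r - 1) ≤ 3 := by
      rw [div_mul_eq_mul_div, div_le_iff₀ hR']
      nlinarith [mul_nonneg (Nat.cast_nonneg Y.card : (0 : ℝ) ≤ Y.card) hr0.le]
    have h4 : Real.exp ((Y.card : ℝ) * r / R * (r - 1)) ≤ 27 := by
      calc _ ≤ Real.exp 3 := Real.exp_le_exp.2 h3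
        _ = Real.exp 1 ^ 3 := by rw [← Real.exp_nat_mul]; norm_num
        _ ≤ 3 ^ 3 := by gcongr; linarith [Real.exp_one_lt_d9]
        _ = 27 := by norm_num
    rw [h101]
    calc ((r : ℝ) ^ 101)⁻¹ * Real.exp ((Y.card : ℝ) * r / R * (r - 1)) ≤
          ((r : ℝ) ^ 101)⁻¹ * 27 := by gcongr
      _ ≤ _ := by
        rw [inv_mul_le_iff₀ (by positivity), mul_one_div, le_div_iff₀ (by positivity)]
        have h5 : (1 : ℝ) ≤ (r : ℝ) ^ 75 := one_le_pow₀ (by linarith)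
        have h6 : (0 : ℝ) < (r : ℝ) ^ 25 := by positivity
        calc 27 * (2000 * (r : ℝ) ^ 25) ≤ 10 ^ 36 * (r : ℝ) ^ 25 := by nlinarith
          _ ≤ r * (r : ℝ) ^ 25 := by gcongr
          _ ≤ r * (r : ℝ) ^ 25 * r ^ 75 := le_mul_of_one_le_right (by positivity) h5
          _ = _ := by ring

/-- One random thinning step: a set of density `R / n` contains a set of density `r / n`. -/
lemma exists_thinning {V ι : Type*} [Fintype V] [DecidableEq V] (I : Finset ι)
    (A : ι → Finset V) (m : ι → ℕ) {n R r : ℕ} (hr : 10 ^ 36 ≤ r) (hrR : r ≤ R) (hRr : R ≤ r ^ 5)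
    (hRn : R ≤ n) (hm : ∀ i ∈ I, 1 ≤ m i) (hA : ∀ i ∈ I, (A i).card * m i ≤ 2 * n)
    (hdeg : ∀ v, ∀ X : ℕ, 1 ≤ X → (I.filter (fun i => v ∈ A i ∧ m i ≤ X)).card ≤ 100 * X ^ 2)
    {y : ℝ} (hy : 10 ^ 7 ≤ y) (hyr : y ^ 5 = r)
    (S : Finset V) {E : ℝ} (hE : E * r ^ 2 ≤ R)
    (h1 : ∀ i ∈ I, |((A i ∩ S).card : ℝ) - R / n * (A i).card| ≤ E)
    (h2 : ∀ i ∈ I, R ^ 2 < m i → (A i ∩ S).card ≤ 100) :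
    ∃ S' : Finset V, ∀ i ∈ I, |((A i ∩ S').card : ℝ) - r / n * (A i).card| ≤ y ^ 3 ∧
      (r ^ 2 < m i → (A i ∩ S').card ≤ 100) := by
  classical
  have hr0 : 0 < r := lt_of_lt_of_le (by norm_num) hr
  have hR0 : 0 < R := hr0.trans_le hrR
  have hn0 : 0 < n := hR0.trans_le hRn
  have hr' : (0 : ℝ) < r := by exact_mod_cast hr0
  have hR' : (0 : ℝ) < R := by exact_mod_cast hR0
  have hn' : (0 : ℝ) < n := by exact_mod_cast hn0
  have hr36 : (10 : ℝ) ^ 36 ≤ r := by exact_mod_cast hr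
  have hrR' : (r : ℝ) ≤ R := by exact_mod_cast hrR
  have hRr' : (R : ℝ) ≤ r ^ 5 := by exact_mod_cast hRr
  have hE1 : E * r ≤ R := by
    rcases le_or_gt E 0 with h | h
    · nlinarith
    · refine le_trans ?_ hE
      have : (r : ℝ) ≤ r ^ 2 := by nlinarith
      gcongr
  have hE2 : E ≤ R := by
    rcases le_or_gt E 0 with h | h
    · linarith
    · nlinarith
  have hmA : ∀ i ∈ I, (R : ℝ) / n * (A i).card * m i ≤ 2 * R := by
    intro i hi
    have : ((A i).card : ℝ) * m i ≤ 2 * n := by exact_mod_cast hA i hi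
    rw [mul_assoc, div_mul_eq_mul_div, div_le_iff₀ hn']
    nlinarith
  have hcard : ∀ i ∈ I, ((A i ∩ S).card : ℝ) ≤ 3 * R := by
    intro i hi
    have h3 := (abs_le.1 (h1 i hi)).2
    have h4 := hmA i hi
    have h5 : (1 : ℝ) ≤ m i := by exact_mod_cast hm i hi
    have h6 : (0 : ℝ) ≤ R / n * (A i).card := by positivity
    nlinarith
  let X : ι → (V → Fin R) → ℕ := fun i ω => ((A i ∩ S).filter (fun v => (ω v : ℕ) < r)).card
  let bad : ι → (V → Fin R) → Prop := fun i ω =>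
    (m i ≤ r ^ 2 ∧ y ^ 3 < |(X i ω : ℝ) - r / n * (A i).card|) ∨ (r ^ 2 < m i ∧ 100 < X i ω)
  have hprob : ∀ i ∈ I, cnt (bad i) ≤ 1 / (2000 * (r : ℝ) ^ 25) *
      cnt (fun _ : V → Fin R => True) := by
    intro i hi
    have : Nonempty (Fin R) := ⟨⟨0, hR0⟩⟩
    rcases le_or_gt (m i) (r ^ 2) with hmi | hmi
    · refine (cnt_mono fun ω (hω : bad i ω) => ?_).trans
        (cnt_abs_card_sub_le (A i ∩ S) hrR hR0 hy hyr (hcard i hi) (M := r / n * (A i).card) ?_)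
      · rcases hω with h | h
        · exact h.2
        · exact absurd h.1 (not_lt.2 hmi)
      · have h3 := h1 i hi
        have : (r : ℝ) / n * (A i).card - (A i ∩ S).card * r / R =
            -(r / R * ((A i ∩ S).card - R / n * (A i).card)) := by field_simp; ring
        rw [this, abs_neg, abs_mul, abs_of_pos (by positivity), div_mul_eq_mul_div,
          div_le_one hR']
        nlinarith
    · refine (cnt_mono fun ω (hω : bad i ω) => ?_).trans
        (cnt_hundred_lt_card_le (A i ∩ S) hrR hr ?_)
      · rcases hω with h | h
        · exact absurd h.1 (not_le.2 hmi)
        · exact h.2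
      · have h3 := (abs_le.1 (h1 i hi)).2
        have h4 := hmA i hi
        have h5 : (r : ℝ) ^ 2 ≤ m i := by exact_mod_cast hmi.le
        have h6 : (0 : ℝ) ≤ R / n * (A i).card := by positivity
        nlinarith [mul_le_mul_of_nonneg_left h5 h6]
  have hR5 : (0 : ℝ) < 600 * (R : ℝ) ^ 5 := by positivity
  have : Nonempty (Fin R) := ⟨⟨0, hR0⟩⟩
  obtain ⟨ω, hω⟩ := exists_avoiding (κ := V) (α := fun _ => Fin R)
    (I.filter (fun i => m i ≤ R ^ 2)) (fun i => A i ∩ S) bad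
    (fun i _ x z hxz => by
      have : X i x = X i z := by
        refine congrArg Finset.card (Finset.filter_congr fun v hv => ?_)
        rw [hxz v hv]
      simp only [bad, this])
    (fun _ => 1 / (600 * (R : ℝ) ^ 5)) (fun _ _ => by positivity)
    (fun _ _ => by
      have : (1 : ℝ) ≤ (R : ℝ) ^ 5 := one_le_pow₀ (by exact_mod_cast hR0)
      rw [div_le_div_iff₀ hR5 (by norm_num)]
      linarith)
    (fun i hi => by
      have hiI := (Finset.mem_filter.1 hi).1
      refine (hprob i hiI).trans (mul_le_mul_of_nonneg_right ?_ (cnt_nonneg _))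
      have hsum : ∑ v ∈ A i ∩ S, ∑ B' ∈ I.filter (fun i => m i ≤ R ^ 2) with v ∈ A B' ∩ S,
          1 / (600 * (R : ℝ) ^ 5) ≤ 1 / 2 := by
        calc ∑ v ∈ A i ∩ S, ∑ B' ∈ I.filter (fun i => m i ≤ R ^ 2) with v ∈ A B' ∩ S,
              1 / (600 * (R : ℝ) ^ 5)
              ≤ ∑ v ∈ A i ∩ S, (100 * (R : ℝ) ^ 4) * (1 / (600 * (R : ℝ) ^ 5)) := by
              refine Finset.sum_le_sum fun v _ => ?_
              rw [Finset.sum_const, nsmul_eq_mul]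
              refine mul_le_mul_of_nonneg_right ?_ (by positivity)
              have h3 := hdeg v (R ^ 2) (Nat.one_le_pow _ _ hR0)
              have h4 : ((I.filter (fun i => m i ≤ R ^ 2)).filter (fun B' => v ∈ A B' ∩ S)).card ≤
                  100 * R ^ 4 := by
                refine le_trans (Finset.card_le_card ?_) (h3.trans_eq (by ring))
                intro j hj
                simp only [Finset.mem_filter, Finset.mem_inter] at hj ⊢
                exact ⟨hj.1.1, hj.2.1, hj.1.2⟩
              exact_mod_cast h4
          _ = ((A i ∩ S).card : ℝ) * (1 / (6 * (R : ℝ))) := by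
              rw [Finset.sum_const, nsmul_eq_mul]
              field_simp
              ring
          _ ≤ 3 * (R : ℝ) * (1 / (6 * (R : ℝ))) := by
              have := hcard i hiI
              gcongr
          _ = 1 / 2 := by field_simp; norm_num
      calc 1 / (2000 * (r : ℝ) ^ 25) ≤ 1 / (600 * (R : ℝ) ^ 5) * (1 / 3) := by
            rw [div_mul_div_comm, one_mul]
            refine one_div_le_one_div_of_le (by positivity) ?_
            have : (R : ℝ) ^ 5 ≤ r ^ 25 := by
              calc (R : ℝ) ^ 5 ≤ (r ^ 5) ^ 5 := by gcongr
                _ = _ := by rw [← pow_mul]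
            nlinarith [pow_pos hr' 25]
        _ ≤ 1 / (600 * (R : ℝ) ^ 5) * Real.exp (-1) := by
            have : (1 / 3 : ℝ) ≤ Real.exp (-1) := by
              rw [Real.exp_neg, one_div]
              exact inv_anti₀ (Real.exp_pos _) (by linarith [Real.exp_one_lt_d9])
            gcongr
        _ ≤ _ := by
            gcongr
            linarith)
  refine ⟨S.filter (fun v => (ω v : ℕ) < r), fun i hi => ?_⟩
  have hX : (A i ∩ S.filter (fun v => (ω v : ℕ) < r)).card = X i ω := by
    rw [Finset.inter_filter]
  rw [hX]
  have hsmall : r ^ 2 < m i → X i ω ≤ 100 := by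
    intro hmi
    rcases le_or_gt (m i) (R ^ 2) with h | h
    · have := hω i (Finset.mem_filter.2 ⟨hi, h⟩)
      by_contra hc
      exact this (Or.inr ⟨hmi, not_le.1 hc⟩)
    · exact (Finset.card_le_card (Finset.filter_subset _ _)).trans (h2 i hi h)
  refine ⟨?_, hsmall⟩
  rcases le_or_gt (m i) (r ^ 2) with hmi | hmi
  · have := hω i (Finset.mem_filter.2 ⟨hi, hmi.trans (by gcongr)⟩)
    by_contra hc
    exact this (Or.inl ⟨hmi, not_le.1 hc⟩)
  · have h3 : (X i ω : ℝ) ≤ 100 := by exact_mod_cast hsmall hmi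
    have h4 : (r : ℝ) / n * (A i).card ≤ 2 := by
      have h5 : ((A i).card : ℝ) * m i ≤ 2 * n := by exact_mod_cast hA i hi
      have h6 : (r : ℝ) ≤ m i := by
        have : (r : ℝ) ^ 2 ≤ m i := by exact_mod_cast hmi.le
        nlinarith
      rw [div_mul_eq_mul_div, div_le_iff₀ hn']
      nlinarith [(Nat.cast_nonneg (A i).card : (0 : ℝ) ≤ (A i).card)]
    have h5 : (0 : ℝ) ≤ r / n * (A i).card := by positivity
    have h6 : (100 : ℝ) ≤ y ^ 3 := by
      calc (100 : ℝ) ≤ (10 ^ 7) ^ 3 := by norm_num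
        _ ≤ _ := by gcongr
    rw [abs_le]
    constructor <;> linarith [(Nat.cast_nonneg (X i ω) : (0 : ℝ) ≤ X i ω)]

lemma exists_pow_five_eq {r : ℕ} (hr : 10 ^ 36 ≤ r) :
    ∃ y : ℝ, 10 ^ 7 ≤ y ∧ y ^ 5 = r ∧ y ^ 3 ≤ 5 / 10 ^ 15 * r := by
  have hr36 : (10 : ℝ) ^ 36 ≤ r := by exact_mod_cast hr
  have h5 : ((r : ℝ) ^ (1 / 5 : ℝ)) ^ 5 = r := by
    rw [← Real.rpow_natCast, ← Real.rpow_mul (by positivity)]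
    norm_num
  have h0 : 0 ≤ (r : ℝ) ^ (1 / 5 : ℝ) := by positivity
  have h7 : 10 ^ 7 * 1.5 ≤ (r : ℝ) ^ (1 / 5 : ℝ) := by
    refine le_of_pow_le_pow_left₀ (n := 5) (by norm_num) h0 ?_
    rw [h5]
    exact le_trans (by norm_num) hr36
  refine ⟨(r : ℝ) ^ (1 / 5 : ℝ), by linarith, h5, ?_⟩
  set y := (r : ℝ) ^ (1 / 5 : ℝ)
  rw [← h5]
  have h2 : (10 ^ 15 / 5 : ℝ) ≤ y ^ 2 := by
    calc (10 ^ 15 / 5 : ℝ) ≤ (10 ^ 7 * 1.5) ^ 2 := by norm_num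
      _ ≤ _ := by gcongr
  have h3 : 0 ≤ y ^ 3 := by positivity
  calc y ^ 3 = 5 / 10 ^ 15 * (y ^ 3 * (10 ^ 15 / 5)) := by ring
    _ ≤ 5 / 10 ^ 15 * (y ^ 3 * y ^ 2) := by gcongr
    _ = _ := by ring

/-- A family of sets of which few large ones pass through any given point has a subset of the
ground set meeting each of them in about the expected number of points. -/
theorem exists_sparse {V ι : Type*} [Fintype V] [DecidableEq V] (I : Finset ι)
    (A : ι → Finset V) (m : ι → ℕ) {n r : ℕ} (hr : 10 ^ 36 ≤ r)
    (hrn : r ≤ n) (hm : ∀ i ∈ I, 1 ≤ m i) (hA : ∀ i ∈ I, (A i).card * m i ≤ 2 * n)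
    (hdeg : ∀ v, ∀ X : ℕ, 1 ≤ X → (I.filter (fun i => v ∈ A i ∧ m i ≤ X)).card ≤ 100 * X ^ 2) :
    ∃ S : Finset V, ∀ i ∈ I,
      |((A i ∩ S).card : ℝ) - r / n * (A i).card| ≤ 5 / 10 ^ 15 * r := by
  classical
  have key : ∀ d r : ℕ, n - r = d → 10 ^ 36 ≤ r → r ≤ n → ∀ y : ℝ, 10 ^ 7 ≤ y → y ^ 5 = r →
      ∃ S : Finset V, ∀ i ∈ I, |((A i ∩ S).card : ℝ) - r / n * (A i).card| ≤ y ^ 3 ∧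
        (r ^ 2 < m i → (A i ∩ S).card ≤ 100) := by
    intro d
    induction d using Nat.strong_induction_on with
    | _ d ih =>
    intro r hd hr hrn y hy hyr
    have hr0 : (0 : ℝ) < r := by
      have : 0 < r := lt_of_lt_of_le (by norm_num) hr
      exact_mod_cast this
    rcases le_or_gt n (r ^ 5) with h | h
    · have hn : 10 ^ 36 ≤ n := hr.trans hrn
      refine exists_thinning I A m hr hrn h le_rfl hm hA hdeg hy hyr Finset.univ (E := 0)
        (by simp) (fun i _ => ?_) fun i hi hmi => ?_
      · have : (n : ℝ) ≠ 0 := by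
          have : n ≠ 0 := by intro h0; rw [h0] at hn; norm_num at hn
          exact_mod_cast this
        rw [div_self this]
        simp
      · have h1 := hA i hi
        rw [Finset.inter_univ]
        have : (A i).card = 0 := by
          by_contra h0
          have : 1 ≤ (A i).card := Nat.one_le_iff_ne_zero.2 h0
          nlinarith
        omega
    · have hrr : r < r ^ 5 := by
        have : 1 < r := lt_of_lt_of_le (by norm_num) hr
        exact lt_self_pow₀ this (by norm_num)
      have hr1 : (1 : ℝ) ≤ r := by
        have : 1 ≤ r := le_trans (by norm_num) hr
        exact_mod_cast this
      obtain ⟨S, hS⟩ := ih (n - r ^ 5) (by omega) (r ^ 5) rfl (hr.trans hrr.le) h.le r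
        (le_trans (by norm_num) (show (10 : ℝ) ^ 36 ≤ r by exact_mod_cast hr)) (by push_cast; rfl)
      refine exists_thinning I A m hr hrr.le le_rfl h.le hm hA hdeg hy hyr S (E := (r : ℝ) ^ 3)
        (by push_cast; exact le_of_eq (by ring)) (fun i hi => (hS i hi).1) fun i hi => (hS i hi).2
  obtain ⟨y, hy, hyr, hy3⟩ := exists_pow_five_eq hr
  obtain ⟨S, hS⟩ := key (n - r) r rfl hr hrn y hy hyr
  exact ⟨S, fun i hi => (hS i hi).1.trans hy3⟩

/-- Coefficients `(A, B, c)` in lowest terms of the lines `A x + B y = c` relevant for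
`{0,…,n-1}²`. -/
def lineCoeffs (n : ℕ) : Finset (ℤ × ℤ × ℤ) :=
  (Finset.Icc (-(n : ℤ)) n ×ˢ Finset.Icc (-(n : ℤ)) n ×ˢ
    Finset.Icc (-(2 * (n : ℤ) ^ 2)) (2 * (n : ℤ) ^ 2)).filter (fun j => IsCoprime j.1 j.2.1)

/-- The points of `{0,…,n-1}²` on the line `A x + B y = c`. -/
def linePoints (n : ℕ) (j : ℤ × ℤ × ℤ) : Finset (Fin n × Fin n) :=
  Finset.univ.filter (fun v => j.1 * (v.1 : ℕ) + j.2.1 * (v.2 : ℕ) = j.2.2)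

/-- A union of residue classes of diagonals, which contains a small but positive proportion of the
points of `{0,…,n-1}²`. -/
def diagPoints (n : ℕ) : Finset (Fin n × Fin n) :=
  Finset.univ.filter (fun v => (v.2 : ℕ) % 400 = v.1 % 400 ∨ (v.2 : ℕ) % 400 = (v.1 + 1) % 400)

lemma mem_linePoints {n : ℕ} {j : ℤ × ℤ × ℤ} {v : Fin n × Fin n} :
    v ∈ linePoints n j ↔ j.1 * (v.1 : ℕ) + j.2.1 * (v.2 : ℕ) = j.2.2 := by
  simp [linePoints]

lemma mem_diagPoints {n : ℕ} {v : Fin n × Fin n} : v ∈ diagPoints n ↔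
    (v.2 : ℕ) % 400 = v.1 % 400 ∨ (v.2 : ℕ) % 400 = (v.1 + 1) % 400 := by
  simp [diagPoints]

lemma mem_lineCoeffs {n : ℕ} {j : ℤ × ℤ × ℤ} : j ∈ lineCoeffs n ↔
    (|j.1| ≤ n ∧ |j.2.1| ≤ n ∧ |j.2.2| ≤ 2 * (n : ℤ) ^ 2) ∧ IsCoprime j.1 j.2.1 := by
  simp [lineCoeffs, abs_le]

lemma card_mul_le_of_dvd_sub {n m : ℕ} (T : Finset (Fin n))
    (hT : ∀ x ∈ T, ∀ y ∈ T, (m : ℤ) ∣ ((x : ℕ) : ℤ) - ((y : ℕ) : ℤ)) : T.card * m ≤ n + m := by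
  have h : T.card ≤ (Finset.range (n / m + 1)).card := by
    refine Finset.card_le_card_of_injOn (fun x => (x : ℕ) / m) (fun x _ => ?_) fun x hx y hy h => ?_
    · simp only [Finset.coe_range, Set.mem_Iio]
      exact Nat.lt_succ_of_le (Nat.div_le_div_right x.2.le)
    · have h2 : ((x : ℕ) : ℤ) % m = ((y : ℕ) : ℤ) % m := Int.modEq_iff_dvd.2 (hT y hy x hx)
      have h3 : (x : ℕ) % m = (y : ℕ) % m := by exact_mod_cast h2
      have h4 : (x : ℕ) / m = (y : ℕ) / m := h
      apply Fin.ext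
      rw [← Nat.div_add_mod (x : ℕ) m, ← Nat.div_add_mod (y : ℕ) m, h3, h4]
  rw [Finset.card_range] at h
  calc T.card * m ≤ (n / m + 1) * m := by gcongr
    _ = n / m * m + m := by ring
    _ ≤ n + m := by gcongr; exact Nat.div_mul_le_self n m

lemma injOn_fst_linePoints {n : ℕ} {j : ℤ × ℤ × ℤ} (hB : j.2.1 ≠ 0) :
    Set.InjOn Prod.fst (linePoints n j : Set (Fin n × Fin n)) := by
  intro v hv w hw h
  have hv := mem_linePoints.1 hv
  have hw := mem_linePoints.1 hw
  rw [h] at hv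
  have : (v.2 : ℤ) = (w.2 : ℕ) := mul_left_cancel₀ hB (by linarith)
  exact Prod.ext h (Fin.ext (by exact_mod_cast this))

lemma injOn_snd_linePoints {n : ℕ} {j : ℤ × ℤ × ℤ} (hA : j.1 ≠ 0) :
    Set.InjOn Prod.snd (linePoints n j : Set (Fin n × Fin n)) := by
  intro v hv w hw h
  have hv := mem_linePoints.1 hv
  have hw := mem_linePoints.1 hw
  rw [h] at hv
  have : (v.1 : ℤ) = (w.1 : ℕ) := mul_left_cancel₀ hA (by linarith)
  exact Prod.ext (Fin.ext (by exact_mod_cast this)) h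

lemma card_linePoints_le {n : ℕ} {j : ℤ × ℤ × ℤ} (hj : j ∈ lineCoeffs n) :
    (linePoints n j).card ≤ n := by
  by_cases hB : j.2.1 = 0
  · have hA : j.1 ≠ 0 := by
      intro hA
      have := (mem_lineCoeffs.1 hj).2
      rw [hA, hB] at this
      exact not_isCoprime_zero_zero this
    simpa using Finset.card_le_card_of_injOn Prod.snd
      (t := (Finset.univ : Finset (Fin n))) (by simp) (injOn_snd_linePoints hA)
  · simpa using Finset.card_le_card_of_injOn Prod.fst
      (t := (Finset.univ : Finset (Fin n))) (by simp) (injOn_fst_linePoints hB)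

lemma card_linePoints_mul_snd_le {n : ℕ} {j : ℤ × ℤ × ℤ} (hj : j ∈ lineCoeffs n)
    (hB : j.2.1 ≠ 0) : (linePoints n j).card * j.2.1.natAbs ≤ 2 * n := by
  obtain ⟨⟨-, hBn, -⟩, hco⟩ := mem_lineCoeffs.1 hj
  have h1 : (linePoints n j).card = ((linePoints n j).image Prod.fst).card :=
    (Finset.card_image_of_injOn (injOn_fst_linePoints hB)).symm
  have h2 := card_mul_le_of_dvd_sub (m := j.2.1.natAbs) ((linePoints n j).image Prod.fst) (by
    intro x hx y hy
    obtain ⟨v, hv, rfl⟩ := Finset.mem_image.1 hx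
    obtain ⟨w, hw, rfl⟩ := Finset.mem_image.1 hy
    have hv := mem_linePoints.1 hv
    have hw := mem_linePoints.1 hw
    rw [Int.natAbs_dvd]
    refine hco.symm.dvd_of_dvd_mul_left ⟨(w.2 : ℕ) - (v.2 : ℕ), ?_⟩
    linarith)
  rw [h1]
  have : j.2.1.natAbs ≤ n := by
    rw [Int.abs_eq_natAbs] at hBn
    exact_mod_cast hBn
  omega

lemma card_linePoints_mul_fst_le {n : ℕ} {j : ℤ × ℤ × ℤ} (hj : j ∈ lineCoeffs n)
    (hA : j.1 ≠ 0) : (linePoints n j).card * j.1.natAbs ≤ 2 * n := by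
  have hj' : (j.2.1, j.1, j.2.2) ∈ lineCoeffs n := by
    rw [mem_lineCoeffs] at hj ⊢
    exact ⟨⟨hj.1.2.1, hj.1.1, hj.1.2.2⟩, hj.2.symm⟩
  refine le_trans (Nat.mul_le_mul_right _ ?_) (card_linePoints_mul_snd_le hj' hA)
  refine Finset.card_le_card_of_injOn Prod.swap (fun v hv => ?_) Prod.swap_injective.injOn
  have hv := mem_linePoints.1 hv
  refine mem_linePoints.2 ?_
  simp only [Prod.fst_swap, Prod.snd_swap]
  linarith

lemma card_linePoints_mul_max_le {n : ℕ} {j : ℤ × ℤ × ℤ} (hj : j ∈ lineCoeffs n) :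
    (linePoints n j).card * max j.1.natAbs j.2.1.natAbs ≤ 2 * n := by
  rcases le_total j.1.natAbs j.2.1.natAbs with h | h
  · rw [max_eq_right h]
    by_cases hB : j.2.1 = 0
    · simp [hB]
    · exact card_linePoints_mul_snd_le hj hB
  · rw [max_eq_left h]
    by_cases hA : j.1 = 0
    · simp [hA]
    · exact card_linePoints_mul_fst_le hj hA

lemma abs_card_mod_sub_le (n : ℕ) {γ : ℕ} (hγ : γ < 400) :
    |((Finset.univ.filter (fun y : Fin n => (y : ℕ) % 400 = γ)).card : ℝ) - n / 400| ≤ 1 := by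
  have h1 : (Finset.univ.filter (fun y : Fin n => (y : ℕ) % 400 = γ)).card =
      n.count (fun y => y ≡ γ [MOD 400]) := by
    rw [Nat.count_eq_card_filter_range]
    refine Finset.card_bij (fun y _ => (y : ℕ)) (fun y hy => ?_) (fun y _ z _ h => Fin.ext h)
      fun y hy => ?_
    · rw [Finset.mem_filter] at hy ⊢
      exact ⟨Finset.mem_range.2 y.2, by rw [Nat.ModEq, hy.2, Nat.mod_eq_of_lt hγ]⟩
    · rw [Finset.mem_filter, Finset.mem_range] at hy
      refine ⟨⟨y, hy.1⟩, Finset.mem_filter.2 ⟨Finset.mem_univ _, ?_⟩, rfl⟩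
      have := hy.2
      rwa [Nat.ModEq, Nat.mod_eq_of_lt hγ] at this
  rw [h1, Nat.count_modEq_card n (by norm_num)]
  have h2 : (n : ℝ) = 400 * (n / 400 : ℕ) + (n % 400 : ℕ) := by
    exact_mod_cast (Nat.div_add_mod n 400).symm
  have h3 : ((n % 400 : ℕ) : ℝ) ≤ 400 := by
    exact_mod_cast (Nat.mod_lt n (by norm_num)).le
  have h4 : (0 : ℝ) ≤ (n % 400 : ℕ) := Nat.cast_nonneg _
  rw [abs_le]
  split_ifs <;> push_cast <;> constructor <;> linarith

lemma abs_card_not_two_mod_sub_le (n : ℕ) {γ δ : ℕ} (hγ : γ < 400) (hδ : δ < 400) (h : γ ≠ δ) :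
    |((Finset.univ.filter (fun y : Fin n => ¬ ((y : ℕ) % 400 = γ ∨ (y : ℕ) % 400 = δ))).card : ℝ) -
      0.995 * n| ≤ 2 := by
  have h1 := abs_le.1 (abs_card_mod_sub_le n hγ)
  have h2 := abs_le.1 (abs_card_mod_sub_le n hδ)
  have h3 := Finset.card_filter_add_card_filter_not (s := (Finset.univ : Finset (Fin n)))
    (fun y : Fin n => ((y : ℕ) % 400 = γ ∨ (y : ℕ) % 400 = δ))
  rw [Finset.filter_or, Finset.card_union_of_disjoint, Finset.card_univ, Fintype.card_fin] at h3
  · have h4 : ((Finset.univ.filter (fun y : Fin n => (y : ℕ) % 400 = γ)).card : ℝ) +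
      (Finset.univ.filter (fun y : Fin n => (y : ℕ) % 400 = δ)).card +
      (Finset.univ.filter (fun y : Fin n => ¬ ((y : ℕ) % 400 = γ ∨ (y : ℕ) % 400 = δ))).card = n := by
      exact_mod_cast h3
    rw [abs_le]
    constructor <;> linarith
  · rw [Finset.disjoint_filter]
    intro y _ h1 h2
    exact h (h1.symm.trans h2)

lemma card_filter_fst_eq_and {n : ℕ} (x : Fin n) (P : Fin n → Prop) [DecidablePred P] :
    (Finset.univ.filter (fun v : Fin n × Fin n => v.1 = x ∧ P v.2)).card =
      (Finset.univ.filter P).card :=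
  Finset.card_bij (fun v _ => v.2) (fun v hv => by simpa using (Finset.mem_filter.1 hv).2.2)
    (fun v hv w hw h => Prod.ext
      ((Finset.mem_filter.1 hv).2.1.trans (Finset.mem_filter.1 hw).2.1.symm) h)
    (fun y hy => ⟨(x, y), by simpa using hy, rfl⟩)

lemma card_filter_snd_eq_and {n : ℕ} (y : Fin n) (P : Fin n → Prop) [DecidablePred P] :
    (Finset.univ.filter (fun v : Fin n × Fin n => v.2 = y ∧ P v.1)).card =
      (Finset.univ.filter P).card :=
  Finset.card_bij (fun v _ => v.1) (fun v hv => by simpa using (Finset.mem_filter.1 hv).2.2)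
    (fun v hv w hw h => Prod.ext h
      ((Finset.mem_filter.1 hv).2.1.trans (Finset.mem_filter.1 hw).2.1.symm))
    (fun x hx => ⟨(x, y), by simpa using hx, rfl⟩)

lemma abs_coeff_le_of_linePoints {n : ℕ} {A B : ℤ} (hA : |A| ≤ n) (hB : |B| ≤ n)
    (v : Fin n × Fin n) : |A * (v.1 : ℕ) + B * (v.2 : ℕ)| ≤ 2 * (n : ℤ) ^ 2 := by
  have h1 : ((v.1 : ℕ) : ℤ) ≤ n := by exact_mod_cast v.1.2.le
  have h2 : ((v.2 : ℕ) : ℤ) ≤ n := by exact_mod_cast v.2.2.le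
  calc _ ≤ |A * (v.1 : ℕ)| + |B * (v.2 : ℕ)| := abs_add_le _ _
    _ = |A| * (v.1 : ℕ) + |B| * (v.2 : ℕ) := by
        rw [abs_mul, abs_mul, Nat.abs_cast, Nat.abs_cast]
    _ ≤ n * n + n * n := by gcongr
    _ = _ := by ring

lemma row_mem_lineCoeffs {n : ℕ} (x : Fin n) : ((1, 0, ((x : ℕ) : ℤ)) : ℤ × ℤ × ℤ) ∈ lineCoeffs n := by
  have hn : 1 ≤ n := Nat.one_le_iff_ne_zero.2 fun h => by subst h; exact x.elim0
  have := abs_coeff_le_of_linePoints (n := n) (A := 1) (B := 0) (by simpa using hn) (by simp) (x, x)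
  rw [mem_lineCoeffs]
  refine ⟨⟨by simpa using hn, by simp, by simpa using this⟩, isCoprime_one_left⟩

lemma col_mem_lineCoeffs {n : ℕ} (x : Fin n) : ((0, 1, ((x : ℕ) : ℤ)) : ℤ × ℤ × ℤ) ∈ lineCoeffs n := by
  have hn : 1 ≤ n := Nat.one_le_iff_ne_zero.2 fun h => by subst h; exact x.elim0
  have := abs_coeff_le_of_linePoints (n := n) (A := 0) (B := 1) (by simp) (by simpa using hn) (x, x)
  rw [mem_lineCoeffs]
  refine ⟨⟨by simp, by simpa using hn, by simpa using this⟩, isCoprime_one_right⟩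

lemma linePoints_row {n : ℕ} (x : Fin n) :
    linePoints n (1, 0, ((x : ℕ) : ℤ)) = Finset.univ.filter (fun v => v.1 = x) := by
  ext v
  simp [mem_linePoints, Fin.ext_iff]

lemma linePoints_col {n : ℕ} (x : Fin n) :
    linePoints n (0, 1, ((x : ℕ) : ℤ)) = Finset.univ.filter (fun v => v.2 = x) := by
  ext v
  simp [mem_linePoints, Fin.ext_iff]

/-- Few lines with small coefficients pass through a given point. -/
lemma card_lineCoeffs_through_le {n : ℕ} (v : Fin n × Fin n) {X : ℕ} (hX : 1 ≤ X) :
    ((lineCoeffs n).filter (fun j => v ∈ linePoints n j ∧ max j.1.natAbs j.2.1.natAbs ≤ X)).card ≤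
      9 * X ^ 2 := by
  have h : ((lineCoeffs n).filter
      (fun j => v ∈ linePoints n j ∧ max j.1.natAbs j.2.1.natAbs ≤ X)).card ≤
      (Finset.Icc (-(X : ℤ)) X ×ˢ Finset.Icc (-(X : ℤ)) X).card := by
    refine Finset.card_le_card_of_injOn (fun j => (j.1, j.2.1)) (fun j hj => ?_) ?_
    · have hj := (Finset.mem_filter.1 hj).2.2
      rw [max_le_iff] at hj
      simp only [Finset.coe_product, Finset.coe_Icc, Set.mem_prod, Set.mem_Icc]
      omega
    · intro i hi j hj h
      have hi := mem_linePoints.1 (Finset.mem_filter.1 hi).2.1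
      have hj := mem_linePoints.1 (Finset.mem_filter.1 hj).2.1
      simp only [Prod.mk.injEq] at h
      refine Prod.ext h.1 (Prod.ext h.2 ?_)
      rw [← hi, ← hj, h.1, h.2]
  rw [Finset.card_product, Int.card_Icc] at h
  have h2 : ((X : ℤ) + 1 - -X).toNat = 2 * X + 1 := by omega
  rw [h2] at h
  nlinarith

/-- A set of points off `diagPoints n` which is well distributed on all lines, and which has
slightly fewer than `k` points on each row and column. -/
lemma exists_initial {n k : ℕ} (hk : 10 ^ 36 ≤ k) (hkn : (k : ℝ) ≤ 0.9 * n) :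
    ∃ S : Finset (Fin n × Fin n), (∀ v ∈ S, v ∉ diagPoints n) ∧
      (∀ x, (S.filter (fun v => v.1 = x)).card ≤ k ∧
        (k : ℝ) ≤ (S.filter (fun v => v.1 = x)).card + 1.2 / 10 ^ 14 * k) ∧
      (∀ x, (S.filter (fun v => v.2 = x)).card ≤ k ∧
        (k : ℝ) ≤ (S.filter (fun v => v.2 = x)).card + 1.2 / 10 ^ 14 * k) ∧
      (∀ (x : Fin n) (γ : ℕ), γ < 400 → γ ≠ x % 400 → γ ≠ (x + 1) % 400 →
        0.0024 * (k : ℝ) ≤ (S.filter (fun v => v.1 = x ∧ (v.2 : ℕ) % 400 = γ)).card) ∧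
      (∀ j ∈ lineCoeffs n, ((linePoints n j ∩ S).card : ℝ) ≤
        k * ((linePoints n j).card / n) + 0.0051 * k) := by
  classical
  have hk' : (10 : ℝ) ^ 36 ≤ k := by exact_mod_cast hk
  have hn' : (0 : ℝ) < n := by linarith
  set c : ℝ := 0.995 + 5 / 10 ^ 15 with hc
  have hc0 : 0 < c := by positivity
  set r : ℕ := ⌊((k : ℝ) - 2) / c⌋₊ with hrdef
  have hr1 : c * r ≤ k - 2 := by
    have := Nat.floor_le (a := ((k : ℝ) - 2) / c) (by apply div_nonneg <;> linarith)
    rw [le_div_iff₀ hc0, ← hrdef] at this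
    linarith
  have hr2 : (k : ℝ) - 2 ≤ c * (r + 1) := by
    have := (Nat.lt_floor_add_one (((k : ℝ) - 2) / c)).le
    rw [div_le_iff₀ hc0, ← hrdef] at this
    linarith
  have hr0 : (0 : ℝ) ≤ r := Nat.cast_nonneg r
  have hkr : (k : ℝ) ≤ r := by rw [hc] at hr2; linarith
  have hrk : (r : ℝ) ≤ 1.00503 * k := by rw [hc] at hr1; linarith
  have hrn : r ≤ n := by
    have : (r : ℝ) ≤ n := by linarith
    exact_mod_cast this
  have hr : 10 ^ 36 ≤ r := by
    have : (10 : ℝ) ^ 36 ≤ r := hk'.trans hkr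
    exact_mod_cast this
  let base : (ℤ × ℤ × ℤ) ⊕ (Fin n × ℕ) → Finset (Fin n × Fin n) :=
    Sum.elim (linePoints n) (fun p => Finset.univ.filter (fun v => v.1 = p.1 ∧ (v.2 : ℕ) % 400 = p.2))
  let m : (ℤ × ℤ × ℤ) ⊕ (Fin n × ℕ) → ℕ :=
    Sum.elim (fun j => max j.1.natAbs j.2.1.natAbs) (fun _ => 1)
  let I : Finset ((ℤ × ℤ × ℤ) ⊕ (Fin n × ℕ)) :=
    (lineCoeffs n).disjSum (Finset.univ ×ˢ Finset.range 400)
  have hcardsd : ∀ i, (base i \ diagPoints n).card ≤ (base i).card :=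
    fun i => Finset.card_le_card Finset.sdiff_subset
  obtain ⟨S, hS⟩ := exists_sparse I (fun i => base i \ diagPoints n) m hr hrn (by
      rintro (j | p) hi
      · have hj := (mem_lineCoeffs.1 (Finset.inl_mem_disjSum.1 hi)).2
        simp only [m, Sum.elim_inl]
        by_contra h
        have h0 : max j.1.natAbs j.2.1.natAbs = 0 := by omega
        rw [Nat.max_eq_zero_iff, Int.natAbs_eq_zero, Int.natAbs_eq_zero] at h0
        rw [h0.1, h0.2] at hj
        exact not_isCoprime_zero_zero hj
      · exact le_rfl) (by
      rintro (j | p) hi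
      · exact (Nat.mul_le_mul_right _ (hcardsd _)).trans
          (card_linePoints_mul_max_le (Finset.inl_mem_disjSum.1 hi))
      · refine (Nat.mul_le_mul_right _ (hcardsd _)).trans ?_
        simp only [m, base, Sum.elim_inr, mul_one]
        rw [card_filter_fst_eq_and p.1 (fun y : Fin n => (y : ℕ) % 400 = p.2)]
        refine (Finset.card_le_univ _).trans ?_
        rw [Fintype.card_fin]
        omega) (by
      intro v X hX
      have h1 : (I.filter (fun i => v ∈ base i \ diagPoints n ∧ m i ≤ X)) ⊆
          (((lineCoeffs n).filter (fun j => v ∈ linePoints n j ∧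
            max j.1.natAbs j.2.1.natAbs ≤ X)).image Sum.inl) ∪ {Sum.inr (v.1, (v.2 : ℕ) % 400)} := by
        rintro (j | p) hi
        · rw [Finset.mem_filter, Finset.inl_mem_disjSum, Finset.mem_sdiff] at hi
          exact Finset.mem_union_left _ (Finset.mem_image_of_mem _ (Finset.mem_filter.2
            ⟨hi.1, hi.2.1.1, hi.2.2⟩))
        · rw [Finset.mem_filter, Finset.mem_sdiff] at hi
          have := (Finset.mem_filter.1 hi.2.1.1).2
          refine Finset.mem_union_right _ (Finset.mem_singleton.2 ?_)
          rw [this.1, this.2]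
      have h2 := card_lineCoeffs_through_le v hX
      have h3 := (Finset.card_le_card h1).trans (Finset.card_union_le _ _)
      have h4 := Finset.card_image_le (s := (lineCoeffs n).filter (fun j => v ∈ linePoints n j ∧
            max j.1.natAbs j.2.1.natAbs ≤ X))
            (f := (Sum.inl : ℤ × ℤ × ℤ → (ℤ × ℤ × ℤ) ⊕ (Fin n × ℕ)))
      rw [Finset.card_singleton] at h3
      nlinarith)
  have hrn1 : (r : ℝ) / n ≤ 1 := by
    rw [div_le_one hn']; exact_mod_cast hrn
  have hrn0 : 0 ≤ (r : ℝ) / n := by positivity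
  have hrnn : (r : ℝ) / n * n = r := by field_simp
  have hlinear : ∀ (N a : ℕ), |(N : ℝ) - 0.995 * n| ≤ 2 →
      |(a : ℝ) - r / n * N| ≤ 5 / 10 ^ 15 * r → a ≤ k ∧ (k : ℝ) ≤ a + 1.2 / 10 ^ 14 * k := by
    intro N a hN ha
    obtain ⟨h1, h2⟩ := abs_le.1 hN
    obtain ⟨h3, h4⟩ := abs_le.1 ha
    have h5 : (r : ℝ) / n * N ≤ 0.995 * r + 2 := by nlinarith
    have h6 : 0.995 * r - 2 ≤ (r : ℝ) / n * N := by nlinarith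
    rw [hc] at hr1 hr2
    constructor
    · have : (a : ℝ) ≤ k := by linarith
      exact_mod_cast this
    · linarith
  refine ⟨S \ diagPoints n, fun v hv => (Finset.mem_sdiff.1 hv).2, fun x => ?_, fun x => ?_,
    fun x γ hγ h1 h2 => ?_, fun j hj => ?_⟩
  · refine hlinear _ _ (abs_card_not_two_mod_sub_le n (Nat.mod_lt (x : ℕ) (by norm_num))
      (Nat.mod_lt ((x : ℕ) + 1) (by norm_num)) (by omega)) ?_
    have h3 := hS (Sum.inl (1, 0, ((x : ℕ) : ℤ))) (Finset.inl_mem_disjSum.2 (row_mem_lineCoeffs x))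
    rw [← card_filter_fst_eq_and x]
    convert h3 using 5
    · simp only [base, Sum.elim_inl, linePoints_row]
      ext v; simp only [Finset.mem_filter, Finset.mem_sdiff, Finset.mem_inter, Finset.mem_univ]
      tauto
    · simp only [base, Sum.elim_inl, linePoints_row]
      refine congrArg Finset.card (Finset.ext fun v => ?_)
      simp only [Finset.mem_filter, Finset.mem_sdiff, Finset.mem_univ, mem_diagPoints, true_and]
      refine and_congr_right fun h => ?_
      rw [h]
  · have h3 := hS (Sum.inl (0, 1, ((x : ℕ) : ℤ))) (Finset.inl_mem_disjSum.2 (col_mem_lineCoeffs x))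
    refine hlinear _ _ (abs_card_not_two_mod_sub_le n (Nat.mod_lt (x : ℕ) (by norm_num))
      (Nat.mod_lt ((x : ℕ) + 399) (by norm_num)) (by omega)) ?_
    rw [← card_filter_snd_eq_and x]
    convert h3 using 5
    · simp only [base, Sum.elim_inl, linePoints_col]
      ext v; simp only [Finset.mem_filter, Finset.mem_sdiff, Finset.mem_inter, Finset.mem_univ]
      tauto
    · simp only [base, Sum.elim_inl, linePoints_col]
      refine congrArg Finset.card (Finset.ext fun v => ?_)
      simp only [Finset.mem_filter, Finset.mem_sdiff, Finset.mem_univ, mem_diagPoints, true_and]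
      refine and_congr_right fun h => ?_
      rw [h]
      omega
  · have h3 := (abs_le.1 (hS (Sum.inr (x, γ)) (Finset.inr_mem_disjSum.2 (by simpa using hγ)))).1
    have h4 := (abs_le.1 (abs_card_mod_sub_le n hγ)).1
    rw [← card_filter_fst_eq_and x] at h4
    have h5 : base (Sum.inr (x, γ)) \ diagPoints n =
        Finset.univ.filter (fun v : Fin n × Fin n => v.1 = x ∧ (v.2 : ℕ) % 400 = γ) := by
      refine Finset.sdiff_eq_self_of_disjoint (Finset.disjoint_left.2 fun v hv hv' => ?_)
      have hv := (Finset.mem_filter.1 hv).2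
      rw [mem_diagPoints, hv.1, hv.2] at hv'
      tauto
    rw [h5] at h3
    have h6 : (Finset.univ.filter (fun v : Fin n × Fin n => v.1 = x ∧ (v.2 : ℕ) % 400 = γ)) ∩ S =
        (S \ diagPoints n).filter (fun v => v.1 = x ∧ (v.2 : ℕ) % 400 = γ) := by
      rw [← h5]
      ext v; simp only [base, Finset.mem_filter, Finset.mem_sdiff, Finset.mem_inter, Finset.mem_univ,
        Sum.elim_inr]
      tauto
    rw [h6] at h3
    nlinarith
  · have h3 := (abs_le.1 (hS (Sum.inl j) (Finset.inl_mem_disjSum.2 hj))).2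
    have h4 : ((base (Sum.inl j) \ diagPoints n).card : ℝ) ≤ (linePoints n j).card := by
      exact_mod_cast hcardsd (Sum.inl j)
    have h5 : (linePoints n j ∩ (S \ diagPoints n)) = (base (Sum.inl j) \ diagPoints n) ∩ S := by
      ext v; simp only [base, Finset.mem_sdiff, Finset.mem_inter, Sum.elim_inl]
      tauto
    rw [h5]
    have h6 : (linePoints n j).card ≤ n := card_linePoints_le hj
    have h7 : ((linePoints n j).card : ℝ) / n ≤ 1 := by
      rw [div_le_one hn']; exact_mod_cast h6
    have h8 : 0 ≤ ((linePoints n j).card : ℝ) / n := by positivity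
    have h9 : (r : ℝ) / n * (base (Sum.inl j) \ diagPoints n).card ≤
        r * ((linePoints n j).card / n) := by
      rw [div_mul_eq_mul_div, mul_div_assoc]; gcongr
    nlinarith

/-- Two functions on a finite type with prescribed fibre sizes. -/
lemma exists_stubs {n : ℕ} (d e : Fin n → ℕ) (h : ∑ x, d x = ∑ y, e y) :
    ∃ (κ : Type) (_ : Fintype κ) (_ : DecidableEq κ) (a b : κ → Fin n),
      (∀ x, (Finset.univ.filter (fun P => a P = x)).card = d x) ∧
      (∀ y, (Finset.univ.filter (fun P => b P = y)).card = e y) := by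
  classical
  have hfib : ∀ f : Fin n → ℕ, ∀ x,
      (Finset.univ.filter (fun P : Σ x, Fin (f x) => P.1 = x)).card = f x := by
    intro f x
    rw [← Fintype.card_subtype, Fintype.card_congr (Equiv.sigmaSubtype x), Fintype.card_fin]
  let φ : (Σ x, Fin (d x)) ≃ (Σ y, Fin (e y)) := Fintype.equivOfCardEq (by simpa using h)
  refine ⟨Σ x, Fin (d x), inferInstance, inferInstance, fun P => P.1, fun P => (φ P).1, hfib d,
    fun y => ?_⟩
  rw [← hfib e y]
  exact Finset.card_bij (fun P _ => φ P) (by simp) (fun P _ Q _ h => φ.injective h)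
    (fun Q hQ => ⟨φ.symm Q, by simpa using hQ, by simp⟩)

/-- The number of points of the set obtained from `S` by removing the points `o P` and adding
the points `x P` and `y P`. -/
lemma card_filter_swap {V κ : Type*} [Fintype κ] [DecidableEq V] (S : Finset V)
    (o x y : κ → V) (ho : Function.Injective o) (hx : Function.Injective x)
    (hy : Function.Injective y) (hxy : ∀ P Q, x P ≠ y Q) (hoS : ∀ P, o P ∈ S)
    (hxS : ∀ P, x P ∉ S) (hyS : ∀ P, y P ∉ S) (p : V → Prop) [DecidablePred p] :
    (((S \ Finset.univ.image o) ∪ Finset.univ.image x ∪ Finset.univ.image y).filter p).card +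
        (Finset.univ.filter (fun P => p (o P))).card =
      (S.filter p).card + (Finset.univ.filter (fun P => p (x P))).card +
        (Finset.univ.filter (fun P => p (y P))).card := by
  have him : ∀ f : κ → V, Function.Injective f → ((Finset.univ.image f).filter p).card =
      (Finset.univ.filter (fun P => p (f P))).card := by
    intro f hf
    rw [Finset.filter_image, Finset.card_image_of_injective _ hf]
  rw [Finset.filter_union, Finset.filter_union, Finset.card_union_of_disjoint,
    Finset.card_union_of_disjoint, him x hx, him y hy]
  · have h1 : (S \ Finset.univ.image o).filter p = S.filter p \ (Finset.univ.image o).filter p := by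
      ext v
      simp only [Finset.mem_filter, Finset.mem_sdiff]
      tauto
    have h2 : (Finset.univ.image o).filter p ⊆ S.filter p := by
      refine Finset.filter_subset_filter _ fun v hv => ?_
      obtain ⟨P, -, rfl⟩ := Finset.mem_image.1 hv
      exact hoS P
    rw [h1, ← him o ho]
    have := Finset.card_sdiff_add_card_eq_card h2
    omega
  · refine Finset.disjoint_filter_filter (Finset.disjoint_left.2 fun v hv hv' => ?_)
    obtain ⟨P, -, rfl⟩ := Finset.mem_image.1 hv'
    exact hxS P (Finset.mem_sdiff.1 hv).1
  · rw [← Finset.filter_union]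
    refine Finset.disjoint_filter_filter (Finset.disjoint_left.2 fun v hv hv' => ?_)
    obtain ⟨P, -, rfl⟩ := Finset.mem_image.1 hv'
    rcases Finset.mem_union.1 hv with h | h
    · exact hyS P (Finset.mem_sdiff.1 h).1
    · obtain ⟨Q, -, hQ⟩ := Finset.mem_image.1 h
      exact hxy Q P hQ

/-- Points `(e, c)` of `S` such that `(a, c)` and `(e, b)` both lie in `diagPoints n`. -/
def swapOptions {n : ℕ} (S : Finset (Fin n × Fin n)) (a b : Fin n) : Finset (Fin n × Fin n) :=
  S.filter (fun z => (a, z.2) ∈ diagPoints n ∧ (z.1, b) ∈ diagPoints n)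

lemma mem_swapOptions {n : ℕ} {S : Finset (Fin n × Fin n)} {a b : Fin n} {z : Fin n × Fin n} :
    z ∈ swapOptions S a b ↔ z ∈ S ∧ (a, z.2) ∈ diagPoints n ∧ (z.1, b) ∈ diagPoints n := by
  simp [swapOptions]

lemma card_swapOptions_ge {n k : ℕ} (hk : 10 ^ 36 ≤ k) (hkn : (k : ℝ) ≤ 0.9 * n)
    {S : Finset (Fin n × Fin n)}
    (hS : ∀ (x : Fin n) (γ : ℕ), γ < 400 → γ ≠ x % 400 → γ ≠ (x + 1) % 400 →
        0.0024 * (k : ℝ) ≤ (S.filter (fun v => v.1 = x ∧ (v.2 : ℕ) % 400 = γ)).card)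
    (a b : Fin n) : (n : ℝ) * k / 180000 ≤ (swapOptions S a b).card := by
  classical
  have hk' : (10 : ℝ) ^ 36 ≤ k := by exact_mod_cast hk
  obtain ⟨β, γ, hβ, hγ, h1, h2, h3, h4⟩ : ∃ β γ : ℕ, β < 400 ∧ γ < 400 ∧ γ ≠ β ∧
      γ ≠ (β + 1) % 400 ∧ (γ = a % 400 ∨ γ = (a + 1) % 400) ∧
      ((b : ℕ) % 400 = β ∨ (b : ℕ) % 400 = (β + 1) % 400) := by
    by_cases h : (a : ℕ) % 400 ≠ (b : ℕ) % 400 ∧ (a : ℕ) % 400 ≠ (b + 1) % 400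
    · exact ⟨b % 400, a % 400, by omega, by omega, h.1, by omega, Or.inl rfl, Or.inl rfl⟩
    · exact ⟨(b + 399) % 400, (a + 1) % 400, by omega, by omega, by omega, by omega, Or.inr rfl,
        by omega⟩
  have hsub : (Finset.univ.filter (fun e : Fin n => (e : ℕ) % 400 = β)).biUnion
      (fun e => S.filter (fun v => v.1 = e ∧ (v.2 : ℕ) % 400 = γ)) ⊆ swapOptions S a b := by
    intro z hz
    obtain ⟨e, he, hz⟩ := Finset.mem_biUnion.1 hz
    obtain ⟨hzS, rfl, hz2⟩ := Finset.mem_filter.1 hz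
    have he := (Finset.mem_filter.1 he).2
    rw [mem_swapOptions, mem_diagPoints, mem_diagPoints]
    refine ⟨hzS, ?_, ?_⟩
    · simp only
      omega
    · simp only
      omega
  have hcard := Finset.card_le_card hsub
  rw [Finset.card_biUnion (by
    intro e _ e' _ hee
    rw [Function.onFun, Finset.disjoint_left]
    intro v hv hv'
    exact hee ((Finset.mem_filter.1 hv).2.1.symm.trans (Finset.mem_filter.1 hv').2.1))] at hcard
  have h5 := (abs_le.1 (abs_card_mod_sub_le n hβ)).1
  calc (n : ℝ) * k / 180000 ≤ (n / 400 - 1) * (0.0024 * k) := by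
        have : 0.0024 * (n : ℝ) ≤ n / 400 - 1 := by linarith
        nlinarith
    _ ≤ ((Finset.univ.filter (fun e : Fin n => (e : ℕ) % 400 = β)).card : ℝ) * (0.0024 * k) := by
        gcongr
        linarith
    _ = ∑ e ∈ Finset.univ.filter (fun e : Fin n => (e : ℕ) % 400 = β), (0.0024 * (k : ℝ)) := by
        rw [Finset.sum_const, nsmul_eq_mul]
    _ ≤ ∑ e ∈ Finset.univ.filter (fun e : Fin n => (e : ℕ) % 400 = β),
        ((S.filter (fun v => v.1 = e ∧ (v.2 : ℕ) % 400 = γ)).card : ℝ) := by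
        refine Finset.sum_le_sum fun e he => hS e γ hγ ?_ ?_
        · rw [(Finset.mem_filter.1 he).2]; exact h1
        · have := (Finset.mem_filter.1 he).2
          omega
    _ ≤ _ := by exact_mod_cast hcard

lemma pow_mul_choose_le {q ρ : ℝ} {N s : ℕ} (hq : 0 ≤ q) (hρ : 0 ≤ ρ)
    (h : 3 * (q * N) ≤ ρ * s) : q ^ s * (N.choose s : ℝ) ≤ ρ ^ s := by
  have h1 : ((s : ℝ)) ^ s / s.factorial ≤ 3 ^ s := by
    calc _ ≤ Real.exp s := Real.pow_div_factorial_le_exp _ (Nat.cast_nonneg s) s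
      _ = Real.exp 1 ^ s := by rw [← Real.exp_nat_mul, mul_one]
      _ ≤ 3 ^ s := by gcongr; linarith [Real.exp_one_lt_d9]
  have h2 : (0 : ℝ) < s.factorial := by exact_mod_cast s.factorial_pos
  calc q ^ s * (N.choose s : ℝ) ≤ q ^ s * ((N : ℝ) ^ s / s.factorial) := by
        gcongr; exact Nat.choose_le_pow_div s N
    _ = (q * N) ^ s / s.factorial := by rw [mul_pow]; ring
    _ ≤ (ρ * s / 3) ^ s / s.factorial := by gcongr; linarith
    _ = (ρ / 3) ^ s * ((s : ℝ) ^ s / s.factorial) := by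
        rw [← mul_div_assoc, ← mul_pow]; congr 2; ring
    _ ≤ (ρ / 3) ^ s * 3 ^ s := by gcongr
    _ = ρ ^ s := by rw [← mul_pow]; congr 1; ring

lemma sum_Icc_int_inv_sq_le (n : ℕ) :
    ∑ A ∈ (Finset.Icc (-(n : ℤ)) n).filter (· ≠ 0), (((A : ℝ)) ^ 2)⁻¹ ≤ 4 := by
  have h1 : ∑ i ∈ Finset.Ioo 0 (n + 1), (((i : ℕ) : ℝ) ^ 2)⁻¹ ≤ 2 := by
    simpa using sum_Ioo_inv_sq_le (α := ℝ) 0 (n + 1)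
  have h2 : (Finset.Icc (-(n : ℤ)) n).filter (· ≠ 0) ⊆
      (Finset.Ioo 0 (n + 1)).image (fun i : ℕ => (i : ℤ)) ∪
      (Finset.Ioo 0 (n + 1)).image (fun i : ℕ => -(i : ℤ)) := by
    intro A hA
    simp only [Finset.mem_filter, Finset.mem_Icc] at hA
    simp only [Finset.mem_union, Finset.mem_image, Finset.mem_Ioo]
    rcases lt_or_gt_of_ne hA.2 with h | h
    · exact Or.inr ⟨A.natAbs, by omega, by omega⟩
    · exact Or.inl ⟨A.natAbs, by omega, by omega⟩
  calc _ ≤ ∑ A ∈ (Finset.Ioo 0 (n + 1)).image (fun i : ℕ => (i : ℤ)) ∪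
      (Finset.Ioo 0 (n + 1)).image (fun i : ℕ => -(i : ℤ)), (((A : ℝ)) ^ 2)⁻¹ :=
        Finset.sum_le_sum_of_subset_of_nonneg h2 fun _ _ _ => by positivity
    _ ≤ ∑ A ∈ (Finset.Ioo 0 (n + 1)).image (fun i : ℕ => (i : ℤ)), (((A : ℝ)) ^ 2)⁻¹ +
        ∑ A ∈ (Finset.Ioo 0 (n + 1)).image (fun i : ℕ => -(i : ℤ)), (((A : ℝ)) ^ 2)⁻¹ := by
        rw [← Finset.sum_union_inter]
        refine le_add_of_nonneg_right (Finset.sum_nonneg fun _ _ => by positivity)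
    _ ≤ _ := by
        rw [Finset.sum_image (by intro i _ j _ h; simpa using h),
          Finset.sum_image (by intro i _ j _ h; simpa using h)]
        simp only [Int.cast_neg, Int.cast_natCast, neg_sq]
        linarith

lemma cnt_coe_le {V : Type*} [DecidableEq V] {O S : Finset V} (h : O ⊆ S) (p : V → Prop)
    [DecidablePred p] : cnt (fun z : O => p z) ≤ (S.filter p).card := by
  rw [cnt_eq_card]
  exact_mod_cast Finset.card_le_card_of_injOn (fun z : O => (z : V))
    (fun z hz => Finset.mem_coe.2 (Finset.mem_filter.2 ⟨h z.2, (Finset.mem_filter.1 hz).2⟩))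
    Subtype.val_injective.injOn

/-- A set of points meeting every row and every column at most once meets few of the points
`(a, z.2)` and `(z.1, b)` with `z ∈ S`. -/
lemma card_filter_cross_le {n k : ℕ} {S : Finset (Fin n × Fin n)}
    (hrow : ∀ x, (S.filter (fun v => v.1 = x)).card ≤ k)
    (hcol : ∀ y, (S.filter (fun v => v.2 = y)).card ≤ k) {U : Finset (Fin n × Fin n)}
    (h1 : Set.InjOn Prod.fst (U : Set (Fin n × Fin n)))
    (h2 : Set.InjOn Prod.snd (U : Set (Fin n × Fin n))) (a b : Fin n) :
    (S.filter (fun z => (a, z.2) ∈ U ∨ (z.1, b) ∈ U)).card ≤ 2 * k := by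
  have hc : (S.filter (fun z => (a, z.2) ∈ U)).card ≤ k := by
    rcases (S.filter (fun z => (a, z.2) ∈ U)).eq_empty_or_nonempty with h | ⟨w, hw⟩
    · simp [h]
    · refine (Finset.card_le_card fun v hv => ?_).trans (hcol w.2)
      rw [Finset.mem_filter] at hv hw ⊢
      exact ⟨hv.1, (Prod.ext_iff.1 (h1 (Finset.mem_coe.2 hv.2) (Finset.mem_coe.2 hw.2) rfl)).2⟩
  have hr : (S.filter (fun z => (z.1, b) ∈ U)).card ≤ k := by
    rcases (S.filter (fun z => (z.1, b) ∈ U)).eq_empty_or_nonempty with h | ⟨w, hw⟩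
    · simp [h]
    · refine (Finset.card_le_card fun v hv => ?_).trans (hrow w.1)
      rw [Finset.mem_filter] at hv hw ⊢
      exact ⟨hv.1, (Prod.ext_iff.1 (h2 (Finset.mem_coe.2 hv.2) (Finset.mem_coe.2 hw.2) rfl)).1⟩
  rw [Finset.filter_or]
  have := Finset.card_union_le (S.filter (fun z => (a, z.2) ∈ U)) (S.filter (fun z => (z.1, b) ∈ U))
  omega

/-- The indices `P` such that row `a P` or column `b P` meets `U`. -/
def crossIndices {n : ℕ} {κ : Type*} [Fintype κ] (a b : κ → Fin n) (U : Finset (Fin n × Fin n)) :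
    Finset κ :=
  Finset.univ.filter (fun P => ∃ w ∈ U, w.1 = a P ∨ w.2 = b P)

lemma card_crossIndices_le {n : ℕ} {κ : Type*} [Fintype κ] [DecidableEq κ] {a b : κ → Fin n}
    {D : ℝ} (ha : ∀ x, ((Finset.univ.filter (fun P => a P = x)).card : ℝ) ≤ D)
    (hb : ∀ y, ((Finset.univ.filter (fun P => b P = y)).card : ℝ) ≤ D)
    (U : Finset (Fin n × Fin n)) : ((crossIndices a b U).card : ℝ) ≤ U.card * (2 * D) := by
  have h1 : crossIndices a b U ⊆ U.biUnion (fun w => (Finset.univ.filter (fun P => a P = w.1)) ∪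
      (Finset.univ.filter (fun P => b P = w.2))) := by
    intro P hP
    obtain ⟨w, hw, h⟩ := (Finset.mem_filter.1 hP).2
    simp only [Finset.mem_biUnion, Finset.mem_union, Finset.mem_filter, Finset.mem_univ, true_and]
    exact ⟨w, hw, h.imp Eq.symm Eq.symm⟩
  have h2 := (Finset.card_le_card h1).trans Finset.card_biUnion_le
  calc ((crossIndices a b U).card : ℝ) ≤
        ∑ w ∈ U, (((Finset.univ.filter (fun P => a P = w.1)) ∪
      (Finset.univ.filter (fun P => b P = w.2))).card : ℝ) := by exact_mod_cast h2
    _ ≤ ∑ w ∈ U, (2 * D) := by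
        refine Finset.sum_le_sum fun w _ => ?_
        have h3 := Finset.card_union_le (Finset.univ.filter (fun P => a P = w.1))
          (Finset.univ.filter (fun P => b P = w.2))
        have h4 : (((Finset.univ.filter (fun P => a P = w.1)) ∪
          (Finset.univ.filter (fun P => b P = w.2))).card : ℝ) ≤
          (Finset.univ.filter (fun P => a P = w.1)).card +
          (Finset.univ.filter (fun P => b P = w.2)).card := by exact_mod_cast h3
        linarith [ha w.1, hb w.2]
    _ = _ := by rw [Finset.sum_const, nsmul_eq_mul]

lemma line_term_le {n k : ℕ} (hk : 10 ^ 36 ≤ k) (hn : 0 < n) {A B : ℤ} (hA : A ≠ 0) (hB : B ≠ 0)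
    {N : ℕ} (hN : (N : ℝ) * (max A.natAbs B.natAbs : ℕ) ≤ 4 * n * (1.2 / 10 ^ 14 * k)) :
    (3 * (360000 / n : ℝ)) ^ ⌈0.002 * (k : ℝ)⌉₊ * (N.choose (⌈0.002 * (k : ℝ)⌉₊ - 1) : ℝ) ≤
      1 / 10 ^ 9 / n * (((A : ℝ) ^ 2)⁻¹ * ((B : ℝ) ^ 2)⁻¹) := by
  have hk' : (10 : ℝ) ^ 36 ≤ k := by exact_mod_cast hk
  have hn' : (0 : ℝ) < n := by exact_mod_cast hn
  have hs1 : 0.002 * (k : ℝ) ≤ ⌈0.002 * (k : ℝ)⌉₊ := Nat.le_ceil _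
  obtain ⟨s, hs⟩ : ∃ s, ⌈0.002 * (k : ℝ)⌉₊ = s + 1 := by
    refine Nat.exists_eq_succ_of_ne_zero fun h => ?_
    rw [h, Nat.cast_zero] at hs1
    linarith
  rw [hs] at hs1 ⊢
  push_cast at hs1
  have hs4 : 4 ≤ s := by
    have : (4 : ℝ) ≤ s := by linarith
    exact_mod_cast this
  set m : ℕ := max A.natAbs B.natAbs with hm
  have hm1 : 1 ≤ m := le_max_of_le_left (Int.natAbs_pos.2 hA)
  have hm1' : (1 : ℝ) ≤ m := by exact_mod_cast hm1
  have h := pow_mul_choose_le (q := 3 * (360000 / n : ℝ)) (ρ := 1 / 10 ^ 4 / m) (N := N) (s := s)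
    (by positivity) (by positivity) (by
      rw [div_mul_eq_mul_div, le_div_iff₀ (by linarith)]
      calc 3 * (3 * (360000 / (n : ℝ)) * N) * m = 3240000 / n * (N * m) := by ring
        _ ≤ 3240000 / n * (4 * n * (1.2 / 10 ^ 14 * k)) := by gcongr
        _ = 12960000 * (1.2 / 10 ^ 14 * k) := by field_simp; ring
        _ ≤ _ := by linarith)
  have hA' : (A : ℝ) ^ 2 ≤ (m : ℝ) ^ 2 := by
    have h : A.natAbs ≤ m := le_max_left _ _
    have h' : |(A : ℝ)| ≤ m := by rw [← Int.cast_abs, ← Nat.cast_natAbs]; exact_mod_cast h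
    exact sq_le_sq' (abs_le.1 h').1 (abs_le.1 h').2
  have hB' : (B : ℝ) ^ 2 ≤ (m : ℝ) ^ 2 := by
    have h : B.natAbs ≤ m := le_max_right _ _
    have h' : |(B : ℝ)| ≤ m := by rw [← Int.cast_abs, ← Nat.cast_natAbs]; exact_mod_cast h
    exact sq_le_sq' (abs_le.1 h').1 (abs_le.1 h').2
  have hA0 : 0 < (A : ℝ) ^ 2 := by positivity
  have hB0 : 0 < (B : ℝ) ^ 2 := by positivity
  rw [Nat.add_sub_cancel, pow_succ', mul_assoc]
  calc 3 * (360000 / (n : ℝ)) * ((3 * (360000 / (n : ℝ))) ^ s * (N.choose s : ℝ)) ≤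
        3 * (360000 / (n : ℝ)) * (1 / 10 ^ 4 / m) ^ s := by gcongr
    _ ≤ 3 * (360000 / (n : ℝ)) * (1 / 10 ^ 4 / m) ^ 4 := by
        refine mul_le_mul_of_nonneg_left (pow_le_pow_of_le_one (by positivity) ?_ hs4)
          (by positivity)
        rw [div_le_one (by linarith)]
        exact le_trans (by norm_num) hm1'
    _ = 1080000 / 10 ^ 16 / n * (((m : ℝ) ^ 2)⁻¹ * ((m : ℝ) ^ 2)⁻¹) := by field_simp; ring
    _ ≤ 1 / 10 ^ 9 / n * (((A : ℝ) ^ 2)⁻¹ * ((B : ℝ) ^ 2)⁻¹) := by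
        gcongr ?_ / _ * (?_ * ?_)
        · norm_num
        · exact inv_anti₀ hA0 hA'
        · exact inv_anti₀ hB0 hB'

lemma sum_lines_le {n : ℕ} (p : ℤ × ℤ × ℤ → Prop) [DecidablePred p] {C : ℝ} (hC : 0 ≤ C)
    (hp : ∀ A B : ℤ, ((Finset.Icc (-(2 * (n : ℤ) ^ 2)) (2 * (n : ℤ) ^ 2)).filter
      (fun c => p (A, B, c))).card ≤ 2 * n) :
    ∑ j ∈ (lineCoeffs n).filter (fun j => j.1 ≠ 0 ∧ j.2.1 ≠ 0),
      (if p j then C / n * (((j.1 : ℝ) ^ 2)⁻¹ * ((j.2.1 : ℝ) ^ 2)⁻¹) else 0) ≤ 32 * C := by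
  have hsub : (lineCoeffs n).filter (fun j => j.1 ≠ 0 ∧ j.2.1 ≠ 0) ⊆
      (Finset.Icc (-(n : ℤ)) n).filter (· ≠ 0) ×ˢ (Finset.Icc (-(n : ℤ)) n).filter (· ≠ 0) ×ˢ
      Finset.Icc (-(2 * (n : ℤ) ^ 2)) (2 * (n : ℤ) ^ 2) := by
    intro j hj
    simp only [lineCoeffs, Finset.mem_filter, Finset.mem_product] at hj ⊢
    tauto
  have h2n : (2 * n : ℝ) * (C / n) ≤ 2 * C := by
    rcases Nat.eq_zero_or_pos n with rfl | hn
    · simp [hC]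
    · have : (0 : ℝ) < n := by exact_mod_cast hn
      refine le_of_eq ?_
      field_simp
  have h4 := sum_Icc_int_inv_sq_le n
  have h0 : 0 ≤ ∑ A ∈ (Finset.Icc (-(n : ℤ)) n).filter (· ≠ 0), (((A : ℝ)) ^ 2)⁻¹ :=
    Finset.sum_nonneg fun _ _ => by positivity
  refine (Finset.sum_le_sum_of_subset_of_nonneg hsub fun j _ _ => by
    split_ifs <;> positivity).trans ?_
  simp_rw [Finset.sum_product]
  calc _ ≤ ∑ A ∈ (Finset.Icc (-(n : ℤ)) n).filter (· ≠ 0),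
        ∑ B ∈ (Finset.Icc (-(n : ℤ)) n).filter (· ≠ 0),
          2 * C * (((A : ℝ) ^ 2)⁻¹ * ((B : ℝ) ^ 2)⁻¹) := by
        refine Finset.sum_le_sum fun A _ => Finset.sum_le_sum fun B _ => ?_
        rw [← Finset.sum_filter, Finset.sum_const, nsmul_eq_mul, ← mul_assoc]
        refine mul_le_mul_of_nonneg_right (le_trans ?_ h2n) (by positivity)
        refine mul_le_mul_of_nonneg_right ?_ (by positivity)
        exact_mod_cast hp A B
    _ = 2 * C * ((∑ A ∈ (Finset.Icc (-(n : ℤ)) n).filter (· ≠ 0), (((A : ℝ)) ^ 2)⁻¹) *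
        (∑ B ∈ (Finset.Icc (-(n : ℤ)) n).filter (· ≠ 0), (((B : ℝ)) ^ 2)⁻¹)) := by
        rw [Finset.sum_mul_sum, Finset.mul_sum]
        simp_rw [Finset.mul_sum]
    _ ≤ 2 * C * (4 * 4) := by gcongr
    _ = _ := by ring

/-- Few lines of a given direction meet a given row or column. -/
lemma card_lines_through_cross_le {n : ℕ} {κ : Type*} [Fintype κ] [DecidableEq κ] (a b : κ → Fin n)
    (P : κ) (A B : ℤ) (C : Finset ℤ) :
    (C.filter (fun c => P ∈ crossIndices a b (linePoints n (A, B, c)))).card ≤ 2 * n := by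
  have h : C.filter (fun c => P ∈ crossIndices a b (linePoints n (A, B, c))) ⊆
      (Finset.univ.image (fun y : Fin n => A * (a P : ℕ) + B * (y : ℕ))) ∪
      (Finset.univ.image (fun x : Fin n => A * (x : ℕ) + B * (b P : ℕ))) := by
    intro c hc
    obtain ⟨w, hw, h⟩ := (Finset.mem_filter.1 (Finset.mem_filter.1 hc).2).2
    have hw := mem_linePoints.1 hw
    simp only [Finset.mem_union, Finset.mem_image, Finset.mem_univ, true_and]
    rcases h with h | h
    · exact Or.inl ⟨w.2, by rw [← h]; exact hw⟩
    · exact Or.inr ⟨w.1, by rw [← h]; exact hw⟩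
  refine (Finset.card_le_card h).trans ((Finset.card_union_le _ _).trans ?_)
  have h1 := Finset.card_image_le (s := (Finset.univ : Finset (Fin n)))
    (f := fun y : Fin n => A * (a P : ℕ) + B * (y : ℕ))
  have h2 := Finset.card_image_le (s := (Finset.univ : Finset (Fin n)))
    (f := fun x : Fin n => A * (x : ℕ) + B * (b P : ℕ))
  rw [Finset.card_univ, Fintype.card_fin] at h1 h2
  omega

lemma card_points_through_cross_le {n : ℕ} {κ : Type*} [Fintype κ] [DecidableEq κ]
    (a b : κ → Fin n) (P : κ) :
    (Finset.univ.filter (fun z : Fin n × Fin n => P ∈ crossIndices a b {z})).card ≤ 2 * n := by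
  have h : Finset.univ.filter (fun z : Fin n × Fin n => P ∈ crossIndices a b {z}) ⊆
      (Finset.univ.image (fun y : Fin n => (a P, y))) ∪
      (Finset.univ.image (fun x : Fin n => (x, b P))) := by
    intro z hz
    obtain ⟨w, hw, h⟩ := (Finset.mem_filter.1 (Finset.mem_filter.1 hz).2).2
    rw [Finset.mem_singleton] at hw
    subst hw
    simp only [Finset.mem_union, Finset.mem_image, Finset.mem_univ, true_and]
    rcases h with h | h
    · exact Or.inl ⟨w.2, by rw [← h]⟩
    · exact Or.inr ⟨w.1, by rw [← h]⟩
  refine (Finset.card_le_card h).trans ((Finset.card_union_le _ _).trans ?_)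
  have h1 := Finset.card_image_le (s := (Finset.univ : Finset (Fin n)))
    (f := fun y : Fin n => (a P, y))
  have h2 := Finset.card_image_le (s := (Finset.univ : Finset (Fin n)))
    (f := fun x : Fin n => (x, b P))
  rw [Finset.card_univ, Fintype.card_fin] at h1 h2
  omega

/-- Whether the swap `z` used for row `a` and column `b` adds a point of `U`. -/
def swapHits {n : ℕ} (a b : Fin n) (U : Finset (Fin n × Fin n)) (z : Fin n × Fin n) : Prop :=
  (a, z.2) ∈ U ∨ (z.1, b) ∈ U

instance {n : ℕ} (a b : Fin n) (U : Finset (Fin n × Fin n)) : DecidablePred (swapHits a b U) :=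
  fun _ => inferInstanceAs (Decidable (_ ∨ _))

lemma card_le_mul_of_fst_fibers {n k : ℕ} {S : Finset (Fin n × Fin n)}
    (hrow : ∀ x, (S.filter (fun v => v.1 = x)).card ≤ k) : S.card ≤ n * k := by
  rw [Finset.card_eq_sum_card_fiberwise (f := Prod.fst) (t := Finset.univ) (by simp)]
  exact (Finset.sum_le_sum fun x _ => hrow x).trans (by simp)

lemma fintypeCard_le_mul_of_fibers {n : ℕ} {κ : Type*} [Fintype κ] {a : κ → Fin n} {D : ℝ}
    (ha : ∀ x, ((Finset.univ.filter (fun P => a P = x)).card : ℝ) ≤ D) :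
    (Fintype.card κ : ℝ) ≤ n * D := by
  rw [← Finset.card_univ, Finset.card_eq_sum_card_fiberwise (f := a) (t := Finset.univ) (by simp)]
  push_cast
  exact (Finset.sum_le_sum fun x _ => ha x).trans (by simp)

lemma sum_lines_through_le {n k : ℕ} {κ : Type*} [Fintype κ] [DecidableEq κ] {a b : κ → Fin n}
    (hk : 10 ^ 36 ≤ k) (hn : 0 < n)
    (ha : ∀ x, ((Finset.univ.filter (fun P => a P = x)).card : ℝ) ≤ 1.2 / 10 ^ 14 * k)
    (hb : ∀ y, ((Finset.univ.filter (fun P => b P = y)).card : ℝ) ≤ 1.2 / 10 ^ 14 * k) (P : κ) :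
    ∑ j ∈ (lineCoeffs n).filter (fun j => j.1 ≠ 0 ∧ j.2.1 ≠ 0),
      (if P ∈ crossIndices a b (linePoints n j) then
        (3 * (360000 / n : ℝ)) ^ ⌈0.002 * (k : ℝ)⌉₊ *
          ((crossIndices a b (linePoints n j)).card.choose (⌈0.002 * (k : ℝ)⌉₊ - 1) : ℝ)
        else 0) ≤ 32 * (1 / 10 ^ 9) := by
  refine le_trans (Finset.sum_le_sum fun j hj => ?_) (sum_lines_le (n := n)
    (fun j => P ∈ crossIndices a b (linePoints n j)) (by norm_num)
    fun A B => card_lines_through_cross_le a b P A B _)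
  split_ifs
  · obtain ⟨hj, hA, hB⟩ := Finset.mem_filter.1 hj
    refine line_term_le hk hn hA hB ?_
    have h1 := card_crossIndices_le ha hb (linePoints n j)
    have h2 : ((linePoints n j).card : ℝ) * (max j.1.natAbs j.2.1.natAbs : ℕ) ≤ 2 * n := by
      exact_mod_cast card_linePoints_mul_max_le hj
    calc _ ≤ ((linePoints n j).card * (2 * (1.2 / 10 ^ 14 * k)) : ℝ) *
          (max j.1.natAbs j.2.1.natAbs : ℕ) := by gcongr
      _ = ((linePoints n j).card * (max j.1.natAbs j.2.1.natAbs : ℕ) : ℝ) *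
          (2 * (1.2 / 10 ^ 14 * k)) := by ring
      _ ≤ 2 * n * (2 * (1.2 / 10 ^ 14 * k)) := by gcongr
      _ = _ := by ring
  · exact le_rfl

lemma sum_cells_through_le {n k : ℕ} {κ : Type*} [Fintype κ] [DecidableEq κ] {a b : κ → Fin n}
    (hn : 0 < n) (hkn : (k : ℝ) ≤ 0.9 * n)
    (ha : ∀ x, ((Finset.univ.filter (fun P => a P = x)).card : ℝ) ≤ 1.2 / 10 ^ 14 * k)
    (hb : ∀ y, ((Finset.univ.filter (fun P => b P = y)).card : ℝ) ≤ 1.2 / 10 ^ 14 * k) (P : κ) :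
    ∑ z : Fin n × Fin n, (if P ∈ crossIndices a b {z} then
        (3 * (360000 / n : ℝ)) ^ 2 * ((crossIndices a b {z}).card.choose (2 - 1) : ℝ)
        else 0) ≤ 0.1 := by
  have hn' : (0 : ℝ) < n := by exact_mod_cast hn
  have h1 : ((Finset.univ.filter (fun z : Fin n × Fin n => P ∈ crossIndices a b {z})).card : ℝ)
      ≤ 2 * n := by exact_mod_cast card_points_through_cross_le a b P
  calc _ ≤ ∑ z : Fin n × Fin n, (if P ∈ crossIndices a b {z} then
        (3 * (360000 / n : ℝ)) ^ 2 * (2 * (1.2 / 10 ^ 14 * k)) else 0) := by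
        refine Finset.sum_le_sum fun z _ => ?_
        split_ifs
        · have := card_crossIndices_le ha hb {z}
          rw [Finset.card_singleton, Nat.cast_one, one_mul] at this
          rw [Nat.choose_one_right]
          gcongr
        · exact le_rfl
    _ ≤ 2 * n * ((3 * (360000 / n : ℝ)) ^ 2 * (2 * (1.2 / 10 ^ 14 * (0.9 * n)))) := by
        rw [← Finset.sum_filter, Finset.sum_const, nsmul_eq_mul]
        gcongr
    _ = 4 * 1080000 ^ 2 * 1.2 / 10 ^ 14 * 0.9 := by field_simp; ring
    _ ≤ _ := by norm_num

lemma sum_points_le {n k : ℕ} {κ : Type*} [Fintype κ] {a : κ → Fin n}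
    (hn : 0 < n) (hk : 0 < k) {S : Finset (Fin n × Fin n)}
    (hS : S.card ≤ n * k)
    (ha : ∀ x, ((Finset.univ.filter (fun P => a P = x)).card : ℝ) ≤ 1.2 / 10 ^ 14 * k) :
    (S.card : ℝ) * ((3 * (180000 / (n * k) : ℝ)) ^ 2 *
      ((Finset.univ : Finset κ).card.choose (2 - 1) : ℝ)) ≤ 0.1 := by
  have hn' : (0 : ℝ) < n := by exact_mod_cast hn
  have hk' : (0 : ℝ) < k := by exact_mod_cast hk
  have hS' : (S.card : ℝ) ≤ n * k := by exact_mod_cast hS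
  have h := fintypeCard_le_mul_of_fibers ha
  rw [Nat.choose_one_right, Finset.card_univ]
  calc _ ≤ (n * k : ℝ) * ((3 * (180000 / (n * k) : ℝ)) ^ 2 * (n * (1.2 / 10 ^ 14 * k))) := by
        gcongr
    _ = 540000 ^ 2 * 1.2 / 10 ^ 14 := by field_simp; ring
    _ ≤ _ := by norm_num

theorem exists_swaps {n k : ℕ} {κ : Type*} [Fintype κ] [DecidableEq κ] {a b : κ → Fin n}
    (hk : 10 ^ 36 ≤ k) (hkn : (k : ℝ) ≤ 0.9 * n)
    (ha : ∀ x, ((Finset.univ.filter (fun P => a P = x)).card : ℝ) ≤ 1.2 / 10 ^ 14 * k)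
    (hb : ∀ y, ((Finset.univ.filter (fun P => b P = y)).card : ℝ) ≤ 1.2 / 10 ^ 14 * k)
    {S : Finset (Fin n × Fin n)}
    (hrow : ∀ x, (S.filter (fun v => v.1 = x)).card ≤ k)
    (hcol : ∀ y, (S.filter (fun v => v.2 = y)).card ≤ k)
    (hopt : ∀ x y, (n : ℝ) * k / 180000 ≤ (swapOptions S x y).card) :
    ∃ o : κ → Fin n × Fin n, (∀ P, o P ∈ swapOptions S (a P) (b P)) ∧
      (∀ z, cnt (fun P => o P = z) < 2) ∧
      (∀ z, cnt (fun P => swapHits (a P) (b P) {z} (o P)) < 2) ∧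
      ∀ j ∈ lineCoeffs n, j.1 ≠ 0 → j.2.1 ≠ 0 →
        cnt (fun P => swapHits (a P) (b P) (linePoints n j) (o P)) < ⌈0.002 * (k : ℝ)⌉₊ := by
  have hk' : (10 : ℝ) ^ 36 ≤ k := by exact_mod_cast hk
  have hk0 : (0 : ℝ) < k := by linarith
  have hn36 : (10 : ℝ) ^ 36 ≤ n := by linarith
  have hn0 : (0 : ℝ) < n := by linarith
  have hn : 0 < n := by exact_mod_cast hn0
  have hnk : (10 : ℝ) ^ 36 ≤ n * k := by nlinarith
  have hne : ∀ P : κ, Nonempty (swapOptions S (a P) (b P)) := by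
    intro P
    have h : (0 : ℝ) < (swapOptions S (a P) (b P)).card :=
      lt_of_lt_of_le (by positivity) (hopt _ _)
    exact (Finset.card_pos.1 (by exact_mod_cast h)).coe_sort
  have hcross : ∀ U : Finset (Fin n × Fin n), Set.InjOn Prod.fst (U : Set (Fin n × Fin n)) →
      Set.InjOn Prod.snd (U : Set (Fin n × Fin n)) → ∀ P,
      cnt (fun z : swapOptions S (a P) (b P) => swapHits (a P) (b P) U z) ≤
        360000 / n * Fintype.card (swapOptions S (a P) (b P)) := by
    intro U h1 h2 P
    have h3 : ((S.filter (swapHits (a P) (b P) U)).card : ℝ) ≤ 2 * k := by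
      exact_mod_cast card_filter_cross_le hrow hcol h1 h2 (a P) (b P)
    calc _ ≤ ((S.filter (swapHits (a P) (b P) U)).card : ℝ) :=
          cnt_coe_le (Finset.filter_subset _ _) _
      _ ≤ 2 * k := h3
      _ = 360000 / n * (n * k / 180000) := by field_simp; ring
      _ ≤ _ := by
          rw [Fintype.card_coe]
          gcongr
          exact hopt _ _
  have hmem : ∀ (U : Finset (Fin n × Fin n)) P (z : Fin n × Fin n), swapHits (a P) (b P) U z →
      P ∈ crossIndices a b U := by
    intro U P z h
    refine Finset.mem_filter.2 ⟨Finset.mem_univ _, ?_⟩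
    rcases h with h | h
    · exact ⟨_, h, Or.inl rfl⟩
    · exact ⟨_, h, Or.inr rfl⟩
  have hθ : 3 * (360000 / n : ℝ) ≤ 1 / 2 := by
    rw [mul_div_assoc', div_le_iff₀ hn0]
    linarith
  obtain ⟨ω, hω⟩ := exists_choice (α := fun P => swapOptions S (a P) (b P))
    (((lineCoeffs n).filter (fun j => j.1 ≠ 0 ∧ j.2.1 ≠ 0)).disjSum
      ((Finset.univ : Finset (Fin n × Fin n)).disjSum S))
    (Sum.elim (fun j P z => swapHits (a P) (b P) (linePoints n j) z)
      (Sum.elim (fun u P z => swapHits (a P) (b P) {u} z) (fun u _ z => (z : Fin n × Fin n) = u)))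
    (Sum.elim (fun j => crossIndices a b (linePoints n j))
      (Sum.elim (fun u => crossIndices a b {u}) (fun _ => Finset.univ)))
    (Sum.elim (fun _ => 360000 / n) (Sum.elim (fun _ => 360000 / n) (fun _ => 180000 / (n * k))))
    (Sum.elim (fun _ => ⌈0.002 * (k : ℝ)⌉₊) (Sum.elim (fun _ => 2) (fun _ => 2)))
    (by rintro (j | u | u) - <;> simp only [Sum.elim_inl, Sum.elim_inr] <;> positivity)
    (by
      rintro (j | u | u) hj P
      · rw [Finset.inl_mem_disjSum] at hj
        obtain ⟨-, hA, hB⟩ := Finset.mem_filter.1 hj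
        exact hcross _ (injOn_fst_linePoints hB) (injOn_snd_linePoints hA) P
      · exact hcross _ (by simp) (by simp) P
      · simp only [Sum.elim_inr]
        have hone : ((swapOptions S (a P) (b P)).filter (fun v => v = u)).card ≤ 1 :=
          Finset.card_le_one.2 fun x hx y hy =>
            (Finset.mem_filter.1 hx).2.trans (Finset.mem_filter.1 hy).2.symm
        calc _ ≤ (((swapOptions S (a P) (b P)).filter (fun v => v = u)).card : ℝ) :=
              cnt_coe_le subset_rfl _
          _ ≤ 1 := by exact_mod_cast hone
          _ = 180000 / (n * k) * (n * k / 180000) := by field_simp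
          _ ≤ _ := by
              rw [Fintype.card_coe]
              gcongr
              exact hopt _ _)
    (by
      rintro (j | u | u) - P o h
      · exact hmem _ _ _ h
      · exact hmem _ _ _ h
      · exact Finset.mem_univ _)
    (by
      rintro (j | u | u) -
      · simp only [Sum.elim_inl]
        exact Nat.one_le_ceil_iff.2 (by positivity)
      · simp
      · simp)
    (by
      rintro (j | u | u) -
      · exact hθ
      · exact hθ
      · simp only [Sum.elim_inr]
        rw [mul_div_assoc', div_le_iff₀ (by positivity)]
        linarith)
    (by
      intro P
      rw [Finset.sum_filter, Finset.sum_disjSum, Finset.sum_disjSum]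
      simp only [Sum.elim_inl, Sum.elim_inr, Finset.mem_univ, if_true]
      rw [Finset.sum_const, nsmul_eq_mul]
      have h1 := sum_lines_through_le hk hn ha hb P
      have h2 := sum_cells_through_le hn hkn ha hb P
      have h3 := sum_points_le (κ := κ) hn (by omega) (card_le_mul_of_fst_fibers hrow) ha
      linarith)
  refine ⟨fun P => ω P, fun P => (ω P).2, fun z => ?_, fun z => ?_, fun j hj hA hB => ?_⟩
  · by_cases hz : z ∈ S
    · exact_mod_cast hω (Sum.inr (Sum.inr z)) (by simpa using hz)
    · rw [cnt_eq_card, Finset.filter_false_of_mem]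
      · simp
      · rintro P - rfl
        exact hz (mem_swapOptions.1 (ω P).2).1
  · exact_mod_cast hω (Sum.inr (Sum.inl z)) (by simp)
  · exact hω (Sum.inl j) (by simpa using ⟨hj, hA, hB⟩)

lemma eq_of_cnt_lt_two {Ω : Type*} [Fintype Ω] {p : Ω → Prop} (h : cnt p < 2) {P Q : Ω}
    (hP : p P) (hQ : p Q) : P = Q := by
  classical
  rw [cnt_eq_card] at h
  have h' : (Finset.univ.filter p).card ≤ 1 := by
    have : (Finset.univ.filter p).card < 2 := by exact_mod_cast h
    omega
  exact Finset.card_le_one.1 h' P (by simpa using hP) Q (by simpa using hQ)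

lemma sum_sub_card_fibers {n k : ℕ} {V : Type*} (S : Finset V) (f : V → Fin n)
    (h : ∀ x, (S.filter (fun v => f v = x)).card ≤ k) :
    ∑ x, (k - (S.filter (fun v => f v = x)).card) + S.card = n * k := by
  rw [Finset.card_eq_sum_card_fiberwise (s := S) (f := f) (t := Finset.univ) (by simp),
    ← Finset.sum_add_distrib]
  calc _ = ∑ _x : Fin n, k := Finset.sum_congr rfl fun x _ => Nat.sub_add_cancel (h x)
    _ = _ := by simp

/-- The finite form of the main result, with lines described by integer equations. -/
theorem exists_regular {n k : ℕ} (hk : 10 ^ 36 ≤ k) (hkn : (k : ℝ) ≤ 0.9 * n) :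
    ∃ S : Finset (Fin n × Fin n), (∀ x, (S.filter (fun v => v.1 = x)).card = k) ∧
      (∀ y, (S.filter (fun v => v.2 = y)).card = k) ∧
      ∀ j ∈ lineCoeffs n, j.1 ≠ 0 → j.2.1 ≠ 0 →
        ((S.filter (fun v => v ∈ linePoints n j)).card : ℝ) ≤
          k * ((linePoints n j).card / n + 0.01) := by
  obtain ⟨S, hdiag, hrow, hcol, hres, hline⟩ := exists_initial hk hkn
  have hrow' := fun x => (hrow x).1
  have hcol' := fun y => (hcol y).1
  obtain ⟨κ, _, _, a, b, ha, hb⟩ := exists_stubs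
    (fun x => k - (S.filter (fun v => v.1 = x)).card)
    (fun y => k - (S.filter (fun v => v.2 = y)).card) (by
      have h1 := sum_sub_card_fibers S Prod.fst hrow'
      have h2 := sum_sub_card_fibers S Prod.snd hcol'
      omega)
  obtain ⟨o, ho, hpt, hcell, hl⟩ := exists_swaps hk hkn (a := a) (b := b)
    (fun x => by
      rw [ha, Nat.cast_sub (hrow' x)]
      linarith [(hrow x).2])
    (fun y => by
      rw [hb, Nat.cast_sub (hcol' y)]
      linarith [(hcol y).2]) hrow' hcol' (card_swapOptions_ge hk hkn hres)
  have ho' := fun P => mem_swapOptions.1 (ho P)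
  obtain ⟨S', hswap⟩ : ∃ S' : Finset (Fin n × Fin n),
      ∀ (p : Fin n × Fin n → Prop) [DecidablePred p],
        (S'.filter p).card + (Finset.univ.filter (fun P => p (o P))).card =
          (S.filter p).card + (Finset.univ.filter (fun P => p (a P, (o P).2))).card +
            (Finset.univ.filter (fun P => p ((o P).1, b P))).card :=
    ⟨_, fun p _ => card_filter_swap S o (fun P => (a P, (o P).2)) (fun P => ((o P).1, b P))
      (fun P Q h => eq_of_cnt_lt_two (hpt (o Q)) h rfl)
      (fun P Q h => eq_of_cnt_lt_two (hcell (a Q, (o Q).2)) (Or.inl (Finset.mem_singleton.2 h))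
        (Or.inl (Finset.mem_singleton.2 rfl)))
      (fun P Q h => eq_of_cnt_lt_two (hcell ((o Q).1, b Q)) (Or.inr (Finset.mem_singleton.2 h))
        (Or.inr (Finset.mem_singleton.2 rfl)))
      (fun P Q h => by
        have hPQ : P = Q := eq_of_cnt_lt_two (hcell ((o Q).1, b Q))
          (Or.inl (Finset.mem_singleton.2 h)) (Or.inr (Finset.mem_singleton.2 rfl))
        subst hPQ
        have h1 : a P = (o P).1 := (Prod.ext_iff.1 h).1
        have h2 := (ho' P).2.1
        rw [h1] at h2
        exact hdiag _ (ho' P).1 h2)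
      (fun P => (ho' P).1) (fun P h => hdiag _ h (ho' P).2.1) (fun P h => hdiag _ h (ho' P).2.2) p⟩
  refine ⟨S', fun x => ?_, fun y => ?_, fun j hj hA hB => ?_⟩
  · have h := hswap (fun v => v.1 = x)
    simp only [ha] at h
    have := hrow' x
    omega
  · have h := hswap (fun v => v.2 = y)
    simp only [hb] at h
    have := hcol' y
    omega
  · have h := hswap (fun v => v ∈ linePoints n j)
    have h1 := hl j hj hA hB
    rw [cnt_eq_card, Nat.cast_lt, Nat.lt_ceil] at h1
    have h2 : (Finset.univ.filter (fun P => (a P, (o P).2) ∈ linePoints n j)).card ≤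
        (Finset.univ.filter (fun P => swapHits (a P) (b P) (linePoints n j) (o P))).card :=
      Finset.card_le_card (Finset.monotone_filter_right _ fun P _ => Or.inl)
    have h3 : (Finset.univ.filter (fun P => ((o P).1, b P) ∈ linePoints n j)).card ≤
        (Finset.univ.filter (fun P => swapHits (a P) (b P) (linePoints n j) (o P))).card :=
      Finset.card_le_card (Finset.monotone_filter_right _ fun P _ => Or.inr)
    have h4 := hline j hj
    rw [Finset.inter_comm, ← Finset.filter_mem_eq_inter] at h4
    have h5 : ((S'.filter (fun v => v ∈ linePoints n j)).card : ℝ) ≤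
        (S.filter (fun v => v ∈ linePoints n j)).card + 2 *
        (Finset.univ.filter (fun P => swapHits (a P) (b P) (linePoints n j) (o P))).card := by
      norm_cast
      omega
    linarith [(Nat.cast_nonneg k : (0 : ℝ) ≤ k)]

lemma mem_line_iff {L : AffineSubspace ℝ (ℝ × ℝ)} (hL : IsLine L) {p q : ℝ × ℝ} (hp : p ∈ L)
    (hq : q ∈ L) (hpq : p ≠ q) (r : ℝ × ℝ) :
    r ∈ L ↔ (q.2 - p.2) * (r.1 - p.1) = (q.1 - p.1) * (r.2 - p.2) := by
  have hv : q - p ∈ L.direction := AffineSubspace.vsub_mem_direction hq hp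
  have hv0 : (⟨q - p, hv⟩ : L.direction) ≠ 0 := by
    rw [Ne, Subtype.ext_iff]
    exact sub_ne_zero.2 hpq.symm
  rw [← AffineSubspace.vsub_right_mem_direction_iff_mem hp r, vsub_eq_sub]
  constructor
  · intro h
    obtain ⟨c, hc⟩ := (finrank_eq_one_iff_of_nonzero' _ hv0).1 hL ⟨r - p, h⟩
    have hc : c • (q - p) = r - p := congrArg Subtype.val hc
    have h1 : c * (q.1 - p.1) = r.1 - p.1 := congrArg Prod.fst hc
    have h2 : c * (q.2 - p.2) = r.2 - p.2 := congrArg Prod.snd hc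
    rw [← h1, ← h2]
    ring
  · intro h
    by_cases hx : q.1 - p.1 = 0
    · have hy : q.2 - p.2 ≠ 0 := fun hy =>
        hpq (Prod.ext (sub_eq_zero.1 hx).symm (sub_eq_zero.1 hy).symm)
      have : r - p = ((r.2 - p.2) / (q.2 - p.2)) • (q - p) := by
        rw [hx, zero_mul, mul_eq_zero, or_iff_right hy] at h
        ext
        · simp [h, hx]
        · simp [hy]
      rw [this]
      exact Submodule.smul_mem _ _ hv
    · have : r - p = ((r.1 - p.1) / (q.1 - p.1)) • (q - p) := by
        ext
        · simp [hx]
        · simp only [Prod.snd_sub, Prod.smul_snd, smul_eq_mul]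
          field_simp
          linarith
      rw [this]
      exact Submodule.smul_mem _ _ hv

/-- The embedding of `{0,…,n-1}²` into the plane as the grid `{1,…,n}²`. -/
def gridEmb (n : ℕ) (v : Fin n × Fin n) : ℝ × ℝ := ((v.1 : ℕ) + 1, (v.2 : ℕ) + 1)

lemma gridEmb_injective (n : ℕ) : Function.Injective (gridEmb n) := by
  intro v w h
  simpa [gridEmb, Prod.ext_iff, Fin.ext_iff] using h

lemma grid2_eq_range (n : ℕ) : grid2 n = Set.range (gridEmb n) := by
  ext p
  constructor
  · rintro ⟨a, b, ha, ha', hb, hb', rfl⟩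
    refine ⟨(⟨(a - 1).toNat, by omega⟩, ⟨(b - 1).toNat, by omega⟩), ?_⟩
    have h1 : (((a - 1).toNat : ℤ) : ℝ) = a - 1 := by
      rw [Int.toNat_of_nonneg (by omega)]
      push_cast
      ring
    have h2 : (((b - 1).toNat : ℤ) : ℝ) = b - 1 := by
      rw [Int.toNat_of_nonneg (by omega)]
      push_cast
      ring
    rw [Int.cast_natCast] at h1 h2
    simp only [gridEmb, h1, h2, sub_add_cancel]
  · rintro ⟨v, rfl⟩
    have h1 := v.1.2
    have h2 := v.2.2
    exact ⟨(v.1 : ℕ) + 1, (v.2 : ℕ) + 1, by omega, by omega, by omega, by omega, by simp [gridEmb]⟩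

lemma ncard_image_gridEmb_inter {n : ℕ} (S : Finset (Fin n × Fin n)) (M : Set (ℝ × ℝ))
    (p : Fin n × Fin n → Prop) [DecidablePred p] (h : ∀ v, gridEmb n v ∈ M ↔ p v) :
    (gridEmb n '' S ∩ M).ncard = (S.filter p).card := by
  rw [← Set.image_inter_preimage, Set.ncard_image_of_injective _ (gridEmb_injective n),
    ← Set.ncard_coe_finset]
  congr 1
  ext v
  simp [h]

lemma exists_lineCoeffs {n : ℕ} {L : AffineSubspace ℝ (ℝ × ℝ)} (hL : InLines n L)
    (hh : ¬ IsHorizontalLine L) (hv : ¬ IsVerticalLine L) :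
    ∃ j ∈ lineCoeffs n, j.1 ≠ 0 ∧ j.2.1 ≠ 0 ∧
      ∀ v, gridEmb n v ∈ (L : Set (ℝ × ℝ)) ↔ v ∈ linePoints n j := by
  obtain ⟨hL1, hL2⟩ := hL
  obtain ⟨p, q, ⟨hpg, hp⟩, ⟨hqg, hq⟩, hpq⟩ :=
    (Set.one_lt_ncard_iff (Set.finite_of_ncard_pos (by omega))).1 hL2
  have hmem := mem_line_iff hL1 hp hq hpq
  have hx : p.1 ≠ q.1 := by
    intro hx
    have hy : q.2 - p.2 ≠ 0 := fun hy => hpq (Prod.ext hx (sub_eq_zero.1 hy).symm)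
    refine hv ⟨p.1, Set.ext fun r => ?_⟩
    rw [SetLike.mem_coe, hmem, hx, sub_self, zero_mul, mul_eq_zero, or_iff_right hy, sub_eq_zero,
      Set.mem_ofPred_eq]
  have hy : p.2 ≠ q.2 := by
    intro hy
    refine hh ⟨p.2, Set.ext fun r => ?_⟩
    rw [SetLike.mem_coe, hmem, hy, sub_self, zero_mul, eq_comm, mul_eq_zero,
      or_iff_right (sub_ne_zero.2 hx.symm), sub_eq_zero, Set.mem_ofPred_eq]
  rw [grid2_eq_range] at hpg hqg
  obtain ⟨u, rfl⟩ := hpg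
  obtain ⟨w, rfl⟩ := hqg
  have hx' : ((w.1 : ℕ) : ℤ) - (u.1 : ℕ) ≠ 0 := by
    intro h
    have : (u.1 : ℕ) = w.1 := by omega
    exact hx (by simp [gridEmb, this])
  have hy' : ((w.2 : ℕ) : ℤ) - (u.2 : ℕ) ≠ 0 := by
    intro h
    have : (u.2 : ℕ) = w.2 := by omega
    exact hy (by simp [gridEmb, this])
  have hg0 : 0 < Int.gcd (((w.2 : ℕ) : ℤ) - (u.2 : ℕ)) (((w.1 : ℕ) : ℤ) - (u.1 : ℕ)) :=
    Int.gcd_pos_of_ne_zero_left _ hy'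
  obtain ⟨g, A, B, hg, hcop, hA, hB⟩ := Int.exists_gcd_one' hg0
  have hg1 : (1 : ℤ) ≤ g := by exact_mod_cast hg
  have hAn : |A| ≤ n := by
    have h1 : |A| ≤ |A| * g := le_mul_of_one_le_right (abs_nonneg _) hg1
    have h2 : |A| * g = |((w.2 : ℕ) : ℤ) - (u.2 : ℕ)| := by
      rw [hA, abs_mul, abs_of_nonneg (by omega : (0 : ℤ) ≤ g)]
    have h3 : |((w.2 : ℕ) : ℤ) - (u.2 : ℕ)| ≤ n := by rw [abs_le]; omega
    omega
  have hBn : |-B| ≤ n := by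
    have h1 : |B| ≤ |B| * g := le_mul_of_one_le_right (abs_nonneg _) hg1
    have h2 : |B| * g = |((w.1 : ℕ) : ℤ) - (u.1 : ℕ)| := by
      rw [hB, abs_mul, abs_of_nonneg (by omega : (0 : ℤ) ≤ g)]
    have h3 : |((w.1 : ℕ) : ℤ) - (u.1 : ℕ)| ≤ n := by rw [abs_le]; omega
    rw [abs_neg]
    omega
  refine ⟨(A, -B, A * (u.1 : ℕ) + -B * (u.2 : ℕ)),
    mem_lineCoeffs.2 ⟨⟨hAn, hBn, abs_coeff_le_of_linePoints hAn hBn u⟩, ?_⟩, ?_, ?_, fun v => ?_⟩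
  · exact (Int.isCoprime_iff_gcd_eq_one.2 hcop).neg_right
  · rintro rfl
    exact hy' (by rw [hA, zero_mul])
  · intro h
    exact hx' (by rw [hB, neg_eq_zero.1 h, zero_mul])
  · have hA' : ((w.2 : ℕ) : ℝ) - (u.2 : ℕ) = A * g := by exact_mod_cast hA
    have hB' : ((w.1 : ℕ) : ℝ) - (u.1 : ℕ) = B * g := by exact_mod_cast hB
    have hg' : (g : ℝ) ≠ 0 := by exact_mod_cast hg.ne'
    rw [SetLike.mem_coe, hmem, mem_linePoints, ← @Int.cast_inj ℝ]
    simp only [gridEmb, add_sub_add_right_eq_sub, hA', hB']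
    push_cast
    constructor
    · intro h
      refine mul_right_cancel₀ hg' ?_
      linear_combination h
    · intro h
      linear_combination (g : ℝ) * h

/-- For integers `10^36 ≤ k ≤ 0.9 n` there is `S ⊆ [n]²` containing exactly `k`
points on each horizontal and each vertical line through the grid, and at most
`k (w(L) + 0.01)` points on every other line `L ∈ 𝓛`. -/
theorem relaxed_version (n k : ℕ) (hk : 10 ^ 36 ≤ k) (hkn : (k : ℝ) ≤ 0.9 * n) :
    ∃ S : Set (ℝ × ℝ), S ⊆ grid2 n ∧
      (∀ c : ℤ, 1 ≤ c → c ≤ (n : ℤ) →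
        (S ∩ {p : ℝ × ℝ | p.2 = (c : ℝ)}).ncard = k) ∧
      (∀ c : ℤ, 1 ≤ c → c ≤ (n : ℤ) →
        (S ∩ {p : ℝ × ℝ | p.1 = (c : ℝ)}).ncard = k) ∧
      (∀ L : AffineSubspace ℝ (ℝ × ℝ), InLines n L →
        ¬IsHorizontalLine L → ¬IsVerticalLine L →
        ((S ∩ (L : Set (ℝ × ℝ))).ncard : ℝ) ≤ k * (lineWeight n L + 0.01)) := by
  obtain ⟨S, hrow, hcol, hline⟩ := exists_regular hk hkn
  refine ⟨gridEmb n '' S, ?_, fun c hc hc' => ?_, fun c hc hc' => ?_, fun L hL hh hv => ?_⟩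
  · rw [grid2_eq_range]
    exact Set.image_subset_range _ _
  · obtain ⟨y, hy⟩ : ∃ y : Fin n, ((y : ℕ) : ℤ) + 1 = c :=
      ⟨⟨(c - 1).toNat, by omega⟩, by simp only; omega⟩
    rw [ncard_image_gridEmb_inter S _ (fun v => v.2 = y) fun v => ?_, hcol y]
    simp [gridEmb, ← hy, Fin.ext_iff]
  · obtain ⟨x, hx⟩ : ∃ x : Fin n, ((x : ℕ) : ℤ) + 1 = c :=
      ⟨⟨(c - 1).toNat, by omega⟩, by simp only; omega⟩
    rw [ncard_image_gridEmb_inter S _ (fun v => v.1 = x) fun v => ?_, hrow x]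
    simp [gridEmb, ← hx, Fin.ext_iff]
  · obtain ⟨j, hj, hA, hB, hjL⟩ := exists_lineCoeffs hL hh hv
    have hw : lineWeight n L = (linePoints n j).card / n := by
      have h := ncard_image_gridEmb_inter Finset.univ (L : Set (ℝ × ℝ))
        (fun v => v ∈ linePoints n j) hjL
      rw [Finset.coe_univ, Set.image_univ, ← grid2_eq_range] at h
      rw [lineWeight, h, Finset.filter_univ_mem]
    rw [ncard_image_gridEmb_inter S _ _ hjL, hw]
    exact hline j hj hA hB
end
end

section
/- For every integer d ≥ 2 and every ε > 0 there exists K₁ = K₁(ε, d) such that the following holds. For all integers n, k, t with K₁ ≤ k ≤ n^t and 1 ≤ t ≤ d−1, there exists a subset S ⊆ [n]^d such that |S ∩ F| ≤ k for every t-dimensional affine subspace F of ℝ^d, and |S ∩ F| ≥ (1−ε)·k for every axis-aligned t-dimensional affine subspace F of ℝ^d that intersects [n]^d. -/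
open Set

noncomputable section

/-- The grid `[n]^d = {1,…,n}^d` regarded as a subset of `ℝ^d`. -/
def gridD (n d : ℕ) : Set (Fin d → ℝ) :=
  {x | ∀ i, ∃ a : ℤ, 1 ≤ a ∧ a ≤ (n : ℤ) ∧ x i = (a : ℝ)}

/-- A `t`-dimensional affine subspace of `ℝ^d`. -/
def IsAffineOfDim (d t : ℕ) (F : AffineSubspace ℝ (Fin d → ℝ)) : Prop :=
  Module.finrank ℝ F.direction = t

/-- An axis-aligned `t`-dimensional affine subspace of `ℝ^d`: one of the form
`{x : x i = c i for all i ∈ I}` for an index set `I` of size `d - t`. -/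
def IsAxisAligned (d t : ℕ) (F : AffineSubspace ℝ (Fin d → ℝ)) : Prop :=
  ∃ (I : Finset (Fin d)) (c : Fin d → ℝ), I.card = d - t ∧
    (F : Set (Fin d → ℝ)) = {x | ∀ i ∈ I, x i = c i}

open MeasureTheory ProbabilityTheory in
/-- A symmetric (lopsided) Lovász local lemma: if each event `A i` has conditional probability at
most `q` given the avoidance of any events outside its neighbourhood, neighbourhoods have at most
`D` elements and `4 q D ≤ 1`, then all events can be avoided simultaneously. -/
theorem lovasz_local_lemma {Ω κ : Type*} [MeasurableSpace Ω] (μ : Measure Ω)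
    [IsProbabilityMeasure μ] [DecidableEq κ] (A : κ → Set Ω) (hA : ∀ i, MeasurableSet (A i))
    (I : Finset κ) (nbr : κ → κ → Prop) [∀ i, DecidablePred (nbr i)] (q : ℝ) (D : ℕ)
    (hq : 0 ≤ q) (hq2 : 2 * q < 1) (hD : 4 * q * D ≤ 1)
    (hcard : ∀ i ∈ I, (I.filter (nbr i)).card ≤ D)
    (hind : ∀ i ∈ I, ∀ S ⊆ I, (∀ j ∈ S, ¬ nbr i j) →
      μ.real (A i ∩ ⋂ j ∈ S, (A j)ᶜ) ≤ q * μ.real (⋂ j ∈ S, (A j)ᶜ)) :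
    0 < μ.real (⋂ j ∈ I, (A j)ᶜ) := by
  have hNm : ∀ S : Finset κ, MeasurableSet (⋂ j ∈ S, (A j)ᶜ) := fun S =>
    Finset.measurableSet_biInter S fun j _ => (hA j).compl
  have key : ∀ (m : ℕ) (S : Finset κ), S.card ≤ m → S ⊆ I → ∀ i ∈ I,
      μ.real (A i ∩ ⋂ j ∈ S, (A j)ᶜ) ≤ 2 * q * μ.real (⋂ j ∈ S, (A j)ᶜ) := by
    intro m
    induction m with
    | zero =>
      intro S hS hSI i hi
      have : S = ∅ := Finset.card_eq_zero.1 (by omega)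
      subst this
      refine (hind i hi ∅ hSI (by simp)).trans ?_
      have : (0 : ℝ) ≤ μ.real (⋂ j ∈ (∅ : Finset κ), (A j)ᶜ) := measureReal_nonneg
      nlinarith [mul_nonneg hq this]
    | succ m ih =>
      intro S hS hSI i hi
      set S1 := S.filter (nbr i) with hS1
      set S2 := S.filter (fun j => ¬ nbr i j) with hS2
      have hsub2 : S2 ⊆ S := Finset.filter_subset _ _
      have h0 : (0 : ℝ) ≤ μ.real (⋂ j ∈ S2, (A j)ᶜ) := measureReal_nonneg
      have hup : μ.real (A i ∩ ⋂ j ∈ S, (A j)ᶜ) ≤ q * μ.real (⋂ j ∈ S2, (A j)ᶜ) := by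
        refine le_trans (measureReal_mono ?_) (hind i hi S2 (hsub2.trans hSI) ?_)
        · exact Set.inter_subset_inter_right _ (Set.biInter_subset_biInter_left hsub2)
        · intro j hj
          exact (Finset.mem_filter.1 hj).2
      have hlow : μ.real (⋂ j ∈ S2, (A j)ᶜ) ≤ 2 * μ.real (⋂ j ∈ S, (A j)ᶜ) := by
        by_cases hne : S1 = ∅
        · have : S2 = S := by
            rw [hS2, Finset.filter_eq_self]
            intro j hj hn
            have : j ∈ S1 := Finset.mem_filter.2 ⟨hj, hn⟩
            simp [hne] at this
          rw [this] at h0 ⊢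
          linarith
        · have hlt : S2.card ≤ m := by
            have h1 : S1.card + S2.card = S.card := Finset.card_filter_add_card_filter_not _
            have h2 : 0 < S1.card := Finset.card_pos.2 (Finset.nonempty_iff_ne_empty.2 hne)
            omega
          have hcov : (⋂ j ∈ S2, (A j)ᶜ) ⊆
              (⋂ j ∈ S, (A j)ᶜ) ∪ ⋃ j ∈ S1, (A j ∩ ⋂ l ∈ S2, (A l)ᶜ) := by
            intro ω hω
            by_cases h : ∃ j ∈ S1, ω ∈ A j
            · obtain ⟨j, hj, hjA⟩ := h
              exact Or.inr (Set.mem_biUnion hj ⟨hjA, hω⟩)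
            · push Not at h
              refine Or.inl (Set.mem_iInter₂.2 fun j hj => ?_)
              by_cases hn : nbr i j
              · exact h j (Finset.mem_filter.2 ⟨hj, hn⟩)
              · exact Set.mem_iInter₂.1 hω j (Finset.mem_filter.2 ⟨hj, hn⟩)
          have h1 : μ.real (⋂ j ∈ S2, (A j)ᶜ) ≤ μ.real (⋂ j ∈ S, (A j)ᶜ) +
              ∑ j ∈ S1, μ.real (A j ∩ ⋂ l ∈ S2, (A l)ᶜ) :=
            (measureReal_mono hcov).trans ((measureReal_union_le _ _).trans
              (by gcongr; exact measureReal_biUnion_finset_le _ _))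
          have h2 : ∑ j ∈ S1, μ.real (A j ∩ ⋂ l ∈ S2, (A l)ᶜ) ≤
              ∑ j ∈ S1, 2 * q * μ.real (⋂ j ∈ S2, (A j)ᶜ) :=
            Finset.sum_le_sum fun j hj =>
              ih S2 hlt (hsub2.trans hSI) j (hSI (Finset.filter_subset _ _ hj))
          rw [Finset.sum_const, nsmul_eq_mul] at h2
          have h3 : (S1.card : ℝ) ≤ D := by
            exact_mod_cast (Finset.card_le_card (Finset.filter_subset_filter _ hSI)).trans
              (hcard i hi)
          have h4 : (S1.card : ℝ) * (2 * q) ≤ 1 / 2 := by nlinarith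
          nlinarith
      nlinarith
  have pos : ∀ S : Finset κ, S ⊆ I → 0 < μ.real (⋂ j ∈ S, (A j)ᶜ) := by
    intro S
    induction S using Finset.induction_on with
    | empty => intro _; simp
    | insert a S ha ih =>
      intro hS
      have hS' : S ⊆ I := (Finset.subset_insert _ _).trans hS
      have h1 := ih hS'
      have h2 := key S.card S le_rfl hS' a (hS (Finset.mem_insert_self _ _))
      have h3 : μ.real (⋂ j ∈ S, (A j)ᶜ) =
          μ.real (A a ∩ ⋂ j ∈ S, (A j)ᶜ) + μ.real (⋂ j ∈ insert a S, (A j)ᶜ) := by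
        rw [← measureReal_inter_add_sdiff (s := ⋂ j ∈ S, (A j)ᶜ) (hA a), Set.inter_comm]
        congr 2
        rw [Finset.set_biInter_insert, Set.sdiff_eq, Set.inter_comm]
      nlinarith
  exact pos I subset_rfl

open MeasureTheory ProbabilityTheory in
/-- Events determined by disjoint sets of coordinates of a product measure are independent. -/
theorem measureReal_pi_inter_of_disjoint {ι : Type*} [Fintype ι] (ν : Measure Bool)
    [IsProbabilityMeasure ν] (A B : Set (ι → Bool)) (U V : Finset ι) (hUV : Disjoint U V)
    (hA : ∀ ω ω' : ι → Bool, (∀ i ∈ U, ω i = ω' i) → ω ∈ A → ω' ∈ A)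
    (hB : ∀ ω ω' : ι → Bool, (∀ i ∈ V, ω i = ω' i) → ω ∈ B → ω' ∈ B) :
    (Measure.pi fun _ : ι => ν).real (A ∩ B) =
      (Measure.pi fun _ : ι => ν).real A * (Measure.pi fun _ : ι => ν).real B := by
  have hi : iIndepFun (fun (i : ι) (ω : ι → Bool) => id (ω i)) (Measure.pi fun _ : ι => ν) :=
    iIndepFun_pi (X := fun _ => id) fun _ => measurable_id.aemeasurable
  have hf := hi.indepFun_finset U V hUV fun i => by fun_prop
  have hpre : ∀ (W : Finset ι) (C : Set (ι → Bool)),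
      (∀ ω ω' : ι → Bool, (∀ i ∈ W, ω i = ω' i) → ω ∈ C → ω' ∈ C) →
      C = (fun (ω : ι → Bool) (i : W) => id (ω i)) ⁻¹'
        ((fun (ω : ι → Bool) (i : W) => id (ω i)) '' C) := by
    intro W C hC
    refine (Set.subset_preimage_image _ _).antisymm ?_
    rintro ω ⟨ω', hω', h⟩
    exact hC ω' ω (fun i hi => congrFun h ⟨i, hi⟩) hω'
  have h := hf.measure_inter_preimage_eq_mul _ _
    (DiscreteMeasurableSpace.forall_measurableSet
      ((fun (ω : ι → Bool) (i : U) => id (ω i)) '' A))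
    (DiscreteMeasurableSpace.forall_measurableSet
      ((fun (ω : ι → Bool) (i : V) => id (ω i)) '' B))
  rw [← hpre U A hA, ← hpre V B hB] at h
  simp [measureReal_def, h, ENNReal.toReal_mul]

open MeasureTheory ProbabilityTheory in
theorem exists_bernoulli_mgf_le (p : ℝ) (hp0 : 0 ≤ p) (hp1 : p ≤ 1) :
    ∃ ν : Measure Bool, IsProbabilityMeasure ν ∧
      ∀ l : ℝ, mgf (fun b : Bool => if b then (1 : ℝ) else 0) ν l ≤
        Real.exp (p * (Real.exp l - 1)) := by
  refine ⟨ENNReal.ofReal p • Measure.dirac true + ENNReal.ofReal (1 - p) • Measure.dirac false,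
    ⟨?_⟩, fun l => ?_⟩
  · simp only [Measure.coe_add, Measure.coe_smul, Pi.add_apply, Pi.smul_apply, measure_univ,
      smul_eq_mul, mul_one]
    rw [← ENNReal.ofReal_add hp0 (by linarith)]
    simp
  · rw [mgf, integral_add_measure (Integrable.of_finite.smul_measure (by simp))
      (Integrable.of_finite.smul_measure (by simp)), integral_smul_measure, integral_smul_measure]
    simp only [integral_dirac, ENNReal.toReal_ofReal hp0,
      ENNReal.toReal_ofReal (sub_nonneg.2 hp1)]
    simp only [if_true, mul_one, smul_eq_mul, Bool.false_eq_true, if_false, mul_zero,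
      Real.exp_zero]
    have := Real.add_one_le_exp (p * (Real.exp l - 1))
    linarith

open MeasureTheory ProbabilityTheory in
/-- The exponential moment of a binomial count. -/
theorem mgf_card_filter_le {ι : Type*} [Fintype ι] (ν : Measure Bool) [IsProbabilityMeasure ν]
    (p l : ℝ) (hν : mgf (fun b : Bool => if b then (1 : ℝ) else 0) ν l ≤
      Real.exp (p * (Real.exp l - 1))) (U : Finset ι) :
    mgf (fun ω : ι → Bool => ((U.filter fun i => ω i).card : ℝ)) (Measure.pi fun _ : ι => ν) l ≤
      Real.exp (U.card * (p * (Real.exp l - 1))) := by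
  set X : ι → (ι → Bool) → ℝ := fun i ω => if ω i then (1 : ℝ) else 0 with hX
  have hind : iIndepFun X (Measure.pi fun _ : ι => ν) :=
    iIndepFun_pi (X := fun _ (b : Bool) => if b then (1 : ℝ) else 0)
      fun _ => (measurable_of_countable _).aemeasurable
  have hsum : (fun ω : ι → Bool => ((U.filter fun i => ω i).card : ℝ)) = ∑ i ∈ U, X i := by
    ext ω
    simp [hX, Finset.sum_apply]
  rw [hsum, hind.mgf_sum (fun i => measurable_of_countable _)]
  have hone : ∀ i, mgf (X i) (Measure.pi fun _ : ι => ν) l ≤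
      Real.exp (p * (Real.exp l - 1)) := by
    intro i
    refine le_trans (le_of_eq ?_) hν
    conv_rhs => rw [← (measurePreserving_eval (fun _ : ι => ν) i).map_eq]
    rw [mgf_map (measurable_of_countable _).aemeasurable
      (measurable_of_countable _).aestronglyMeasurable]
    rfl
  calc ∏ i ∈ U, mgf (X i) (Measure.pi fun _ : ι => ν) l
      ≤ ∏ _i ∈ U, Real.exp (p * (Real.exp l - 1)) :=
        Finset.prod_le_prod (fun i _ => mgf_nonneg) fun i _ => hone i
    _ = Real.exp (U.card * (p * (Real.exp l - 1))) := by
        rw [Finset.prod_const, ← Real.exp_nat_mul]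

open MeasureTheory ProbabilityTheory in
/-- Random sparsification: if few of the sets `T ∩ E` meet a given one and the Chernoff bounds for
a `p`-random subset of `T` are small, then some subset of `T` meets every `E` in the prescribed
range. -/
theorem exists_subset_card_inter_mem_Icc {α : Type*} [DecidableEq α] (T : Finset α)
    (𝓔 : Finset (Finset α)) (lo hi : Finset α → ℝ) (p q : ℝ) (D : ℕ) (hp0 : 0 ≤ p) (hp1 : p ≤ 1)
    (hq : 0 ≤ q) (hq2 : 2 * q < 1) (hD : 4 * q * D ≤ 1)
    (hcard : ∀ E ∈ 𝓔, (𝓔.filter fun E' => ¬ Disjoint (T ∩ E) (T ∩ E')).card ≤ D)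
    (hhi : ∀ E ∈ 𝓔, ∃ l : ℝ, 0 ≤ l ∧
      Real.exp (-l * hi E + (T ∩ E).card * (p * (Real.exp l - 1))) ≤ q / 2)
    (hlo : ∀ E ∈ 𝓔, lo E ≤ 0 ∨ ∃ l : ℝ, l ≤ 0 ∧
      Real.exp (-l * lo E + (T ∩ E).card * (p * (Real.exp l - 1))) ≤ q / 2) :
    ∃ S ⊆ T, ∀ E ∈ 𝓔, lo E ≤ ((S ∩ E).card : ℝ) ∧ ((S ∩ E).card : ℝ) ≤ hi E := by
  obtain ⟨ν, hν, hmgf⟩ := exists_bernoulli_mgf_le p hp0 hp1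
  set μ := Measure.pi fun _ : T => ν with hμ
  let U : Finset α → Finset T := fun E => Finset.univ.filter fun i => (i : α) ∈ E
  have hUcard : ∀ E, (U E).card = (T ∩ E).card := by
    intro E
    rw [← Finset.card_map (Function.Embedding.subtype _)]
    congr 1
    ext x
    simp [U, and_comm]
  let c : Finset α → (T → Bool) → ℝ := fun E ω => (((U E).filter fun i => ω i).card : ℝ)
  let A : Finset α → Set (T → Bool) := fun E => {ω | hi E < c E ω} ∪ {ω | c E ω < lo E}
  have hdet : ∀ E, ∀ ω ω' : T → Bool, (∀ i ∈ U E, ω i = ω' i) → c E ω = c E ω' := by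
    intro E ω ω' h
    simp only [c]
    congr 2
    exact Finset.filter_congr fun i hi => by rw [h i hi]
  have hprob : ∀ E ∈ 𝓔, μ.real (A E) ≤ q := by
    intro E hE
    have h1 : μ.real {ω | hi E < c E ω} ≤ q / 2 := by
      obtain ⟨l, hl, hlq⟩ := hhi E hE
      refine le_trans ?_ hlq
      refine (measureReal_mono (μ := μ) (s₂ := {ω | hi E ≤ c E ω}) (fun ω hω => by
            simp only [Set.mem_ofPred_eq] at hω ⊢; exact hω.le)).trans
        ((measure_ge_le_exp_mul_mgf (hi E) hl Integrable.of_finite).trans ?_)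
      rw [Real.exp_add, ← hUcard]
      exact mul_le_mul_of_nonneg_left (mgf_card_filter_le ν p l (hmgf l) (U E))
        (Real.exp_pos _).le
    have h2 : μ.real {ω | c E ω < lo E} ≤ q / 2 := by
      rcases hlo E hE with h | ⟨l, hl, hlq⟩
      · have : {ω | c E ω < lo E} = ∅ := by
          ext ω
          have : (0 : ℝ) ≤ c E ω := Nat.cast_nonneg _
          simp only [Set.mem_ofPred_eq, Set.mem_empty_iff_false, iff_false, not_lt]
          linarith
        rw [this]
        simp only [measureReal_empty]
        linarith
      · refine le_trans ?_ hlq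
        refine (measureReal_mono (μ := μ) (s₂ := {ω | c E ω ≤ lo E}) (fun ω hω => by
            simp only [Set.mem_ofPred_eq] at hω ⊢; exact hω.le)).trans
          ((measure_le_le_exp_mul_mgf (lo E) hl Integrable.of_finite).trans ?_)
        rw [Real.exp_add, ← hUcard]
        exact mul_le_mul_of_nonneg_left (mgf_card_filter_le ν p l (hmgf l) (U E))
          (Real.exp_pos _).le
    exact (measureReal_union_le _ _).trans (by linarith)
  have hAdet : ∀ E, ∀ ω ω' : T → Bool, (∀ i ∈ U E, ω i = ω' i) → ω ∈ A E → ω' ∈ A E := by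
    intro E ω ω' h hω
    simp only [A, Set.mem_union, Set.mem_ofPred_eq] at hω ⊢
    rwa [← hdet E ω ω' h]
  have hpos : 0 < μ.real (⋂ E ∈ 𝓔, (A E)ᶜ) := by
    classical
    refine lovasz_local_lemma μ A (fun E => DiscreteMeasurableSpace.forall_measurableSet _) 𝓔
      (fun E E' => ¬ Disjoint (T ∩ E) (T ∩ E')) q D hq hq2 hD ?_ ?_
    · intro E hE
      convert hcard E hE
    · intro E hE S hS hn
      rw [measureReal_pi_inter_of_disjoint ν (A E) _ (U E) (S.biUnion U) ?_ (hAdet E) ?_]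
      · exact mul_le_mul_of_nonneg_right (hprob E hE) measureReal_nonneg
      · rw [Finset.disjoint_biUnion_right]
        intro E' hE'
        have := not_not.1 (hn E' hE')
        rw [Finset.disjoint_left] at this ⊢
        intro i hi hi'
        simp only [U, Finset.mem_filter, Finset.mem_univ, true_and] at hi hi'
        exact this (Finset.mem_inter.2 ⟨i.2, hi⟩) (Finset.mem_inter.2 ⟨i.2, hi'⟩)
      · intro ω ω' h hω
        refine Set.mem_iInter₂.2 fun E' hE' hbad => ?_
        refine Set.mem_iInter₂.1 hω E' hE' (hAdet E' ω' ω (fun i hi => ?_) hbad)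
        exact (h i (Finset.mem_biUnion.2 ⟨E', hE', hi⟩)).symm
  obtain ⟨ω, hω⟩ : (⋂ E ∈ 𝓔, (A E)ᶜ).Nonempty := by
    by_contra h
    rw [Set.not_nonempty_iff_eq_empty] at h
    simp [h] at hpos
  refine ⟨(Finset.univ.filter fun i : T => ω i = true).map (Function.Embedding.subtype _), ?_, ?_⟩
  · intro x hx
    obtain ⟨i, -, rfl⟩ := Finset.mem_map.1 hx
    exact i.2
  · intro E hE
    have hc : c E ω = (((Finset.univ.filter fun i : T => ω i = true).map
        (Function.Embedding.subtype _) ∩ E).card : ℝ) := by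
      simp only [c]
      rw [← Finset.card_map (Function.Embedding.subtype _)]
      congr 2
      ext x
      simp only [U, Finset.mem_map, Finset.mem_filter, Finset.mem_univ, true_and,
        Function.Embedding.subtype_apply, Subtype.exists, Finset.mem_inter]
      grind
    have := Set.mem_iInter₂.1 hω E hE
    simp only [A, Set.mem_compl_iff, Set.mem_union, Set.mem_ofPred_eq, not_or, not_lt] at this
    rw [← hc]
    exact ⟨this.2, this.1⟩

theorem exp_sub_one_le_add_sq {l : ℝ} (hl : |l| ≤ 1) : Real.exp l - 1 ≤ l + l ^ 2 := by
  have := (abs_le.1 (Real.abs_exp_sub_one_sub_id_le hl)).2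
  linarith

theorem upper_tail_exponent_le {z ρ m : ℝ} (hz : 2 ≤ z) (hρ : 0 ≤ ρ)
    (hm0 : 0 ≤ m) (hm : m ≤ (z ^ 8 + z ^ 6) * ρ + 1 / z ^ 4) :
    -(1 / (8 * z)) * ((z ^ 8 + z ^ 7) * ρ + z ^ 2) + m * (Real.exp (1 / (8 * z)) - 1) ≤
      -(z / 16) := by
  have hz0 : 0 < z := by linarith
  set l := 1 / (8 * z) with hl
  have hlz : l * z = 1 / 8 := by rw [hl]; field_simp
  have hl0 : 0 < l := by positivity
  have hl1 : l ≤ 1 := by nlinarith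
  have h1 : Real.exp l - 1 ≤ l + l ^ 2 := exp_sub_one_le_add_sq (by rwa [abs_of_pos hl0])
  have h2 : m * (Real.exp l - 1) ≤ m * (l + l ^ 2) := mul_le_mul_of_nonneg_left h1 hm0
  have h3 : m * (1 + l) ≤ ((z ^ 8 + z ^ 6) * ρ + 1 / z ^ 4) * (1 + l) :=
    mul_le_mul_of_nonneg_right hm (by linarith)
  have h4 : (z ^ 8 + z ^ 6) * (1 + l) ≤ z ^ 8 + z ^ 7 := by
    have e1 : z ^ 8 * l = z ^ 7 / 8 := by
      calc z ^ 8 * l = z ^ 7 * (l * z) := by ring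
        _ = _ := by rw [hlz]; ring
    have e2 : z ^ 6 * l ≤ z ^ 6 / 8 := by
      have : l ≤ 1 / 8 := by nlinarith
      nlinarith [pow_pos hz0 6]
    have e3 : 2 * z ^ 6 ≤ z ^ 7 := by nlinarith [pow_pos hz0 6]
    nlinarith [pow_pos hz0 6]
  have h5 : 1 / z ^ 4 * (1 + l) ≤ z ^ 2 / 2 := by
    have e1 : 1 / z ^ 4 ≤ 1 := by
      rw [div_le_one (by positivity)]
      exact one_le_pow₀ (by linarith)
    have e2 : 1 / z ^ 4 * (1 + l) ≤ 1 * 2 :=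
      mul_le_mul e1 (by linarith) (by linarith) (by norm_num)
    nlinarith
  have h6 : m * (1 + l) ≤ (z ^ 8 + z ^ 7) * ρ + z ^ 2 / 2 := by
    nlinarith [mul_le_mul_of_nonneg_right h4 hρ]
  have h7 : l * z ^ 2 = z / 8 := by
    calc l * z ^ 2 = (l * z) * z := by ring
      _ = _ := by rw [hlz]; ring
  nlinarith [mul_le_mul_of_nonneg_left h6 hl0.le]

theorem lower_tail_exponent_le {z m : ℝ} (hz : 2 ≤ z) (hm : z ^ 8 - z ^ 6 ≤ m) :
    -(-(1 / (8 * z))) * (z ^ 8 - z ^ 7) + m * (Real.exp (-(1 / (8 * z))) - 1) ≤ -(z / 16) := by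
  have hz0 : 0 < z := by linarith
  set l := 1 / (8 * z) with hl
  have hlz : l * z = 1 / 8 := by rw [hl]; field_simp
  have hl0 : 0 < l := by positivity
  have hl1 : l ≤ 1 := by nlinarith
  have h1 : Real.exp (-l) - 1 ≤ -l + (-l) ^ 2 :=
    exp_sub_one_le_add_sq (by rwa [abs_neg, abs_of_pos hl0])
  have p5 := pow_pos hz0 5
  have p6 := pow_pos hz0 6
  have hm0 : 0 ≤ m := by
    have : z ^ 6 ≤ z ^ 8 := pow_le_pow_right₀ (by linarith) (by norm_num)
    linarith
  have h2 : m * (Real.exp (-l) - 1) ≤ m * (-l + (-l) ^ 2) := mul_le_mul_of_nonneg_left h1 hm0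
  have h3 : (z ^ 8 - z ^ 6) * (1 - l) ≤ m * (1 - l) :=
    mul_le_mul_of_nonneg_right hm (by linarith)
  have e1 : z ^ 8 * l = z ^ 7 / 8 := by
    calc z ^ 8 * l = z ^ 7 * (l * z) := by ring
      _ = _ := by rw [hlz]; ring
  have e3 : 2 * z ^ 6 ≤ z ^ 7 := by nlinarith
  have e4 : z ^ 2 ≤ z ^ 6 := pow_le_pow_right₀ (by linarith) (by norm_num)
  have e5 : 0 ≤ z ^ 6 * l := by positivity
  have h6 : (z ^ 8 - z ^ 7) - m * (1 - l) ≤ -(z ^ 2 / 2) := by nlinarith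
  have h7 : l * z ^ 2 = z / 8 := by
    calc l * z ^ 2 = (l * z) * z := by ring
      _ = _ := by rw [hlz]; ring
  nlinarith [mul_le_mul_of_nonneg_left h6 hl0.le]

theorem exp_small_tail_le {z m : ℝ} (s : ℕ) (hz : 1 ≤ z) (hm0 : 0 ≤ m) (hm : m ≤ 3 / z ^ 4) :
    Real.exp (-(Real.log (z ^ 4)) * s + m * (Real.exp (Real.log (z ^ 4)) - 1)) ≤
      Real.exp 3 / z ^ (4 * s) := by
  have hz0 : 0 < z := by linarith
  have h4 : 0 < z ^ 4 := by positivity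
  rw [Real.exp_log h4]
  have h1 : m * (z ^ 4 - 1) ≤ 3 := by
    calc m * (z ^ 4 - 1) ≤ m * z ^ 4 := by nlinarith
      _ ≤ 3 / z ^ 4 * z ^ 4 := mul_le_mul_of_nonneg_right hm h4.le
      _ = 3 := by field_simp
  have h2 : Real.exp (-(Real.log (z ^ 4)) * s) = 1 / z ^ (4 * s) := by
    rw [neg_mul, Real.exp_neg, mul_comm, Real.exp_nat_mul, Real.exp_log h4, pow_mul, one_div]
  rw [Real.exp_add, h2]
  calc 1 / z ^ (4 * s) * Real.exp (m * (z ^ 4 - 1)) ≤ 1 / z ^ (4 * s) * Real.exp 3 := by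
        gcongr
    _ = _ := by ring

/-- The set `T` has density about `w / N` on every large member `E` of `𝓔`, where `w = z ^ 8`, with
relative error `1 / z`; it has almost exactly this density on the members of `𝓐` and meets the very
small members of `𝓔` in at most `s` points. -/
structure IsBalanced {α : Type*} [DecidableEq α] (𝓔 𝓐 : Finset (Finset α)) (N s : ℕ) (z : ℝ)
    (T : Finset α) : Prop where
  upper : ∀ E ∈ 𝓔, ((T ∩ E).card : ℝ) ≤ (z ^ 8 + z ^ 7) * (E.card / N) + z ^ 2
  lower : ∀ E ∈ 𝓐, z ^ 8 - z ^ 7 ≤ ((T ∩ E).card : ℝ)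
  small : ∀ E ∈ 𝓔, (E.card : ℝ) * z ^ 16 ≤ N → (T ∩ E).card ≤ s

theorem IsBalanced.exists_subset_of_le {α : Type*} [DecidableEq α] (𝓔 𝓐 : Finset (Finset α))
    (N A B : ℕ) (hN : 0 < N) (h𝓐 : 𝓐 ⊆ 𝓔) (h𝓐N : ∀ E ∈ 𝓐, E.card = N)
    (h𝓔N : ∀ E ∈ 𝓔, E.card ≤ N)
    (hdeg : ∀ (Q : ℕ) (x : α),
      (𝓔.filter fun E => x ∈ E ∧ N ≤ Q * E.card).card ≤ (A * Q) ^ B)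
    (z : ℝ) (hz4 : 4 ≤ z) (hzA : 12 * (2 * A : ℝ) ^ B ≤ z) (hzs : ((8 * B + 5 : ℕ) : ℝ) ≤ z)
    (hzexp : Real.exp (-(z / 16)) ≤ 1 / z ^ (17 + 32 * B) / 2)
    (M : ℝ) (hM1 : z ^ 8 ≤ M) (hM2 : M ≤ z ^ 16) (T : Finset α)
    (hU : ∀ E ∈ 𝓔, ((T ∩ E).card : ℝ) ≤
      M / z ^ 8 * ((z ^ 8 + z ^ 6) * (E.card / N) + 1 / z ^ 4))
    (hL : ∀ E ∈ 𝓐, M / z ^ 8 * (z ^ 8 - z ^ 6) ≤ ((T ∩ E).card : ℝ))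
    (hS : ∀ E ∈ 𝓔, (E.card : ℝ) * M ^ 2 ≤ N → (T ∩ E).card ≤ 8 * B + 5) :
    ∃ T' ⊆ T, IsBalanced 𝓔 𝓐 N (8 * B + 5) z T' := by
  set s := 8 * B + 5 with hs
  have hz0 : 0 < z := by linarith
  have hz1 : 1 ≤ z := by linarith
  have hN' : (0 : ℝ) < N := by exact_mod_cast hN
  have hz8 : 0 < z ^ 8 := by positivity
  have hz8' : 1 ≤ z ^ 8 := one_le_pow₀ hz1
  have hM0 : 0 < M := by linarith
  have hMone : 1 ≤ M := by linarith
  have hρ0 : ∀ E : Finset α, (0 : ℝ) ≤ E.card / N := fun E => by positivity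
  have hρ1 : ∀ E ∈ 𝓔, (E.card / N : ℝ) ≤ 1 := fun E hE => by
    rw [div_le_one hN']; exact_mod_cast h𝓔N E hE
  have hp4 : 1 / z ^ 4 ≤ 1 := by
    rw [div_le_one (by positivity)]; exact one_le_pow₀ hz1
  have h68 : z ^ 6 ≤ z ^ 8 := pow_le_pow_right₀ hz1 (by norm_num)
  set q : ℝ := 1 / z ^ (17 + 32 * B) with hq
  have hq0 : 0 < q := by positivity
  set D : ℕ := ⌊3 * z ^ 16 * (2 * A * z ^ 32) ^ B⌋₊ with hD
  have hDle : (D : ℝ) ≤ 3 * z ^ 16 * (2 * A * z ^ 32) ^ B := Nat.floor_le (by positivity)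
  have h4qD : 4 * q * D ≤ 1 := by
    have e1 : 4 * q * D ≤ 4 * q * (3 * z ^ 16 * (2 * A * z ^ 32) ^ B) :=
      mul_le_mul_of_nonneg_left hDle (by positivity)
    have e2 : 4 * q * (3 * z ^ 16 * (2 * A * z ^ 32) ^ B) = 12 * (2 * A) ^ B / z := by
      rw [hq, mul_pow, ← pow_mul]
      field_simp
      ring
    rw [e2] at e1
    exact e1.trans ((div_le_one hz0).2 hzA)
  have h2q : 2 * q < 1 := by
    have : z ≤ z ^ (17 + 32 * B) := le_self_pow₀ hz1 (by omega)
    rw [hq, mul_one_div, div_lt_one (by positivity)]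
    linarith
  have hmean : ∀ E : Finset α, ∀ x : ℝ, ((T ∩ E).card : ℝ) * (z ^ 8 / M * x) =
      (((T ∩ E).card : ℝ) * (z ^ 8 / M)) * x := fun E x => by ring
  have hmU : ∀ E ∈ 𝓔, ((T ∩ E).card : ℝ) * (z ^ 8 / M) ≤
      (z ^ 8 + z ^ 6) * (E.card / N) + 1 / z ^ 4 := by
    intro E hE
    calc ((T ∩ E).card : ℝ) * (z ^ 8 / M)
        ≤ M / z ^ 8 * ((z ^ 8 + z ^ 6) * (E.card / N) + 1 / z ^ 4) * (z ^ 8 / M) :=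
          mul_le_mul_of_nonneg_right (hU E hE) (by positivity)
      _ = _ := by field_simp
  have hmL : ∀ E ∈ 𝓐, z ^ 8 - z ^ 6 ≤ ((T ∩ E).card : ℝ) * (z ^ 8 / M) := by
    intro E hE
    calc z ^ 8 - z ^ 6 = M / z ^ 8 * (z ^ 8 - z ^ 6) * (z ^ 8 / M) := by field_simp
      _ ≤ _ := mul_le_mul_of_nonneg_right (hL E hE) (by positivity)
  have hm0 : ∀ E : Finset α, 0 ≤ ((T ∩ E).card : ℝ) * (z ^ 8 / M) := fun E => by positivity
  have hcardT : ∀ E ∈ 𝓔, ((T ∩ E).card : ℝ) ≤ 3 * z ^ 16 := by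
    intro E hE
    have e1 : (z ^ 8 + z ^ 6) * (E.card / N : ℝ) + 1 / z ^ 4 ≤ 3 * z ^ 8 := by
      nlinarith [hρ0 E, hρ1 E hE]
    calc ((T ∩ E).card : ℝ) ≤ M / z ^ 8 * (3 * z ^ 8) :=
          (hU E hE).trans (mul_le_mul_of_nonneg_left e1 (by positivity))
      _ = 3 * M := by field_simp
      _ ≤ _ := by linarith
  set Q : ℕ := ⌈M ^ 2⌉₊ with hQ
  have hQ1 : M ^ 2 ≤ Q := Nat.le_ceil _
  have hQ2 : (Q : ℝ) ≤ 2 * z ^ 32 := by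
    have e1 : (Q : ℝ) < M ^ 2 + 1 := Nat.ceil_lt_add_one (by positivity)
    have e2 : M ^ 2 ≤ (z ^ 16) ^ 2 := by gcongr
    have e3 : (1 : ℝ) ≤ z ^ 32 := one_le_pow₀ hz1
    have e4 : (z ^ 16) ^ 2 = z ^ 32 := by ring
    linarith
  let 𝓔' := 𝓔.filter fun E => (N : ℝ) < E.card * M ^ 2
  let hi : Finset α → ℝ := fun E =>
    if (E.card : ℝ) * z ^ 16 ≤ N then (s : ℝ) else (z ^ 8 + z ^ 7) * (E.card / N) + z ^ 2
  let lo : Finset α → ℝ := fun E => if E ∈ 𝓐 then z ^ 8 - z ^ 7 else 0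
  obtain ⟨T', hT', hT'E⟩ := exists_subset_card_inter_mem_Icc T 𝓔' lo hi (z ^ 8 / M) q D
    (by positivity) ((div_le_one hM0).2 hM1) hq0.le h2q h4qD
    (by
      intro E hE
      have hE' := (Finset.mem_filter.1 hE).1
      have hsub : (𝓔'.filter fun E' => ¬ Disjoint (T ∩ E) (T ∩ E')) ⊆
          (T ∩ E).biUnion fun x => 𝓔.filter fun E' => x ∈ E' ∧ N ≤ Q * E'.card := by
        intro E' hE'
        obtain ⟨h1, h2⟩ := Finset.mem_filter.1 hE'
        obtain ⟨h3, h4⟩ := Finset.mem_filter.1 h1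
        obtain ⟨x, hx, hx'⟩ := Finset.not_disjoint_iff.1 h2
        refine Finset.mem_biUnion.2 ⟨x, hx, Finset.mem_filter.2
          ⟨h3, (Finset.mem_inter.1 hx').2, ?_⟩⟩
        have : (N : ℝ) ≤ Q * E'.card := by
          nlinarith [(Nat.cast_nonneg E'.card : (0 : ℝ) ≤ E'.card)]
        exact_mod_cast this
      have h1 : (𝓔'.filter fun E' => ¬ Disjoint (T ∩ E) (T ∩ E')).card ≤
          (T ∩ E).card * (A * Q) ^ B :=
        (Finset.card_le_card hsub).trans (Finset.card_biUnion_le_card_mul _ _ _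
          fun x _ => hdeg Q x)
      refine h1.trans (Nat.le_floor ?_)
      push_cast
      have h2 : (A * Q : ℝ) ≤ 2 * A * z ^ 32 := by
        nlinarith [(Nat.cast_nonneg A : (0 : ℝ) ≤ A)]
      exact mul_le_mul (hcardT E hE') (pow_le_pow_left₀ (by positivity) h2 B) (by positivity)
        (by positivity))
    (by
      intro E hE
      have hE' := (Finset.mem_filter.1 hE).1
      simp only [hmean, hi]
      split_ifs with hsm
      · refine ⟨Real.log (z ^ 4), Real.log_nonneg (one_le_pow₀ hz1), ?_⟩
        refine (exp_small_tail_le s hz1 (hm0 E) ((hmU E hE').trans ?_)).trans ?_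
        · have e1 : (E.card / N : ℝ) ≤ 1 / z ^ 16 := by
            rw [div_le_div_iff₀ hN' (by positivity)]
            linarith
          have e2 : (z ^ 8 + z ^ 6) * (E.card / N : ℝ) ≤ 2 * z ^ 8 * (1 / z ^ 16) :=
            mul_le_mul (by linarith) e1 (hρ0 E) (by positivity)
          have e3 : 2 * z ^ 8 * (1 / z ^ 16) ≤ 2 / z ^ 4 := by
            rw [mul_one_div, div_le_div_iff₀ (by positivity) (by positivity)]
            have : z ^ 12 ≤ z ^ 16 := pow_le_pow_right₀ hz1 (by norm_num)
            nlinarith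
          have e4 : 3 / z ^ 4 = 2 / z ^ 4 + 1 / z ^ 4 := by ring
          linarith
        · have e0 : Real.exp 3 * 2 ≤ z ^ 3 := by
            have h3 : Real.exp 3 = Real.exp 1 ^ 3 := by rw [← Real.exp_nat_mul]; norm_num
            have h4 : Real.exp 1 ^ 3 ≤ 3 ^ 3 := by
              gcongr; exact (Real.exp_one_lt_d9.trans (by norm_num)).le
            have h5 : (4 : ℝ) ^ 3 ≤ z ^ 3 := by gcongr
            rw [h3]; linarith
          have e1 : 4 * s = 17 + 32 * B + 3 := by omega
          rw [e1, pow_add, hq, div_div, div_le_div_iff₀ (by positivity) (by positivity)]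
          nlinarith [pow_pos hz0 (17 + 32 * B)]
      · refine ⟨1 / (8 * z), by positivity, le_trans (Real.exp_le_exp.2 ?_) hzexp⟩
        exact upper_tail_exponent_le (by linarith) (hρ0 E) (hm0 E) (hmU E hE'))
    (by
      intro E hE
      simp only [hmean, lo]
      split_ifs with hA
      · refine Or.inr ⟨-(1 / (8 * z)), by rw [neg_nonpos]; positivity,
          le_trans (Real.exp_le_exp.2 ?_) hzexp⟩
        exact lower_tail_exponent_le (by linarith) (hmL E hA)
      · exact Or.inl le_rfl)
  have hsz : (s : ℝ) ≤ z ^ 2 := by nlinarith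
  have hcaseS : ∀ E ∈ 𝓔, E ∉ 𝓔' → (T' ∩ E).card ≤ s := by
    intro E hE hE'
    have : (E.card : ℝ) * M ^ 2 ≤ N := by
      by_contra h
      exact hE' (Finset.mem_filter.2 ⟨hE, not_le.1 h⟩)
    exact (Finset.card_le_card (Finset.inter_subset_inter_right hT')).trans (hS E hE this)
  have hbase : ∀ E : Finset α, (0 : ℝ) ≤ (z ^ 8 + z ^ 7) * (E.card / N) := fun E => by positivity
  refine ⟨T', hT', ⟨?_, ?_, ?_⟩⟩
  · intro E hE
    by_cases hE' : E ∈ 𝓔'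
    · have h := (hT'E E hE').2
      simp only [hi] at h
      split_ifs at h
      · linarith [hbase E]
      · exact h
    · have h : ((T' ∩ E).card : ℝ) ≤ s := by exact_mod_cast hcaseS E hE hE'
      linarith [hbase E]
  · intro E hE
    by_cases hE' : E ∈ 𝓔'
    · have h := (hT'E E hE').1
      simpa only [lo, hE, if_true] using h
    · exfalso
      refine hE' (Finset.mem_filter.2 ⟨h𝓐 hE, ?_⟩)
      rw [h𝓐N E hE]
      have : 1 < M ^ 2 := by
        have : z ≤ z ^ 8 := le_self_pow₀ hz1 (by norm_num)
        nlinarith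
      nlinarith
  · intro E hE hsm
    by_cases hE' : E ∈ 𝓔'
    · have h := (hT'E E hE').2
      simp only [hi, hsm, if_true] at h
      exact_mod_cast h
    · exact hcaseS E hE hE'

theorem exists_isBalanced (A B : ℕ) : ∃ Z : ℝ, ∀ (α : Type) [DecidableEq α]
    (𝓔 𝓐 : Finset (Finset α)) (X : Finset α) (N : ℕ), 0 < N → 𝓐 ⊆ 𝓔 →
    (∀ E ∈ 𝓐, E.card = N) → (∀ E ∈ 𝓔, E.card ≤ N) → (∀ E ∈ 𝓔, E ⊆ X) →
    (∀ (Q : ℕ) (x : α), (𝓔.filter fun E => x ∈ E ∧ N ≤ Q * E.card).card ≤ (A * Q) ^ B) →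
    ∀ z : ℝ, Z ≤ z → z ^ 8 ≤ N → ∃ T ⊆ X, IsBalanced 𝓔 𝓐 N (8 * B + 5) z T := by
  have hlim : ∀ᶠ z : ℝ in Filter.atTop,
      Real.exp (-(z / 16)) ≤ 1 / z ^ (17 + 32 * B) / 2 := by
    have h1 : Filter.Tendsto (fun z : ℝ => (z / 16) ^ (17 + 32 * B) * Real.exp (-(z / 16)))
        Filter.atTop (nhds 0) :=
      (Real.tendsto_pow_mul_exp_neg_atTop_nhds_zero (17 + 32 * B)).comp
        (Filter.tendsto_id.atTop_div_const (by norm_num))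
    have h2 : (0 : ℝ) < 1 / (2 * 16 ^ (17 + 32 * B)) := by positivity
    filter_upwards [h1.eventually_le_const h2, Filter.eventually_gt_atTop 0] with z hz hz0
    rw [div_pow] at hz
    rw [div_div, le_div_iff₀ (by positivity)]
    rw [div_mul_eq_mul_div, div_le_div_iff₀ (by positivity) (by positivity)] at hz
    have h16 : (0 : ℝ) < 16 ^ (17 + 32 * B) := by positivity
    nlinarith
  obtain ⟨Z', hZ'⟩ := Filter.eventually_atTop.1 hlim
  refine ⟨max (max 4 (12 * (2 * A : ℝ) ^ B)) (max ((8 * B + 5 : ℕ) : ℝ) Z'), ?_⟩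
  intro α _ 𝓔 𝓐 X N hN h𝓐 h𝓐N h𝓔N h𝓔X hdeg
  have hN' : (0 : ℝ) < N := by exact_mod_cast hN
  have hN1 : (1 : ℝ) ≤ N := by exact_mod_cast hN
  have key : ∀ (j : ℕ) (z : ℝ),
      max (max 4 (12 * (2 * A : ℝ) ^ B)) (max ((8 * B + 5 : ℕ) : ℝ) Z') ≤ z → z ^ 8 ≤ N →
      (N : ℝ) ≤ (z ^ 16) ^ 2 ^ j → ∃ T ⊆ X, IsBalanced 𝓔 𝓐 N (8 * B + 5) z T := by
    intro j
    induction j with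
    | zero =>
      intro z hz hzN hNz
      simp only [max_le_iff] at hz
      obtain ⟨⟨hz4, hzA⟩, hzs, hz'⟩ := hz
      have hz0 : 0 < z := by linarith
      have hXE : ∀ E ∈ 𝓔, X ∩ E = E := fun E hE => Finset.inter_eq_right.2 (h𝓔X E hE)
      refine IsBalanced.exists_subset_of_le 𝓔 𝓐 N A B hN h𝓐 h𝓐N h𝓔N hdeg z hz4 hzA hzs
        (hZ' z hz') N hzN (by simpa using hNz) X ?_ ?_ ?_
      · intro E hE
        rw [hXE E hE]
        have e1 : (N : ℝ) / z ^ 8 * ((z ^ 8 + z ^ 6) * (E.card / N) + 1 / z ^ 4) =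
            E.card + (E.card / z ^ 2 + N / z ^ 12) := by
          field_simp
          ring
        rw [e1]
        have : (0 : ℝ) ≤ E.card / z ^ 2 + N / z ^ 12 := by positivity
        linarith
      · intro E hE
        rw [hXE E (h𝓐 hE), h𝓐N E hE]
        have e1 : (N : ℝ) / z ^ 8 * (z ^ 8 - z ^ 6) = N - N / z ^ 2 := by
          field_simp
        rw [e1]
        have : (0 : ℝ) ≤ N / z ^ 2 := by positivity
        linarith
      · intro E hE hsm
        rw [hXE E hE]
        have h1 : (E.card : ℝ) ≤ 1 := by
          have e1 : (E.card : ℝ) * N ≤ 1 := by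
            have : (E.card : ℝ) * N * N ≤ 1 * N := by linarith [hsm, sq (N : ℝ)]
            exact le_of_mul_le_mul_right this hN'
          nlinarith [(Nat.cast_nonneg E.card : (0 : ℝ) ≤ E.card)]
        have h2 : E.card ≤ 1 := by exact_mod_cast h1
        omega
    | succ j ih =>
      intro z hz hzN hNz
      have hzz := hz
      simp only [max_le_iff] at hz
      obtain ⟨⟨hz4, hzA⟩, hzs, hz'⟩ := hz
      have hz0 : 0 < z := by linarith
      by_cases hsmall : (N : ℝ) ≤ (z ^ 16) ^ 2 ^ 0
      · have hmono : ∀ i : ℕ, (N : ℝ) ≤ (z ^ 16) ^ 2 ^ 0 → (N : ℝ) ≤ (z ^ 16) ^ 2 ^ i :=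
          fun i h => h.trans (pow_le_pow_right₀ (one_le_pow₀ (by linarith))
            (Nat.pow_le_pow_right (by norm_num) (Nat.zero_le i)))
        exact ih z hzz hzN (hmono j hsmall)
      · simp only [pow_zero, pow_one, not_le] at hsmall
        have hsq : z ≤ z ^ 2 := by nlinarith
        have e16 : (z ^ 2) ^ 8 = z ^ 16 := by ring
        obtain ⟨T, hTX, hT⟩ := ih (z ^ 2) (hzz.trans hsq) (by rw [e16]; exact hsmall.le)
          (hNz.trans (le_of_eq (by
            rw [pow_succ' 2 j, pow_mul]
            ring)))
        obtain ⟨T', hT', hb⟩ := IsBalanced.exists_subset_of_le 𝓔 𝓐 N A B hN h𝓐 h𝓐N h𝓔N hdeg z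
          hz4 hzA hzs (hZ' z hz') (z ^ 16)
          (pow_le_pow_right₀ (by linarith) (by norm_num)) le_rfl T
          (fun E hE => (hT.upper E hE).trans (le_of_eq (by field_simp)))
          (fun E hE => le_trans (le_of_eq (by field_simp)) (hT.lower E hE))
          (fun E hE h => hT.small E hE (le_trans (le_of_eq (by ring)) h))
        exact ⟨T', hT'.trans hTX, hb⟩
  intro z hz hzN
  have hz4 : 4 ≤ z := le_trans ((le_max_left _ _).trans (le_max_left _ _)) hz
  refine key N z hz hzN ?_
  have e1 : N ≤ 2 ^ 2 ^ N := Nat.lt_two_pow_self.le.trans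
    (Nat.pow_le_pow_right (by norm_num) Nat.lt_two_pow_self.le)
  have e2 : (N : ℝ) ≤ 2 ^ 2 ^ N := by exact_mod_cast e1
  have e3 : z ≤ z ^ 16 := le_self_pow₀ (by linarith) (by norm_num)
  exact e2.trans (pow_le_pow_left₀ (by norm_num) (by linarith) _)

/-- In a hypergraph in which every vertex lies in polynomially many edges of relative size at least
`1 / Q`, for `k` large there is a vertex set meeting every edge in at most `k` vertices and every
edge of full size in almost `k` vertices. -/
theorem exists_card_inter_le (A B : ℕ) (ε : ℝ) (hε : 0 < ε) (hε1 : ε < 1) :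
    ∃ K : ℕ, ∀ (α : Type) [DecidableEq α]
    (𝓔 𝓐 : Finset (Finset α)) (X : Finset α) (N : ℕ), 0 < N → 𝓐 ⊆ 𝓔 →
    (∀ E ∈ 𝓐, E.card = N) → (∀ E ∈ 𝓔, E.card ≤ N) → (∀ E ∈ 𝓔, E ⊆ X) →
    (∀ (Q : ℕ) (x : α), (𝓔.filter fun E => x ∈ E ∧ N ≤ Q * E.card).card ≤ (A * Q) ^ B) →
    ∀ k : ℕ, K ≤ k → k ≤ N → ∃ T ⊆ X, (∀ E ∈ 𝓔, (T ∩ E).card ≤ k) ∧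
      ∀ E ∈ 𝓐, (1 - ε) * k ≤ ((T ∩ E).card : ℝ) := by
  obtain ⟨Z, hZ⟩ := exists_isBalanced A B
  set W : ℝ := max (max Z 1) (4 / ε) with hW
  have hW1 : 1 ≤ W := (le_max_right _ _).trans (le_max_left _ _)
  refine ⟨⌈2 * W ^ 8⌉₊, ?_⟩
  intro α _ 𝓔 𝓐 X N hN h𝓐 h𝓐N h𝓔N h𝓔X hdeg k hKk hkN
  have hN' : (0 : ℝ) < N := by exact_mod_cast hN
  have hk : 2 * W ^ 8 ≤ k := (Nat.le_ceil _).trans (by exact_mod_cast hKk)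
  have hkN' : (k : ℝ) ≤ N := by exact_mod_cast hkN
  have hW8 : 0 < W ^ 8 := by positivity
  have hk0 : (0 : ℝ) ≤ k := Nat.cast_nonneg k
  set m : ℝ := (1 - ε / 2) * k with hm
  have hmW : W ^ 8 ≤ m := by nlinarith
  have hm0 : 0 ≤ m := by linarith
  set z : ℝ := m ^ ((1 : ℝ) / 8) with hz
  have hz8 : z ^ 8 = m := by
    rw [hz, ← Real.rpow_natCast, ← Real.rpow_mul hm0]
    norm_num
  have hz0 : 0 ≤ z := by positivity
  have hWz : W ≤ z := by
    rw [← hz8] at hmW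
    exact le_of_pow_le_pow_left₀ (by norm_num) hz0 hmW
  have hz1 : 1 ≤ z := hW1.trans hWz
  have hzε : 4 ≤ ε * z := by
    have : 4 / ε ≤ z := (le_max_right _ _).trans hWz
    rwa [div_le_iff₀' hε] at this
  obtain ⟨T, hTX, hT⟩ := hZ α 𝓔 𝓐 X N hN h𝓐 h𝓐N h𝓔N h𝓔X hdeg z
    (((le_max_left _ _).trans (le_max_left _ _)).trans hWz) (by rw [hz8]; nlinarith)
  have h7 : 4 * z ^ 7 ≤ ε * z ^ 8 := by nlinarith [pow_nonneg hz0 7]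
  have h27 : z ^ 2 ≤ z ^ 7 := pow_le_pow_right₀ hz1 (by norm_num)
  refine ⟨T, hTX, fun E hE => ?_, fun E hE => ?_⟩
  · have h1 := hT.upper E hE
    have hρ : (E.card / N : ℝ) ≤ 1 := by
      rw [div_le_one hN']; exact_mod_cast h𝓔N E hE
    have h2 : (z ^ 8 + z ^ 7) * (E.card / N : ℝ) ≤ z ^ 8 + z ^ 7 :=
      mul_le_of_le_one_right (by positivity) hρ
    have h3 : ((T ∩ E).card : ℝ) ≤ k := by
      have : z ^ 8 + z ^ 7 + z ^ 2 ≤ (1 + ε / 2) * m := by rw [← hz8]; nlinarith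
      have : (1 + ε / 2) * m ≤ k := by rw [hm]; nlinarith [mul_nonneg (sq_nonneg ε) hk0]
      linarith
    exact_mod_cast h3
  · have h1 := hT.lower E hE
    have h2 : (1 - ε / 4) * m ≤ z ^ 8 - z ^ 7 := by rw [← hz8]; linarith
    have h3 : (1 - ε) * k ≤ (1 - ε / 4) * m := by
      rw [hm]; nlinarith [mul_nonneg (sq_nonneg ε) hk0, mul_nonneg hε.le hk0]
    linarith

/-- Any finite spanning family of a real vector space contains a basis in which every member
of the family has coefficients bounded by one in absolute value. -/
theorem exists_abs_coeff_le_one {ι M : Type*} [Finite ι] [AddCommGroup M] [Module ℝ M]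
    [FiniteDimensional ℝ M] (φ : ι → M) (hφ : Submodule.span ℝ (range φ) = ⊤) :
    ∃ J : Fin (Module.finrank ℝ M) → ι, ∀ i, ∃ c : Fin (Module.finrank ℝ M) → ℝ,
      (∀ j, |c j| ≤ 1) ∧ φ i = ∑ j, c j • φ (J j) := by
  classical
  have hfin : Module.finrank ℝ (Submodule.span ℝ (range φ)) = Module.finrank ℝ M := by
    rw [hφ, finrank_top]
  have hex := Submodule.exists_fun_fin_finrank_span_eq ℝ (range φ)
  rw [hfin, hφ] at hex
  obtain ⟨f, hf, hfs, hfli⟩ := hex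
  choose J₀ hJ₀ using hf
  obtain rfl : φ ∘ J₀ = f := funext hJ₀
  let e : Module.Basis (Fin (Module.finrank ℝ M)) ℝ M := Module.finBasis ℝ M
  have : Nonempty (Fin (Module.finrank ℝ M) → ι) := ⟨J₀⟩
  obtain ⟨J, hJ⟩ := Finite.exists_max fun J : Fin (Module.finrank ℝ M) → ι => |e.det (φ ∘ J)|
  have hJ₀pos : 0 < |e.det (φ ∘ J₀)| :=
    abs_pos.2 ((Module.Basis.is_basis_iff_det e).1 ⟨hfli, hfs⟩).ne_zero
  have hJpos : 0 < |e.det (φ ∘ J)| := hJ₀pos.trans_le (hJ J₀)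
  obtain ⟨hli, hsp⟩ := (Module.Basis.is_basis_iff_det e).2 (abs_pos.1 hJpos).isUnit
  refine ⟨J, fun i => ⟨(Module.Basis.mk hli hsp.ge).repr (φ i), fun j => ?_, ?_⟩⟩
  · have h := congrArg (fun g => g (φ i))
      (Module.Basis.det_smul_mk_coord_eq_det_update e hli hsp.ge j)
    simp only [LinearMap.smul_apply, smul_eq_mul, MultilinearMap.toLinearMap_apply,
      Module.Basis.coord_apply] at h
    have hup : Function.update (φ ∘ J) j (φ i) = φ ∘ Function.update J j i := by
      rw [Function.comp_update]
    have h' := congrArg abs h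
    rw [abs_mul, hup] at h'
    have hle := hJ (Function.update J j i)
    change |e.det (φ ∘ Function.update J j i)| ≤ _ at hle
    refine le_of_mul_le_mul_left ?_ hJpos
    rw [mul_one]
    exact h'.trans_le hle
  · conv_lhs => rw [← (Module.Basis.mk hli hsp.ge).sum_repr (φ i)]
    simp

/-- A subspace of `ℝ^d` has `finrank`-many coordinates which control all the others. -/
theorem exists_coord_bound {d : ℕ} (W : Submodule ℝ (Fin d → ℝ)) :
    ∃ J : Fin (Module.finrank ℝ W) → Fin d, ∀ v ∈ W, ∀ i, |v i| ≤ ∑ j, |v (J j)| := by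
  let φ : Fin d → Module.Dual ℝ W := fun i => LinearMap.proj i ∘ₗ W.subtype
  have hφ : Submodule.span ℝ (range φ) = ⊤ := by
    refine eq_top_iff.2 fun ψ _ => mem_span_of_iInf_ker_le_ker fun w hw => ?_
    have : w = 0 := by
      ext i
      simpa [φ] using (Submodule.mem_iInf _).1 hw i
    simp [this]
  have h := exists_abs_coeff_le_one φ hφ
  rw [Subspace.dual_finrank_eq] at h
  obtain ⟨J, hJ⟩ := h
  refine ⟨J, fun v hv i => ?_⟩
  obtain ⟨c, hc, hi⟩ := hJ i
  have hvi : v i = ∑ j, c j * v (J j) := by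
    simpa [φ] using congrArg (fun g => g ⟨v, hv⟩) hi
  rw [hvi]
  refine (Finset.abs_sum_le_sum_abs _ _).trans (Finset.sum_le_sum fun j _ => ?_)
  rw [abs_mul]
  exact mul_le_of_le_one_left (abs_nonneg _) (hc j)

/-- A finite subset of a product of sets of size at most `c` whose differences lie in a subspace
of dimension `m` has at most `c ^ m` elements. -/
theorem card_le_pow_finrank {d c : ℕ} (W : Submodule ℝ (Fin d → ℝ)) (P : Finset (Fin d → ℝ))
    (C : Fin d → Finset ℝ) (hC : ∀ i, (C i).card ≤ c) (hPC : ∀ x ∈ P, ∀ i, x i ∈ C i)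
    (hP : ∀ x ∈ P, ∀ y ∈ P, x - y ∈ W) : P.card ≤ c ^ Module.finrank ℝ W := by
  obtain ⟨J, hJ⟩ := exists_coord_bound W
  calc P.card ≤ (Fintype.piFinset fun j => C (J j)).card := by
        refine Finset.card_le_card_of_injOn (fun x j => x (J j)) (fun x hx => ?_) ?_
        · simpa using fun j => hPC x hx (J j)
        · intro x hx y hy hxy
          ext i
          have h := hJ _ (hP x hx y hy) i
          have h0 : ∑ j, |(x - y) (J j)| = 0 := Finset.sum_eq_zero fun j _ => by
            simpa [sub_eq_zero] using congrFun hxy j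
          rw [h0] at h
          simpa [sub_eq_zero] using abs_nonpos_iff.1 h
    _ = ∏ j, (C (J j)).card := Fintype.card_piFinset _
    _ ≤ ∏ _j : Fin (Module.finrank ℝ W), c := Finset.prod_le_prod' fun j _ => hC _
    _ = c ^ Module.finrank ℝ W := by simp

/-- The real numbers `1, …, n`. -/
def realGrid (n : ℕ) : Finset ℝ := (Finset.Icc 1 n).image (Nat.cast : ℕ → ℝ)

theorem mem_realGrid {n : ℕ} {z : ℝ} :
    z ∈ realGrid n ↔ ∃ a : ℕ, (1 ≤ a ∧ a ≤ n) ∧ (a : ℝ) = z := by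
  simp [realGrid]

theorem card_realGrid (n : ℕ) : (realGrid n).card = n := by
  simp [realGrid, Finset.card_image_of_injective _ Nat.cast_injective]

/-- The span of the differences of points of `E` that are bounded by `R` in every coordinate. -/
def shortSpan {d : ℕ} (E : Finset (Fin d → ℝ)) (R : ℕ) : Submodule ℝ (Fin d → ℝ) :=
  Submodule.span ℝ {v | (∃ y ∈ E, ∃ y' ∈ E, v = y - y') ∧ ∀ i, |v i| ≤ R}

theorem sub_mem_shortSpan {d : ℕ} {E : Finset (Fin d → ℝ)} {R : ℕ} {y y' : Fin d → ℝ}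
    (hy : y ∈ E) (hy' : y' ∈ E) (h : ∀ i, |y i - y' i| ≤ R) : y - y' ∈ shortSpan E R :=
  Submodule.subset_span ⟨⟨y, hy, y', hy', rfl⟩, h⟩

theorem shortSpan_le {d : ℕ} {E : Finset (Fin d → ℝ)} {R : ℕ} {V : Submodule ℝ (Fin d → ℝ)}
    (hV : ∀ y ∈ E, ∀ y' ∈ E, y - y' ∈ V) : shortSpan E R ≤ V := by
  refine Submodule.span_le.2 ?_
  rintro _ ⟨⟨y, hy, y', hy', rfl⟩, -⟩
  exact hV y hy y' hy'

/-- The set of points of `E` in a box of side length `r` around the controlling coordinates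
of a point has size governed by the rank of the short differences. -/
theorem card_filter_floor_div_le {d n r R : ℕ} (hr : 0 < r) (E : Finset (Fin d → ℝ))
    (hE : ∀ y ∈ E, ∀ i, y i ∈ realGrid n) {V : Submodule ℝ (Fin d → ℝ)}
    (hV : ∀ y ∈ E, ∀ y' ∈ E, y - y' ∈ V) (J : Fin (Module.finrank ℝ V) → Fin d)
    (hJ : ∀ v ∈ V, ∀ i, |v i| ≤ ∑ j, |v (J j)|) (hR : Module.finrank ℝ V * r ≤ R)
    (b : Fin (Module.finrank ℝ V) → ℕ) :
    (E.filter fun y => (fun j => ⌊y (J j)⌋₊ / r) = b).card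
      ≤ (2 * (Module.finrank ℝ V * r) + 1) ^ Module.finrank ℝ (shortSpan E R) := by
  classical
  set P := E.filter fun y => (fun j => ⌊y (J j)⌋₊ / r) = b with hPdef
  have hclose : ∀ y ∈ P, ∀ y' ∈ P, ∀ i,
      |y i - y' i| ≤ ((Module.finrank ℝ V * r : ℕ) : ℝ) := by
    intro y hy y' hy' i
    rw [hPdef, Finset.mem_filter] at hy hy'
    refine (hJ _ (hV y hy.1 y' hy'.1) i).trans ?_
    calc ∑ j, |(y - y') (J j)| ≤ ∑ _j : Fin (Module.finrank ℝ V), (r : ℝ) := by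
          refine Finset.sum_le_sum fun j _ => ?_
          obtain ⟨a, -, ha⟩ := mem_realGrid.1 (hE y hy.1 (J j))
          obtain ⟨a', -, ha'⟩ := mem_realGrid.1 (hE y' hy'.1 (J j))
          have h1 : a / r = a' / r := by
            have := congrFun (hy.2.trans hy'.2.symm) j
            simpa [← ha, ← ha'] using this
          have h2 : a < a' + r ∧ a' < a + r := by
            have h3 := Nat.div_add_mod a r
            have h4 := Nat.div_add_mod a' r
            have h5 := Nat.mod_lt a hr
            have h6 := Nat.mod_lt a' hr
            rw [h1] at h3
            omega
          have h7 : (a : ℝ) < a' + r := by exact_mod_cast h2.1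
          have h8 : (a' : ℝ) < a + r := by exact_mod_cast h2.2
          rw [Pi.sub_apply, ← ha, ← ha', abs_le]
          constructor <;> linarith
      _ = _ := by simp
  rcases P.eq_empty_or_nonempty with h0 | ⟨y₀, hy₀⟩
  · simp [h0]
  refine card_le_pow_finrank _ P
    (fun i => (Finset.Icc (-((Module.finrank ℝ V * r : ℕ) : ℤ)) (Module.finrank ℝ V * r : ℕ)).image
      fun a : ℤ => y₀ i + a) (fun i => ?_) (fun y hy i => ?_) (fun y hy y' hy' => ?_)
  · refine Finset.card_image_le.trans ?_
    rw [Int.card_Icc]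
    omega
  · obtain ⟨a, -, ha⟩ := mem_realGrid.1 (hE y (Finset.mem_filter.1 hy).1 i)
    obtain ⟨a', -, ha'⟩ := mem_realGrid.1 (hE y₀ (Finset.mem_filter.1 hy₀).1 i)
    have h := hclose y hy y₀ hy₀ i
    rw [← ha, ← ha', abs_le] at h
    refine Finset.mem_image.2 ⟨(a : ℤ) - a', Finset.mem_Icc.2 ⟨?_, ?_⟩, ?_⟩
    · exact_mod_cast h.1
    · exact_mod_cast h.2
    · rw [← ha, ← ha']
      push_cast
      ring
  · exact sub_mem_shortSpan (Finset.mem_filter.1 hy).1 (Finset.mem_filter.1 hy').1 fun i =>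
      (hclose y hy y' hy' i).trans (by exact_mod_cast hR)

/-- If `E` fills a fraction at least `1 / Q` of the maximal possible number `n ^ t` of grid points
of a `t`-dimensional subspace, then all of its differences are spanned by short ones. -/
theorem sub_mem_shortSpan_of_le_mul_card {d n t Q r : ℕ} (ht : 0 < t)
    (hr : r = (6 * d) ^ d * Q + 1) (E : Finset (Fin d → ℝ))
    (hE : ∀ y ∈ E, ∀ i, y i ∈ realGrid n) {V : Submodule ℝ (Fin d → ℝ)}
    (hVt : Module.finrank ℝ V = t) (hV : ∀ y ∈ E, ∀ y' ∈ E, y - y' ∈ V)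
    (hcard : n ^ t ≤ Q * E.card) {y y' : Fin d → ℝ} (hy : y ∈ E) (hy' : y' ∈ E) :
    y - y' ∈ shortSpan E (d * r) := by
  classical
  have hr0 : 0 < r := by omega
  have htd : t ≤ d := by
    simpa [hVt] using V.finrank_le
  rcases lt_or_ge n r with hnr | hrn
  · refine sub_mem_shortSpan hy hy' fun i => ?_
    obtain ⟨a, ha1, ha⟩ := mem_realGrid.1 (hE y hy i)
    obtain ⟨a', ha1', ha'⟩ := mem_realGrid.1 (hE y' hy' i)
    have h1 : n ≤ d * r := hnr.le.trans (Nat.le_mul_of_pos_left r (by omega))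
    have h2 : a ≤ d * r + a' := by omega
    have h3 : a' ≤ d * r + a := by omega
    have h4 : (a : ℝ) ≤ (d * r : ℕ) + a' := by exact_mod_cast h2
    have h5 : (a' : ℝ) ≤ (d * r : ℕ) + a := by exact_mod_cast h3
    rw [← ha, ← ha', abs_le]
    constructor <;> linarith
  have hle : shortSpan E (d * r) ≤ V := shortSpan_le hV
  by_contra hcon
  have hlt : Module.finrank ℝ (shortSpan E (d * r)) < t := by
    by_contra! h
    exact hcon (Submodule.eq_of_le_of_finrank_le hle (hVt.trans_le h) ▸ hV y hy y' hy')
  obtain ⟨J, hJ⟩ := exists_coord_bound V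
  have hbox : E.card ≤ (3 * (t * r)) ^ (t - 1) * (n / r + 1) ^ t := by
    have h := Finset.card_le_mul_card_image_of_maps_to
      (s := E) (t := Fintype.piFinset fun _ : Fin (Module.finrank ℝ V) => Finset.range (n / r + 1))
      (f := fun y j => ⌊y (J j)⌋₊ / r) (fun z hz => by
        rw [Fintype.mem_piFinset]
        intro j
        obtain ⟨a, ha1, ha⟩ := mem_realGrid.1 (hE z hz (J j))
        rw [Finset.mem_range, Nat.lt_succ_iff, ← ha, Nat.floor_natCast]
        exact Nat.div_le_div_right ha1.2) ((3 * (t * r)) ^ (t - 1)) (fun b _ => by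
        refine (card_filter_floor_div_le hr0 E hE hV J hJ
          (R := d * r) (by rw [hVt]; exact Nat.mul_le_mul_right r htd) b).trans ?_
        rw [hVt]
        have h1 : 0 < t * r := Nat.mul_pos ht hr0
        exact (Nat.pow_le_pow_left (by omega) _).trans
          (Nat.pow_le_pow_right (by omega) (by omega)))
    simpa [Fintype.card_piFinset, hVt] using h
  have hE0 : 0 < E.card := Finset.card_pos.2 ⟨y, hy⟩
  have hrdiv : r * (n / r + 1) ≤ 2 * n := by
    have := Nat.mul_div_le n r
    rw [mul_add]
    omega
  obtain ⟨s, rfl⟩ : ∃ s, t = s + 1 := ⟨t - 1, by omega⟩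
  rw [Nat.add_sub_cancel] at hbox
  have h1 : r ^ s * (r * E.card) ≤ r ^ s * ((6 * d) ^ d * Q * E.card) := by
    calc r ^ s * (r * E.card) = r ^ (s + 1) * E.card := by ring
      _ ≤ r ^ (s + 1) * ((3 * ((s + 1) * r)) ^ s * (n / r + 1) ^ (s + 1)) :=
        Nat.mul_le_mul_left _ hbox
      _ = (3 * ((s + 1) * r)) ^ s * (r * (n / r + 1)) ^ (s + 1) := by rw [mul_pow r]; ring
      _ ≤ (3 * ((s + 1) * r)) ^ s * (2 * n) ^ (s + 1) :=
        Nat.mul_le_mul_left _ (Nat.pow_le_pow_left hrdiv _)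
      _ = r ^ s * ((3 * (s + 1)) ^ s * 2 ^ (s + 1) * n ^ (s + 1)) := by
        rw [← mul_assoc 3, mul_pow _ r, mul_pow 2]; ring
      _ ≤ r ^ s * ((6 * d) ^ d * (Q * E.card)) := by
        refine Nat.mul_le_mul_left _ (Nat.mul_le_mul ?_ hcard)
        calc (3 * (s + 1)) ^ s * 2 ^ (s + 1) ≤ (3 * (s + 1)) ^ (s + 1) * 2 ^ (s + 1) :=
              Nat.mul_le_mul_right _ (Nat.pow_le_pow_right (by omega) (by omega))
          _ = (6 * (s + 1)) ^ (s + 1) := by rw [← mul_pow]; congr 1; ring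
          _ ≤ (6 * d) ^ (s + 1) := Nat.pow_le_pow_left (by omega) _
          _ ≤ (6 * d) ^ d := Nat.pow_le_pow_right (by omega) htd
      _ = _ := by ring
  have h2 := Nat.le_of_mul_le_mul_right (Nat.le_of_mul_le_mul_left h1 (by positivity)) hE0
  omega

/-- The span of short differences of grid points has an integral spanning family
with small entries. -/
theorem exists_span_eq_shortSpan {d n R : ℕ} (E : Finset (Fin d → ℝ))
    (hE : ∀ y ∈ E, ∀ i, y i ∈ realGrid n) :
    ∃ g ∈ Fintype.piFinset fun _ : Fin d => Fintype.piFinset fun _ : Fin d =>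
        Finset.Icc (-(R : ℤ)) R,
      shortSpan E R = Submodule.span ℝ (range fun j i => ((g j i : ℤ) : ℝ)) := by
  classical
  unfold shortSpan
  set s := {v : Fin d → ℝ | (∃ y ∈ E, ∃ y' ∈ E, v = y - y') ∧ ∀ i, |v i| ≤ R}
  have hint : ∀ v ∈ s,
      ∃ a : Fin d → ℤ, (∀ i, a i ∈ Finset.Icc (-(R : ℤ)) R) ∧ v = fun i => (a i : ℝ) := by
    rintro _ ⟨⟨y, hy, y', hy', rfl⟩, hv⟩
    choose a _ ha using fun i => mem_realGrid.1 (hE y hy i)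
    choose a' _ ha' using fun i => mem_realGrid.1 (hE y' hy' i)
    refine ⟨fun i => a i - a' i, fun i => ?_, ?_⟩
    · have h := hv i
      rw [Pi.sub_apply, ← ha, ← ha', abs_le] at h
      rw [Finset.mem_Icc]
      exact ⟨by exact_mod_cast h.1, by exact_mod_cast h.2⟩
    · ext i
      simp [ha, ha']
  obtain ⟨f, hf, hfs, -⟩ := Submodule.exists_fun_fin_finrank_span_eq ℝ s
  have hm : Module.finrank ℝ (Submodule.span ℝ s) ≤ d := by
    simpa using (Submodule.span ℝ s).finrank_le
  choose a ha hfa using fun j => hint _ (hf j)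
  refine ⟨fun j => if h : (j : ℕ) < Module.finrank ℝ (Submodule.span ℝ s) then a ⟨j, h⟩ else 0,
    ?_, ?_⟩
  · rw [Fintype.mem_piFinset]
    intro j
    rw [Fintype.mem_piFinset]
    intro i
    split_ifs with h
    · exact ha _ i
    · simp
  · refine hfs.symm.trans (le_antisymm (Submodule.span_mono ?_) (Submodule.span_le.2 ?_))
    · rintro _ ⟨j, rfl⟩
      refine ⟨⟨j, j.2.trans_le hm⟩, ?_⟩
      have hj : (j : ℕ) < Module.finrank ℝ (Submodule.span ℝ s) := j.2
      simp only [hj, dite_true]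
      exact (hfa j).symm
    · rintro _ ⟨j, rfl⟩
      by_cases h : (j : ℕ) < Module.finrank ℝ (Submodule.span ℝ s)
      · simp only [h, dite_true]
        exact Submodule.subset_span ⟨⟨j, h⟩, hfa _⟩
      · simp only [h, dite_false, Pi.zero_apply, Int.cast_zero]
        exact Submodule.zero_mem _

/-- Through a given point there are only polynomially many (in `Q`) traces on the grid of
`t`-dimensional affine subspaces having at least `n ^ t / Q` points. -/
theorem card_rich_traces_le {d n t Q : ℕ} (ht : 0 < t) (hn : 0 < n) (X : Finset (Fin d → ℝ))
    (hX : ∀ y ∈ X, ∀ i, y i ∈ realGrid n) (𝓔 : Finset (Finset (Fin d → ℝ)))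
    (h𝓔 : ∀ E ∈ 𝓔, ∃ F, IsAffineOfDim d t F ∧ ∀ y, y ∈ E ↔ y ∈ X ∧ y ∈ F) (x : Fin d → ℝ) :
    (𝓔.filter fun E => x ∈ E ∧ n ^ t ≤ Q * E.card).card
      ≤ ((2 * (d * ((6 * d) ^ d + 1)) + 1) * Q) ^ (d * d) := by
  classical
  rcases Nat.eq_zero_or_pos Q with rfl | hQ
  · have h : 0 < n ^ t := by positivity
    rw [Finset.filter_false_of_mem fun E _ hE => by omega]
    simp
  set r := (6 * d) ^ d * Q + 1 with hr
  set 𝓖 := Fintype.piFinset fun _ : Fin d => Fintype.piFinset fun _ : Fin d =>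
        Finset.Icc (-((d * r : ℕ) : ℤ)) (d * r : ℕ) with h𝓖
  have hsub : (𝓔.filter fun E => x ∈ E ∧ n ^ t ≤ Q * E.card) ⊆ 𝓖.image fun g =>
      X.filter fun y => y - x ∈ Submodule.span ℝ (range fun j i => ((g j i : ℤ) : ℝ)) := by
    intro E hE
    obtain ⟨hE𝓔, hxE, hcard⟩ := Finset.mem_filter.1 hE
    obtain ⟨F, hF, hEF⟩ := h𝓔 E hE𝓔
    have hEX : ∀ y ∈ E, ∀ i, y i ∈ realGrid n := fun y hy => hX y ((hEF y).1 hy).1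
    have hEV : ∀ y ∈ E, ∀ y' ∈ E, y - y' ∈ F.direction := fun y hy y' hy' =>
      AffineSubspace.vsub_mem_direction ((hEF y).1 hy).2 ((hEF y').1 hy').2
    obtain ⟨g, hg, hgs⟩ := exists_span_eq_shortSpan (R := d * r) E hEX
    refine Finset.mem_image.2 ⟨g, hg, ?_⟩
    ext y
    rw [← hgs, Finset.mem_filter]
    constructor
    · rintro ⟨hyX, hy⟩
      refine (hEF y).2 ⟨hyX, ?_⟩
      have h := AffineSubspace.vadd_mem_of_mem_direction (shortSpan_le hEV hy) ((hEF x).1 hxE).2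
      simpa using h
    · exact fun hy => ⟨((hEF y).1 hy).1,
        sub_mem_shortSpan_of_le_mul_card ht hr E hEX hF hEV hcard hy hxE⟩
  refine (Finset.card_le_card hsub).trans (Finset.card_image_le.trans ?_)
  have h1 : 𝓖.card = (2 * (d * r) + 1) ^ (d * d) := by
    simp only [h𝓖, Fintype.card_piFinset, Int.card_Icc, Finset.prod_const, Finset.card_univ,
      Fintype.card_fin, ← pow_mul]
    congr 1
    omega
  rw [h1]
  refine Nat.pow_le_pow_left ?_ _
  have h2 : d * r ≤ d * ((6 * d) ^ d + 1) * Q := by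
    rw [hr, mul_assoc]
    refine Nat.mul_le_mul_left _ ?_
    rw [add_mul]
    omega
  calc 2 * (d * r) + 1 ≤ 2 * (d * ((6 * d) ^ d + 1) * Q) + Q := by omega
    _ = _ := by ring

theorem mem_gridD_iff {n d : ℕ} {x : Fin d → ℝ} : x ∈ gridD n d ↔ ∀ i, x i ∈ realGrid n := by
  unfold gridD
  simp only [Set.mem_ofPred_eq, mem_realGrid]
  refine forall_congr' fun i => ⟨?_, ?_⟩
  · rintro ⟨a, h1, h2, h3⟩
    lift a to ℕ using by omega
    exact ⟨a, ⟨by omega, by omega⟩, by simpa using h3.symm⟩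
  · rintro ⟨a, ⟨h1, h2⟩, h3⟩
    exact ⟨a, by omega, by omega, by simpa using h3.symm⟩

/-- An axis-aligned `t`-dimensional affine subspace that meets `[n]^d` contains exactly `n ^ t`
of its points. -/
theorem IsAxisAligned.card_eq {d n t : ℕ} (htd : t ≤ d) {F : AffineSubspace ℝ (Fin d → ℝ)}
    (hF : IsAxisAligned d t F) (hne : ((F : Set (Fin d → ℝ)) ∩ gridD n d).Nonempty)
    (E : Finset (Fin d → ℝ)) (hE : ∀ y, y ∈ E ↔ y ∈ gridD n d ∧ y ∈ F) : E.card = n ^ t := by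
  classical
  obtain ⟨I, c, hI, hFc⟩ := hF
  have hmem : ∀ y, y ∈ F ↔ ∀ i ∈ I, y i = c i := fun y => by
    rw [← SetLike.mem_coe, hFc, Set.mem_ofPred_eq]
  obtain ⟨z, hzF, hz⟩ := hne
  rw [SetLike.mem_coe, hmem] at hzF
  rw [mem_gridD_iff] at hz
  have hEpi : E = Fintype.piFinset fun i => if i ∈ I then {c i} else realGrid n := by
    ext y
    rw [hE, mem_gridD_iff, hmem, Fintype.mem_piFinset, ← forall_and]
    refine forall_congr' fun i => ?_
    by_cases hi : i ∈ I
    · simp only [hi, forall_const, if_true, Finset.mem_singleton, and_iff_right_iff_imp]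
      rintro h
      rw [h, ← hzF i hi]
      exact hz i
    · simp [hi]
  have hcard : ∀ i, (if i ∈ I then {c i} else realGrid n).card = if i ∈ I then 1 else n := by
    intro i
    split_ifs
    · simp
    · exact card_realGrid n
  have hIc : (Finset.univ.filter fun i => i ∉ I).card = t := by
    rw [Finset.filter_not, Finset.card_sdiff]
    simp [hI]
    omega
  rw [hEpi, Fintype.card_piFinset, Finset.prod_congr rfl fun i _ => hcard i, Finset.prod_ite]
  simp [hIc]

/-- For every `d ≥ 2` and `ε > 0` there is `K₁ = K₁(ε,d)` such that for all
integers `n, k, t` with `K₁ ≤ k ≤ n^t` and `1 ≤ t ≤ d-1`, there exists `S ⊆ [n]^d` with at most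
`k` points in every `t`-dimensional affine subspace, and at least `(1-ε)k` points in every
axis-aligned `t`-dimensional affine subspace intersecting `[n]^d`. -/
theorem higher_dimensions (d : ℕ) (hd : 2 ≤ d) (ε : ℝ) (hε : 0 < ε) :
    ∃ K₁ : ℕ, ∀ n k t : ℕ, K₁ ≤ k → k ≤ n ^ t → 1 ≤ t → t ≤ d - 1 →
      ∃ S : Set (Fin d → ℝ), S ⊆ gridD n d ∧
        (∀ F : AffineSubspace ℝ (Fin d → ℝ), IsAffineOfDim d t F →
          (S ∩ (F : Set (Fin d → ℝ))).ncard ≤ k) ∧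
        (∀ F : AffineSubspace ℝ (Fin d → ℝ), IsAffineOfDim d t F → IsAxisAligned d t F →
          ((F : Set (Fin d → ℝ)) ∩ gridD n d).Nonempty →
          (1 - ε) * k ≤ ((S ∩ (F : Set (Fin d → ℝ))).ncard : ℝ)) := by
  rcases le_or_gt 1 ε with hε1 | hε1
  · refine ⟨0, fun n k t _ _ _ _ => ⟨∅, Set.empty_subset _, by simp, fun F _ _ _ => ?_⟩⟩
    simpa using mul_nonpos_of_nonpos_of_nonneg (sub_nonpos.2 hε1) k.cast_nonneg
  classical
  obtain ⟨K, hK⟩ := exists_card_inter_le (2 * (d * ((6 * d) ^ d + 1)) + 1) (d * d) ε hε hε1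
  refine ⟨max 1 K, fun n k t hKk hkn ht htd => ?_⟩
  have hnt : 0 < n ^ t := by omega
  have hn : 0 < n := Nat.pos_of_ne_zero fun h => by
    rw [h, zero_pow (by omega)] at hnt
    omega
  set X : Finset (Fin d → ℝ) := Fintype.piFinset fun _ => realGrid n
  have hX : ∀ y, y ∈ X ↔ y ∈ gridD n d := fun y => by
    rw [mem_gridD_iff, Fintype.mem_piFinset]
  set 𝓔 : Finset (Finset (Fin d → ℝ)) :=
    X.powerset.filter fun E => ∃ F, IsAffineOfDim d t F ∧ ∀ y, y ∈ E ↔ y ∈ X ∧ y ∈ F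
  have htrace : ∀ F, IsAffineOfDim d t F → (X.filter fun y => y ∈ F) ∈ 𝓔 := fun F hF =>
    Finset.mem_filter.2 ⟨Finset.mem_powerset.2 (Finset.filter_subset _ _), F, hF, fun y => by simp⟩
  obtain ⟨T, hTX, hT, hT'⟩ := hK (Fin d → ℝ) 𝓔 (𝓔.filter fun E => E.card = n ^ t) X (n ^ t) hnt
    (Finset.filter_subset _ _) (fun E hE => (Finset.mem_filter.1 hE).2)
    (fun E hE => by
      obtain ⟨F, hF, hEF⟩ := (Finset.mem_filter.1 hE).2
      rw [← hF]
      exact card_le_pow_finrank F.direction E (fun _ => realGrid n) (fun _ => (card_realGrid n).le)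
        (fun y hy => mem_gridD_iff.1 ((hX y).1 ((hEF y).1 hy).1)) fun y hy y' hy' =>
          AffineSubspace.vsub_mem_direction ((hEF y).1 hy).2 ((hEF y').1 hy').2)
    (fun E hE => Finset.mem_powerset.1 (Finset.mem_filter.1 hE).1)
    (fun Q x => card_rich_traces_le (by omega) hn X (fun y hy => mem_gridD_iff.1 ((hX y).1 hy)) 𝓔
      (fun E hE => (Finset.mem_filter.1 hE).2) x) k (by omega) hkn
  have hncard : ∀ F : AffineSubspace ℝ (Fin d → ℝ),
      ((T : Set (Fin d → ℝ)) ∩ F).ncard = (T ∩ X.filter fun y => y ∈ F).card := fun F => by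
    rw [← Set.ncard_coe_finset]
    congr 1
    ext y
    simp only [Set.mem_inter_iff, Finset.coe_inter, Finset.mem_filter,
      SetLike.mem_coe]
    exact and_congr_right fun hy => (and_iff_right (hTX hy)).symm
  refine ⟨T, fun y hy => (hX y).1 (hTX hy), fun F hF => ?_, fun F hF hFa hne => ?_⟩
  · rw [hncard]
    exact hT _ (htrace F hF)
  · rw [hncard]
    refine hT' _ (Finset.mem_filter.2 ⟨htrace F hF, hFa.card_eq (by omega) hne _ fun y => ?_⟩)
    rw [Finset.mem_filter, hX]
end
end
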